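/- For every d ≥ 2 and all integers n_1, n_2, n_3 ≥ d+1 there exist three d-polytopes P_1, P_2, P_3 in ℝ^d with f_0(P_i) = n_i such that for every 1 ≤ k ≤ d, f_{k−1}(P_1+P_2+P_3) = f_{k+1}(C_{d+2}(n_{[3]})) − Σ_{i=0}^{⌊(d+2)/2⌋} C(d+2−i, k+2−i) · Σ_{∅⊂S⊊[3]} (−1)^{|S|} C(n_S−d−3+i, i) − (d−2⌊d/2⌋) · C(⌊d/2⌋+1, k−⌊d/2⌋) · Σ_{i=1}^{3} C(n_i−⌊d/2⌋−2, ⌊d/2⌋+1), where [3] = {1,2,3} and n_S = Σ_{i∈S} n_i; i.e., the upper bound on the number of (k−1)-faces of the Minkowski sum of three d-polytopes is attained simultaneously for all k. -/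

import Mathlib

open Finset Pointwise

noncomputable section

/-- The ambient space `ℝ^d`. -/
abbrev Vec (d : ℕ) := Fin d → ℝ

/-- Dimension of a set of points: the dimension of its affine span,
with the convention that the empty set has dimension `-1`. -/
noncomputable def sdim {D : ℕ} (s : Set (Vec D)) : ℤ :=
  open scoped Classical in
  if s = ∅ then -1 else (Module.finrank ℝ (affineSpan ℝ s).direction : ℤ)

/-- `F` is a proper (nonempty) face of `P`: a nonempty exposed face distinct from `P`. -/
def IsProperFace {D : ℕ} (P F : Set (Vec D)) : Prop :=
  IsExposed ℝ P F ∧ F.Nonempty ∧ F ≠ P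

/-- The number of `k`-dimensional (proper, nonempty) faces of `P`. -/
noncomputable def fPoly {D : ℕ} (P : Set (Vec D)) (k : ℤ) : ℕ :=
  Nat.card {F : Set (Vec D) // IsProperFace P F ∧ sdim F = k}

/-- `P` is the (convex) polytope with vertex set `V`. -/
def IsPolytopeWithVertexSet {D : ℕ} (P : Set (Vec D)) (V : Finset (Vec D)) : Prop :=
  P = convexHull ℝ (V : Set (Vec D)) ∧
    ∀ v ∈ V, v ∉ convexHull ℝ ((V.erase v : Finset (Vec D)) : Set (Vec D))

/-- The (generalized) binomial coefficient `C(a,b)` for integers `a b`, equal to `0`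
for `b < 0` (and, in particular, equal to `0` when `b > a ≥ 0`). -/
noncomputable def ch (a b : ℤ) : ℤ := if 0 ≤ b then Ring.choose a b.toNat else 0

/-- The moment curve in `ℝ^m`. -/
def momentCurve (m : ℕ) (t : ℝ) : Vec m := fun i => t ^ ((i : ℕ) + 1)

/-- The cyclic polytope `C_m(N)`: the convex hull of `N` distinct points on the
moment curve in `ℝ^m`. -/
noncomputable def cyclicPolytope (m N : ℕ) : Set (Vec m) :=
  convexHull ℝ (Set.range fun j : Fin N => momentCurve m ((j : ℕ) + 1))

/-- The upper bound expression for `f_{k-1}(P₁+P₂+P₃)` from Theorem `thm:ms3ub`. -/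
noncomputable def UB3 (d : ℕ) (n : Fin 3 → ℕ) (k : ℕ) : ℤ :=
  (fPoly (cyclicPolytope (d + 2) (n 0 + n 1 + n 2)) ((k : ℤ) + 1) : ℤ) -
    (∑ i ∈ Finset.range ((d + 2) / 2 + 1),
      ch ((d : ℤ) + 2 - (i : ℤ)) ((k : ℤ) + 2 - (i : ℤ)) *
        ∑ S ∈ (Finset.univ : Finset (Fin 3)).powerset.filter
            (fun S => S ≠ ∅ ∧ S ≠ Finset.univ),
          (-1 : ℤ) ^ S.card * ch ((∑ j ∈ S, (n j : ℤ)) - (d : ℤ) - 3 + (i : ℤ)) (i : ℤ)) -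
    ((d : ℤ) - 2 * ((d / 2 : ℕ) : ℤ)) *
      ch (((d / 2 : ℕ) : ℤ) + 1) ((k : ℤ) - ((d / 2 : ℕ) : ℤ)) *
      ∑ i : Fin 3, ch ((n i : ℤ) - ((d / 2 : ℕ) : ℤ) - 2) (((d / 2 : ℕ) : ℤ) + 1)

set_option linter.unusedSectionVars false

namespace SignCells

open Classical in
/-- The sign vectors realised by a finite family of linear functionals. -/
def realized {E J : Type*} [AddCommGroup E] [Module ℝ E] [Fintype J]
    (ℓ : J → E →ₗ[ℝ] ℝ) : Finset (J → SignType) :=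
  univ.filter fun s => ∃ u, (fun j => SignType.sign (ℓ j u)) = s

/-- The common kernel of the functionals in `K` whose prescribed sign is `0`. -/
def zeroSpace {E J : Type*} [AddCommGroup E] [Module ℝ E]
    (ℓ : J → E →ₗ[ℝ] ℝ) (K : Finset J) (s : J → SignType) : Submodule ℝ E :=
  ⨅ j ∈ {j | j ∈ K ∧ s j = 0}, LinearMap.ker (ℓ j)

/-- The weight `(-1)^dim` of a cell. -/
def weight {E J : Type*} [AddCommGroup E] [Module ℝ E] [Fintype J]
    (ℓ : J → E →ₗ[ℝ] ℝ) (s : J → SignType) : ℤ :=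
  (-1) ^ Module.finrank ℝ (zeroSpace ℓ univ s)

variable {E J : Type*} [AddCommGroup E] [Module ℝ E] {ℓ : J → E →ₗ[ℝ] ℝ}

lemma mem_zeroSpace {K : Finset J} {s : J → SignType} {u : E} :
    u ∈ zeroSpace ℓ K s ↔ ∀ j ∈ K, s j = 0 → ℓ j u = 0 := by
  simp [zeroSpace, Submodule.mem_iInf]

lemma zeroSpace_congr {K : Finset J} {s s' : J → SignType} (h : ∀ j ∈ K, s j = s' j) :
    zeroSpace ℓ K s = zeroSpace ℓ K s' := by
  ext u
  simp only [mem_zeroSpace]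
  exact forall₂_congr fun j hj => by rw [h j hj]

/-- Moving slightly inside the zero space does not change the signs in `K`. -/
lemma exists_small_move (K : Finset J) (u z : E)
    (hz : z ∈ zeroSpace ℓ K (fun j => SignType.sign (ℓ j u))) :
    ∃ δ : ℝ, 0 < δ ∧ ∀ j ∈ K, SignType.sign (ℓ j (u + δ • z)) = SignType.sign (ℓ j u) ∧
      SignType.sign (ℓ j (u - δ • z)) = SignType.sign (ℓ j u) := by
  have key : ∀ j ∈ K, ∀ᶠ δ : ℝ in nhds 0,
      SignType.sign (ℓ j (u + δ • z)) = SignType.sign (ℓ j u) ∧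
      SignType.sign (ℓ j (u - δ • z)) = SignType.sign (ℓ j u) := by
    intro j hj
    have h1 : Filter.Tendsto (fun δ : ℝ => ℓ j u + δ * ℓ j z) (nhds 0) (nhds (ℓ j u)) := by
      have : Continuous fun δ : ℝ => ℓ j u + δ * ℓ j z := by fun_prop
      simpa using this.tendsto 0
    have h2 : Filter.Tendsto (fun δ : ℝ => ℓ j u - δ * ℓ j z) (nhds 0) (nhds (ℓ j u)) := by
      have : Continuous fun δ : ℝ => ℓ j u - δ * ℓ j z := by fun_prop
      simpa using this.tendsto 0
    simp only [map_add, map_sub, map_smul, smul_eq_mul]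
    rcases lt_trichotomy (ℓ j u) 0 with h | h | h
    · filter_upwards [h1.eventually (gt_mem_nhds h), h2.eventually (gt_mem_nhds h)] with δ a b
      rw [sign_neg a, sign_neg b, sign_neg h]; simp
    · have := mem_zeroSpace.1 hz j hj (by simp [h])
      simp [this]
    · filter_upwards [h1.eventually (lt_mem_nhds h), h2.eventually (lt_mem_nhds h)] with δ a b
      rw [sign_pos a, sign_pos b, sign_pos h]; simp
  have h3 : ∀ᶠ δ : ℝ in nhds 0, ∀ j ∈ K,
      SignType.sign (ℓ j (u + δ • z)) = SignType.sign (ℓ j u) ∧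
      SignType.sign (ℓ j (u - δ • z)) = SignType.sign (ℓ j u) :=
    (Filter.eventually_all_finset K).2 key
  have h4 := (h3.filter_mono (nhdsWithin_le_nhds (s := Set.Ioi 0))).and
    (self_mem_nhdsWithin (a := (0:ℝ)) (s := Set.Ioi 0))
  obtain ⟨δ, h, hpos⟩ := h4.exists
  exact ⟨δ, hpos, h⟩

lemma finrank_inf_ker [FiniteDimensional ℝ E] (Z : Submodule ℝ E) (f : E →ₗ[ℝ] ℝ) {z : E}
    (hz : z ∈ Z) (hf : f z ≠ 0) :
    Module.finrank ℝ Z = Module.finrank ℝ (Z ⊓ LinearMap.ker f : Submodule ℝ E) + 1 := by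
  have h := LinearMap.finrank_range_add_finrank_ker (f.domRestrict Z)
  have h1 : LinearMap.range (f.domRestrict Z) = ⊤ := by
    refine LinearMap.range_eq_top.2 (LinearMap.surjective ?_)
    intro h0
    exact hf (by simpa using LinearMap.congr_fun h0 ⟨z, hz⟩)
  have h2 : Module.finrank ℝ (LinearMap.ker (f.domRestrict Z)) =
      Module.finrank ℝ (Z ⊓ LinearMap.ker f : Submodule ℝ E) := by
    rw [← Submodule.finrank_map_subtype_eq, LinearMap.ker_domRestrict,
      Submodule.map_comap_subtype]
  rw [h1, finrank_top, h2] at h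
  simp at h
  omega

variable [Fintype J]

open Classical in
/-- The part of the cell sum on which the functionals in `K` have the signs they have at `u`. -/
def cellSum (ℓ : J → E →ₗ[ℝ] ℝ) (K : Finset J) (τ : J → SignType) : ℤ :=
  ∑ s ∈ (realized ℓ).filter (fun s => ∀ j ∈ K, s j = τ j), weight ℓ s

lemma cellSum_congr {K : Finset J} {s s' : J → SignType} (h : ∀ j ∈ K, s j = s' j) :
    cellSum ℓ K s = cellSum ℓ K s' := by
  unfold cellSum
  congr 1
  ext t
  simp only [mem_filter]
  refine and_congr_right fun _ => forall₂_congr fun j hj => by rw [h j hj]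

open Classical in
lemma cellSum_split {K : Finset J} {τ : J → SignType} {j : J} (hj : j ∉ K) :
    cellSum ℓ K τ = ∑ σ : SignType, cellSum ℓ (insert j K) (Function.update τ j σ) := by
  unfold cellSum
  rw [← Finset.sum_fiberwise (g := fun s => s j)]
  refine Finset.sum_congr rfl fun σ _ => Finset.sum_congr ?_ fun _ _ => rfl
  ext s
  simp only [mem_filter, mem_insert, forall_eq_or_imp, Function.update_self, and_assoc]
  refine and_congr_right fun _ => ?_
  rw [and_comm]
  refine and_congr_right fun _ => forall₂_congr fun i hi => ?_
  rw [Function.update_of_ne (by rintro rfl; exact hj hi)]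

lemma cellSum_eq_zero {K : Finset J} {τ : J → SignType}
    (h : ∀ u, ¬ ∀ j ∈ K, SignType.sign (ℓ j u) = τ j) : cellSum ℓ K τ = 0 := by
  classical
  unfold cellSum
  rw [Finset.filter_false_of_mem, Finset.sum_empty]
  intro s hs h'
  simp only [realized, mem_filter, mem_univ, true_and] at hs
  obtain ⟨u, rfl⟩ := hs
  exact h u h'

variable [FiniteDimensional ℝ E]

/-- The alternating sum over the cells of an arrangement contained in a relatively open cell. -/
theorem cellSum_eq (K : Finset J) (u : E) :
    cellSum ℓ K (fun j => SignType.sign (ℓ j u)) =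
      (-1) ^ Module.finrank ℝ (zeroSpace ℓ K (fun j => SignType.sign (ℓ j u))) := by
  classical
  induction hk : Kᶜ.card generalizing K u with
  | zero =>
    have hK : K = univ := by
      rw [Finset.card_eq_zero, Finset.compl_eq_empty_iff] at hk; exact hk
    subst hK
    unfold cellSum
    rw [Finset.sum_eq_single_of_mem (fun j => SignType.sign (ℓ j u))]
    · rfl
    · simp [realized]
    · intro s hs hne
      simp only [mem_filter, mem_univ, true_imp_iff] at hs
      exact absurd (funext hs.2) hne
  | succ m ih =>
    obtain ⟨j, hj⟩ : Kᶜ.Nonempty := by rw [← Finset.card_pos]; omega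
    have hjK : j ∉ K := by simpa using hj
    have hcard : (insert j K)ᶜ.card = m := by
      rw [Finset.compl_insert, Finset.card_erase_of_mem hj, hk]; rfl
    set τ : J → SignType := fun j => SignType.sign (ℓ j u) with hτ
    -- value of a nonempty subcell
    have sub : ∀ (σ : SignType) (u₁ : E), (∀ i ∈ K, SignType.sign (ℓ i u₁) = τ i) →
        SignType.sign (ℓ j u₁) = σ →
        cellSum ℓ (insert j K) (Function.update τ j σ) =
          (-1) ^ Module.finrank ℝ (zeroSpace ℓ (insert j K) (Function.update τ j σ)) := by
      intro σ u₁ h1 h2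
      have e : ∀ i ∈ insert j K, Function.update τ j σ i = SignType.sign (ℓ i u₁) := by
        intro i hi
        rcases eq_or_ne i j with rfl | hij
        · simp [h2]
        · rw [Function.update_of_ne hij, h1 i (by simpa [hij] using hi)]
      rw [cellSum_congr e, zeroSpace_congr e]
      exact ih _ _ hcard
    have zero_ne : ∀ σ : SignType, σ ≠ 0 →
        zeroSpace ℓ (insert j K) (Function.update τ j σ) = zeroSpace ℓ K τ := by
      intro σ hσ
      ext z
      simp only [mem_zeroSpace, mem_insert, forall_eq_or_imp, Function.update_self, hσ,
        false_imp_iff, true_and]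
      refine forall₂_congr fun i hi => ?_
      rw [Function.update_of_ne (by rintro rfl; exact hjK hi)]
    have zero_eq : zeroSpace ℓ (insert j K) (Function.update τ j 0) =
        zeroSpace ℓ K τ ⊓ LinearMap.ker (ℓ j) := by
      ext z
      simp only [mem_zeroSpace, mem_insert, forall_eq_or_imp, Function.update_self,
        true_imp_iff, Submodule.mem_inf, LinearMap.mem_ker]
      rw [and_comm]
      refine and_congr_left fun _ => forall₂_congr fun i hi => ?_
      rw [Function.update_of_ne (by rintro rfl; exact hjK hi)]
    have memZ : ∀ u₁ : E, (∀ i ∈ K, SignType.sign (ℓ i u₁) = τ i) → u₁ ∈ zeroSpace ℓ K τ := by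
      intro u₁ h
      refine mem_zeroSpace.2 fun i hi h0 => ?_
      rw [← h i hi, sign_eq_zero_iff] at h0
      exact h0
    have empt : ∀ σ : SignType, (¬ ∃ u₁, (∀ i ∈ K, SignType.sign (ℓ i u₁) = τ i) ∧
        SignType.sign (ℓ j u₁) = σ) →
        cellSum ℓ (insert j K) (Function.update τ j σ) = 0 := by
      intro σ h
      refine cellSum_eq_zero fun u₁ h1 => h ⟨u₁, fun i hi => ?_, ?_⟩
      · rw [h1 i (by simp [hi]), Function.update_of_ne (by rintro rfl; exact hjK hi)]
      · simpa using h1 j (by simp)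
    rw [cellSum_split hjK]
    have hsum : ∀ g : SignType → ℤ, ∑ σ, g σ = g 0 + g 1 + g (-1) := by
      intro g
      have : (univ : Finset SignType) = {0, 1, -1} := by decide
      rw [this]; simp [add_assoc]
    rw [hsum]
    by_cases hv : ∀ z ∈ zeroSpace ℓ K τ, ℓ j z = 0
    · have h0 : SignType.sign (ℓ j u) = 0 := by
        rw [hv u (memZ u fun _ _ => rfl), sign_zero]
      rw [sub 0 u (fun _ _ => rfl) h0, empt 1, empt (-1), zero_eq]
      · have : zeroSpace ℓ K τ ⊓ LinearMap.ker (ℓ j) = zeroSpace ℓ K τ :=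
          inf_eq_left.2 fun z hz => hv z hz
        rw [this]; ring
      · rintro ⟨u₁, h1, h2⟩
        rw [hv u₁ (memZ u₁ h1)] at h2; simp at h2
      · rintro ⟨u₁, h1, h2⟩
        rw [hv u₁ (memZ u₁ h1)] at h2; simp at h2
    push Not at hv
    obtain ⟨z, hz, hz0⟩ := hv
    wlog hzpos : 0 < ℓ j z generalizing z
    · exact this (-z) (neg_mem hz) (by simpa using hz0)
        (by simp; exact lt_of_le_of_ne (not_lt.1 hzpos) hz0)
    by_cases hex : ∃ u₁, (∀ i ∈ K, SignType.sign (ℓ i u₁) = τ i) ∧ SignType.sign (ℓ j u₁) = 0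
    · obtain ⟨u₁, h1, h2⟩ := hex
      have hz' : z ∈ zeroSpace ℓ K (fun i => SignType.sign (ℓ i u₁)) := by
        rwa [zeroSpace_congr h1]
      obtain ⟨δ, hδ, hm⟩ := exists_small_move K u₁ z hz'
      have h20 : ℓ j u₁ = 0 := sign_eq_zero_iff.1 h2
      rw [sub 0 u₁ h1 h2,
        sub 1 (u₁ + δ • z) (fun i hi => by rw [(hm i hi).1, h1 i hi])
          (by simp only [map_add, map_smul, h20, smul_eq_mul, zero_add]
              exact sign_pos (mul_pos hδ hzpos)),
        sub (-1) (u₁ - δ • z) (fun i hi => by rw [(hm i hi).2, h1 i hi])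
          (by simp only [map_sub, map_smul, h20, smul_eq_mul, zero_sub]
              exact sign_neg (neg_neg_of_pos (mul_pos hδ hzpos))),
        zero_ne 1 (by decide), zero_ne (-1) (by decide), zero_eq,
        finrank_inf_ker _ (ℓ j) hz hz0]
      ring
    · have hu0 : SignType.sign (ℓ j u) ≠ 0 := fun h => hex ⟨u, fun _ _ => rfl, h⟩
      have hconv : ∀ u₁, (∀ i ∈ K, SignType.sign (ℓ i u₁) = τ i) →
          SignType.sign (ℓ j u₁) ≠ - SignType.sign (ℓ j u) := by
        intro u₁ h1 h2
        apply hex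
        have hu0' : ℓ j u ≠ 0 := fun h => hu0 (by simp [h])
        have hpos : ∀ i ∈ K, ∀ a b : ℝ, 0 < a → 0 < b →
            SignType.sign (ℓ i (a • u + b • u₁)) = τ i := by
          intro i hi a b ha hb
          have := h1 i hi
          simp only [hτ] at this ⊢
          simp only [map_add, map_smul, smul_eq_mul]
          rcases lt_trichotomy (ℓ i u) 0 with h | h | h
          · rw [sign_neg h, sign_eq_neg_one_iff] at this
            rw [sign_neg h, sign_eq_neg_one_iff]
            nlinarith [mul_neg_of_pos_of_neg ha h, mul_neg_of_pos_of_neg hb this]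
          · rw [h, sign_zero, sign_eq_zero_iff] at this
            simp [h, this]
          · rw [sign_pos h, sign_eq_one_iff] at this
            rw [sign_pos h, sign_eq_one_iff]
            positivity
        have hu1 : ℓ j u₁ ≠ 0 := by
          intro h
          rw [h, sign_zero] at h2
          apply hu0
          rw [← neg_neg (SignType.sign (ℓ j u)), ← h2]; rfl
        refine ⟨|ℓ j u₁| • u + |ℓ j u| • u₁,
          fun i hi => hpos i hi _ _ (abs_pos.2 hu1) (abs_pos.2 hu0'), ?_⟩
        simp only [map_add, map_smul, smul_eq_mul, sign_eq_zero_iff]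
        rcases lt_or_gt_of_ne hu0' with h | h
        · rw [sign_neg h, neg_neg, sign_eq_one_iff] at h2
          rw [abs_of_neg h, abs_of_pos h2]; ring
        · rw [sign_pos h, sign_eq_neg_one_iff] at h2
          rw [abs_of_pos h, abs_of_neg h2]; ring
      have e0 := empt 0 hex
      rcases lt_or_gt_of_ne (fun h => hu0 (by simp [h]) : ℓ j u ≠ 0) with h | h
      · have hs := sign_neg h
        rw [e0, sub (-1) u (fun _ _ => rfl) hs, zero_ne (-1) (by decide), empt 1]
        · ring
        · rintro ⟨u₁, h1, h2⟩
          exact hconv u₁ h1 (by rw [h2, hs]; decide)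
      · have hs := sign_pos h
        rw [e0, sub 1 u (fun _ _ => rfl) hs, zero_ne 1 (by decide), empt (-1)]
        · ring
        · rintro ⟨u₁, h1, h2⟩
          exact hconv u₁ h1 (by rw [h2, hs])

end SignCells

namespace ColoredConfig

variable {ι X : Type*} [DecidableEq ι] [Fintype X] [DecidableEq X] {d : ℕ}

open Classical in
/-- The points with colours in `R` at which `u` is maximal within its colour class. -/
def topSet (c : X → ι) (v : X → Vec d) (R : Finset ι) (u : Module.Dual ℝ (Vec d)) : Finset X :=
  univ.filter fun x => c x ∈ R ∧ ∀ y, c y = c x → u (v y) ≤ u (v x)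

open Classical in
/-- The vertex sets of the proper faces meeting exactly the colours in `R`. -/
def faces (c : X → ι) (v : X → Vec d) (R : Finset ι) : Finset (Finset X) :=
  univ.filter fun G => ∃ u, u ≠ 0 ∧ topSet c v R u = G

/-- The functionals that are constant on each colour class of `G`. -/
def flat (c : X → ι) (v : X → Vec d) (G : Finset X) : Submodule ℝ (Module.Dual ℝ (Vec d)) where
  carrier := {u | ∀ x ∈ G, ∀ y ∈ G, c x = c y → u (v x) = u (v y)}
  add_mem' ha hb x hx y hy h := by
    simp [ha x hx y hy h, hb x hx y hy h]
  zero_mem' := by simp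
  smul_mem' r a ha x hx y hy h := by simp [ha x hx y hy h]

/-- A coloured configuration in general position with sufficiently large colour classes. -/
structure Generic (c : X → ι) (v : X → Vec d) : Prop where
  large : ∀ i, d + 1 ≤ (univ.filter fun x => c x = i).card
  eq_zero : ∀ G : Finset X, G.card = d + (G.image c).card → ∀ u ∈ flat c v G, u = 0

variable {c : X → ι} {v : X → Vec d}

lemma mem_topSet {R : Finset ι} {u : Module.Dual ℝ (Vec d)} {x : X} :
    x ∈ topSet c v R u ↔ c x ∈ R ∧ ∀ y, c y = c x → u (v y) ≤ u (v x) := by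
  simp [topSet]

lemma mem_faces {R : Finset ι} {G : Finset X} :
    G ∈ faces c v R ↔ ∃ u, u ≠ 0 ∧ topSet c v R u = G := by
  simp [faces]

lemma mem_flat {G : Finset X} {u : Module.Dual ℝ (Vec d)} :
    u ∈ flat c v G ↔ ∀ x ∈ G, ∀ y ∈ G, c x = c y → u (v x) = u (v y) := Iff.rfl

lemma flat_anti {G H : Finset X} (h : G ⊆ H) : flat c v H ≤ flat c v G :=
  fun _ hu x hx y hy => hu x (h hx) y (h hy)

lemma topSet_mem_flat {R : Finset ι} (u : Module.Dual ℝ (Vec d)) :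
    u ∈ flat c v (topSet c v R u) := by
  intro x hx y hy h
  exact le_antisymm ((mem_topSet.1 hy).2 x h) ((mem_topSet.1 hx).2 y h.symm)

lemma Generic.card_color_le (hg : Generic c v) {R : Finset ι} (hR : R.Nonempty) :
    d + R.card ≤ (univ.filter fun x => c x ∈ R).card := by
  have h : (univ.filter fun x => c x ∈ R).card = ∑ i ∈ R, (univ.filter fun x => c x = i).card := by
    rw [Finset.card_eq_sum_card_fiberwise (f := c) (t := R) (by intro x hx; simpa using hx)]
    refine Finset.sum_congr rfl fun i hi => ?_
    congr 1; ext x; simp only [mem_filter, mem_univ, true_and]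
    exact ⟨fun h => h.2, fun h => ⟨h ▸ hi, h⟩⟩
  rw [h]
  have h2 : ∑ i ∈ R, (d + 1) ≤ ∑ i ∈ R, (univ.filter fun x => c x = i).card :=
    Finset.sum_le_sum fun i _ => hg.large i
  rw [Finset.sum_const, smul_eq_mul] at h2
  have := hR.card_pos
  nlinarith

lemma Generic.exists_color (hg : Generic c v) (i : ι) : ∃ x, c x = i := by
  have h := hg.large i
  obtain ⟨x, hx⟩ := Finset.card_pos.1 (by omega : 0 < (univ.filter fun x => c x = i).card)
  exact ⟨x, by simpa using hx⟩

lemma Generic.eq_zero_of_le (hg : Generic c v) {G : Finset X}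
    (h : d + (G.image c).card ≤ G.card) {u : Module.Dual ℝ (Vec d)} (hu : u ∈ flat c v G) :
    u = 0 := by
  obtain ⟨T, hT, hinj, himg⟩ := Finset.exists_subset_injOn_image_eq_of_surjOn (f := c)
    (G : Set X) (G.image c) (by rw [Set.SurjOn, coe_image])
  have hTc : T.card = (G.image c).card := by
    rw [← himg, Finset.card_image_of_injOn hinj]
  obtain ⟨H, hTH, hHG, hcard⟩ := Finset.exists_subsuperset_card_eq hT
    (by rw [hTc]; exact Nat.le_add_left _ d) h
  have hH : H.image c = G.image c :=
    subset_antisymm (image_subset_image hHG) (himg ▸ image_subset_image hTH)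
  exact hg.eq_zero H (by rw [hcard, hH]) u (flat_anti hHG hu)

lemma Generic.exists_values (hg : Generic c v) {G : Finset X} (hG : G.Nonempty)
    (h : G.card ≤ d + (G.image c).card) (b : X → ℝ) :
    ∃ (u : Module.Dual ℝ (Vec d)) (a : ι → ℝ), ∀ x ∈ G, u (v x) + a (c x) = b x := by
  have hsub : G ⊆ univ.filter fun x => c x ∈ G.image c := by
    intro x hx; simpa using ⟨x, hx, rfl⟩
  obtain ⟨H, hGH, hH, hcard⟩ := Finset.exists_subsuperset_card_eq hsub h
    (hg.card_color_le (hG.image c))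
  have himg : H.image c = G.image c := by
    apply subset_antisymm
    · intro i hi
      obtain ⟨x, hx, rfl⟩ := mem_image.1 hi
      simpa using hH hx
    · exact image_subset_image hGH
  let Φ : (Module.Dual ℝ (Vec d) × ({i // i ∈ H.image c} → ℝ)) →ₗ[ℝ] ({x // x ∈ H} → ℝ) :=
    LinearMap.pi fun x => (Module.Dual.eval ℝ (Vec d) (v x)) ∘ₗ LinearMap.fst ℝ _ _ +
      (LinearMap.proj (R := ℝ) (φ := fun _ => ℝ)
        (⟨c x.1, mem_image_of_mem c x.2⟩ : {i // i ∈ H.image c})) ∘ₗ LinearMap.snd ℝ _ _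
  have hΦ : ∀ p x, Φ p x = p.1 (v x) + p.2 ⟨c x, mem_image_of_mem c x.2⟩ := fun p x => rfl
  have hinj : Function.Injective Φ := by
    rw [← LinearMap.ker_eq_bot, LinearMap.ker_eq_bot']
    rintro ⟨u, a⟩ h0
    have hval : ∀ x (hx : x ∈ H), u (v x) = - a ⟨c x, mem_image_of_mem c hx⟩ := by
      intro x hx
      have := congrFun h0 ⟨x, hx⟩
      rw [hΦ] at this
      simpa [eq_neg_iff_add_eq_zero] using this
    have hu : u = 0 := by
      refine hg.eq_zero H (by rw [hcard, himg]) u fun x hx y hy hxy => ?_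
      rw [hval x hx, hval y hy]
      simp only [hxy]
    ext i
    · simp [hu]
    · obtain ⟨i, hi⟩ := i
      obtain ⟨x, hx, rfl⟩ := mem_image.1 hi
      have := hval x hx
      simp [hu] at this
      simpa using this
  have hfin : Module.finrank ℝ (Module.Dual ℝ (Vec d) × ({i // i ∈ H.image c} → ℝ)) =
      Module.finrank ℝ ({x // x ∈ H} → ℝ) := by
    rw [Module.finrank_prod, Subspace.dual_finrank_eq]
    simp [hcard, himg]
  obtain ⟨⟨u, a⟩, hua⟩ :=
    (LinearMap.injective_iff_surjective_of_finrank_eq_finrank hfin).1 hinj (fun x => b x)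
  refine ⟨u, fun i => if hi : i ∈ H.image c then a ⟨i, hi⟩ else 0, fun x hx => ?_⟩
  have := congrFun hua ⟨x, hGH hx⟩
  rw [hΦ] at this
  simp only [dif_pos (mem_image_of_mem c (hGH hx))]
  exact this

lemma Generic.finrank_flat (hg : Generic c v) {G : Finset X} (hG : G.Nonempty)
    (h : G.card ≤ d + (G.image c).card) :
    Module.finrank ℝ (flat c v G) + G.card = d + (G.image c).card := by
  let Φ : (Module.Dual ℝ (Vec d) × ({i // i ∈ G.image c} → ℝ)) →ₗ[ℝ] ({x // x ∈ G} → ℝ) :=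
    LinearMap.pi fun x => (Module.Dual.eval ℝ (Vec d) (v x)) ∘ₗ LinearMap.fst ℝ _ _ +
      (LinearMap.proj (R := ℝ) (φ := fun _ => ℝ)
        (⟨c x.1, mem_image_of_mem c x.2⟩ : {i // i ∈ G.image c})) ∘ₗ LinearMap.snd ℝ _ _
  have hΦ : ∀ p x, Φ p x = p.1 (v x) + p.2 ⟨c x, mem_image_of_mem c x.2⟩ := fun p x => rfl
  have hsurj : Function.Surjective Φ := by
    intro b
    obtain ⟨u, a, hua⟩ := hg.exists_values hG h (fun x => if hx : x ∈ G then b ⟨x, hx⟩ else 0)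
    refine ⟨(u, fun i => a i), funext fun x => ?_⟩
    rw [hΦ]
    simpa using hua x x.2
  let f := (LinearMap.fst ℝ (Module.Dual ℝ (Vec d)) ({i // i ∈ G.image c} → ℝ)) ∘ₗ
    (LinearMap.ker Φ).subtype
  have hfinj : Function.Injective f := by
    rintro ⟨⟨u, a⟩, hp⟩ ⟨⟨u', a'⟩, hq⟩ h0
    have hu : u = u' := h0
    subst hu
    have ha : a = a' := by
      ext i
      obtain ⟨i, hi⟩ := i
      obtain ⟨x, hx, rfl⟩ := mem_image.1 hi
      have h1 := congrFun (LinearMap.mem_ker.1 hp) ⟨x, hx⟩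
      have h2 := congrFun (LinearMap.mem_ker.1 hq) ⟨x, hx⟩
      rw [hΦ] at h1 h2
      exact add_left_cancel (h1.trans h2.symm)
    rw [Subtype.mk.injEq, ha]
  have hrange : LinearMap.range f = flat c v G := by
    ext u
    constructor
    · rintro ⟨⟨⟨u, a⟩, hk⟩, rfl⟩ x hx y hy hxy
      have h1 := congrFun (LinearMap.mem_ker.1 hk) ⟨x, hx⟩
      have h2 := congrFun (LinearMap.mem_ker.1 hk) ⟨y, hy⟩
      rw [hΦ] at h1 h2
      simp only [hxy, Pi.zero_apply] at h1 h2
      change u (v x) = u (v y)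
      linarith
    · intro hu
      have hrep : ∀ i : {i // i ∈ G.image c}, ∃ x, x ∈ G ∧ c x = i := by
        rintro ⟨i, hi⟩; simpa using hi
      choose r hr hcr using hrep
      refine ⟨⟨(u, fun i => - u (v (r i))), ?_⟩, rfl⟩
      rw [LinearMap.mem_ker]
      funext x
      rw [hΦ]
      have := hu x x.2 _ (hr ⟨c x, mem_image_of_mem c x.2⟩) (by rw [hcr])
      simp [this]
  have h1 := LinearMap.finrank_range_of_inj hfinj
  rw [hrange] at h1
  have h2 := LinearMap.finrank_range_add_finrank_ker Φ
  rw [LinearMap.range_eq_top.2 hsurj, finrank_top, Module.finrank_prod,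
    Subspace.dual_finrank_eq] at h2
  simp at h2
  omega

lemma Generic.image_topSet (hg : Generic c v) (R : Finset ι) (u : Module.Dual ℝ (Vec d)) :
    (topSet c v R u).image c = R := by
  ext i
  simp only [mem_image]
  constructor
  · rintro ⟨x, hx, rfl⟩; exact (mem_topSet.1 hx).1
  · intro hi
    obtain ⟨x, hx⟩ := hg.exists_color i
    obtain ⟨y, hy, hmax⟩ := Finset.exists_max_image (univ.filter fun x => c x = i)
      (fun x => u (v x)) ⟨x, by simpa using hx⟩
    simp only [mem_filter, mem_univ, true_and] at hy hmax
    exact ⟨y, mem_topSet.2 ⟨hy ▸ hi, fun z hz => hmax z (hz.trans hy)⟩, hy⟩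

lemma Generic.image_eq (hg : Generic c v) {R : Finset ι} {G : Finset X} (hG : G ∈ faces c v R) :
    G.image c = R := by
  obtain ⟨u, -, rfl⟩ := mem_faces.1 hG
  exact hg.image_topSet R u

lemma Generic.card_lt (hg : Generic c v) {R : Finset ι} {G : Finset X} (hG : G ∈ faces c v R) :
    G.card < d + R.card := by
  by_contra! h
  have himg := hg.image_eq hG
  obtain ⟨u, hu, rfl⟩ := mem_faces.1 hG
  exact hu (hg.eq_zero_of_le (by rwa [himg]) (topSet_mem_flat u))

lemma topSet_zero (R : Finset ι) :
    topSet c v R 0 = univ.filter fun x => c x ∈ R := by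
  ext x; simp [mem_topSet]

/-- A functional that is constant on every colour class with colour in `R` vanishes. -/
lemma Generic.eq_zero_of_color (hg : Generic c v) {R : Finset ι} (hR : R.Nonempty)
    {u : Module.Dual ℝ (Vec d)} (hu : u ∈ flat c v (univ.filter fun x => c x ∈ R)) : u = 0 := by
  refine hg.eq_zero_of_le ?_ hu
  have := hg.image_topSet R 0
  rw [topSet_zero] at this
  rw [this]
  exact hg.card_color_le hR

lemma Generic.subset_mem_faces (hg : Generic c v) {R : Finset ι} {G G₀ : Finset X}
    (hG : G ∈ faces c v R) (hsub : G₀ ⊆ G) (hne : G₀.Nonempty) :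
    G₀ ∈ faces c v (G₀.image c) := by
  have himg := hg.image_eq hG
  have hcard := hg.card_lt hG
  obtain ⟨u, hu, htop⟩ := mem_faces.1 hG
  obtain ⟨w, a, hw⟩ := hg.exists_values (hne.mono hsub) (by rw [himg]; omega)
    (fun x => if x ∈ G₀ then 0 else -1)
  have hmemG : ∀ x, x ∈ G ↔ c x ∈ R ∧ ∀ y, c y = c x → u (v y) ≤ u (v x) := by
    intro x; rw [← htop]; exact mem_topSet
  have hlt : ∀ x ∈ G, ∀ y, y ∉ G → c y = c x → u (v y) < u (v x) := by
    intro x hx y hy hxy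
    by_contra! h
    refine hy ((hmemG y).2 ⟨hxy ▸ ((hmemG x).1 hx).1, fun z hz => ?_⟩)
    exact (((hmemG x).1 hx).2 z (hz.trans hxy)).trans h
  have hev : ∀ᶠ ε : ℝ in nhdsWithin 0 (Set.Ioi 0), ∀ p ∈ (univ : Finset (X × X)),
      p.1 ∈ G → p.2 ∉ G → c p.2 = c p.1 →
        u (v p.2) + ε * w (v p.2) < u (v p.1) + ε * w (v p.1) := by
    refine (Filter.eventually_all_finset _).2 fun p _ => ?_
    by_cases h1 : p.1 ∈ G ∧ p.2 ∉ G ∧ c p.2 = c p.1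
    · have h := hlt _ h1.1 _ h1.2.1 h1.2.2
      have hc1 : Filter.Tendsto (fun ε : ℝ => u (v p.2) + ε * w (v p.2))
          (nhdsWithin 0 (Set.Ioi 0)) (nhds (u (v p.2))) := by
        have : Continuous fun ε : ℝ => u (v p.2) + ε * w (v p.2) := by fun_prop
        simpa using (this.tendsto 0).mono_left nhdsWithin_le_nhds
      have hc2 : Filter.Tendsto (fun ε : ℝ => u (v p.1) + ε * w (v p.1))
          (nhdsWithin 0 (Set.Ioi 0)) (nhds (u (v p.1))) := by
        have : Continuous fun ε : ℝ => u (v p.1) + ε * w (v p.1) := by fun_prop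
        simpa using (this.tendsto 0).mono_left nhdsWithin_le_nhds
      filter_upwards [hc1.eventually_lt hc2 h] with ε hε _ _ _ using hε
    · exact Filter.Eventually.of_forall fun ε a b e => absurd ⟨a, b, e⟩ h1
  obtain ⟨ε, hε, hpos⟩ := (hev.and self_mem_nhdsWithin).exists
  replace hε : ∀ x ∈ G, ∀ y, y ∉ G → c y = c x →
      u (v y) + ε * w (v y) < u (v x) + ε * w (v x) :=
    fun x hx y hy h => hε (x, y) (mem_univ _) hx hy h
  have hpos : 0 < ε := hpos
  have key : topSet c v (G₀.image c) (u + ε • w) = G₀ := by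
    ext x
    rw [mem_topSet]
    simp only [LinearMap.add_apply, LinearMap.smul_apply, smul_eq_mul]
    constructor
    · rintro ⟨hx, hmax⟩
      obtain ⟨z, hz, hzx⟩ := mem_image.1 hx
      have hxG : x ∈ G := by
        by_contra hxG
        exact absurd (hmax z hzx) (not_le.2 (hε z (hsub hz) x hxG hzx.symm))
      by_contra hx0
      have h1 := hw x hxG
      have h2 := hw z (hsub hz)
      rw [if_neg hx0] at h1
      rw [if_pos hz, hzx] at h2
      have h3 := hmax z hzx
      have h4 : u (v x) ≤ u (v z) := ((hmemG z).1 (hsub hz)).2 x hzx.symm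
      have h5 : u (v z) ≤ u (v x) := ((hmemG x).1 hxG).2 z hzx
      have h6 : w (v z) = w (v x) + 1 := by linarith
      rw [h6] at h3
      nlinarith
    · intro hx
      refine ⟨mem_image_of_mem c hx, fun y hy => ?_⟩
      by_cases hyG : y ∈ G
      · have h1 := hw x (hsub hx)
        have h2 := hw y hyG
        rw [if_pos hx] at h1
        rw [hy] at h2
        have h3 : w (v y) ≤ w (v x) := by
          split_ifs at h2 <;> linarith
        have h4 : u (v y) ≤ u (v x) := ((hmemG x).1 (hsub hx)).2 y hy
        nlinarith
      · exact (hε x (hsub hx) y hyG hy).le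
  refine mem_faces.2 ⟨u + ε • w, fun h0 => hu ?_, key⟩
  rw [h0, topSet_zero] at key
  refine hg.eq_zero_of_color (hne.image c) (R := G₀.image c) ?_
  rw [key]
  refine flat_anti hsub ?_
  rw [← htop]
  exact topSet_mem_flat u

end ColoredConfig

namespace ColoredConfig
open SignCells

variable {ι X : Type*} [DecidableEq ι] [Fintype X] [DecidableEq X] {d : ℕ}
variable {c : X → ι} {v : X → Vec d}

/-- The functional comparing two points. -/
def diff (v : X → Vec d) (p : X × X) : Module.Dual ℝ (Vec d) →ₗ[ℝ] ℝ :=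
  Module.Dual.eval ℝ (Vec d) (v p.1 - v p.2)

lemma diff_apply (p : X × X) (u : Module.Dual ℝ (Vec d)) :
    diff v p u = u (v p.1) - u (v p.2) := by
  simp [diff]

/-- The top set read off from a sign vector. -/
def signTop (c : X → ι) (R : Finset ι) (s : X × X → SignType) : Finset X :=
  univ.filter fun x => c x ∈ R ∧ ∀ y, c y = c x → 0 ≤ s (x, y)

lemma signTop_sign (R : Finset ι) (u : Module.Dual ℝ (Vec d)) :
    signTop c R (fun p => SignType.sign (diff v p u)) = topSet c v R u := by
  ext x
  rw [mem_topSet]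
  simp [signTop, diff_apply, sign_nonneg_iff]

lemma sign_diff_of_mem {R : Finset ι} {u : Module.Dual ℝ (Vec d)} {x y : X}
    (hx : x ∈ topSet c v R u) (hy : c y = c x) :
    SignType.sign (diff v (x, y) u) = if y ∈ topSet c v R u then 0 else 1 := by
  have hx' := mem_topSet.1 hx
  rw [diff_apply]
  split_ifs with h
  · rw [sign_eq_zero_iff, sub_eq_zero]
    exact topSet_mem_flat (c := c) u x hx y h hy.symm
  · rw [sign_eq_one_iff, sub_pos]
    by_contra! hle
    exact h (mem_topSet.2 ⟨hy ▸ hx'.1, fun z hz => (hx'.2 z (hz.trans hy)).trans hle⟩)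

/-- The comparisons of points of `G` with all points of the same colour. -/
def comparisons (c : X → ι) (G : Finset X) : Finset (X × X) :=
  univ.filter fun p => p.1 ∈ G ∧ c p.2 = c p.1

lemma Generic.topSet_eq_iff (hg : Generic c v) (R : Finset ι) (u u₀ : Module.Dual ℝ (Vec d)) :
    topSet c v R u = topSet c v R u₀ ↔ ∀ p ∈ comparisons c (topSet c v R u₀),
      SignType.sign (diff v p u) = SignType.sign (diff v p u₀) := by
  constructor
  · rintro h ⟨x, y⟩ hp
    simp only [comparisons, mem_filter, mem_univ, true_and] at hp
    rw [sign_diff_of_mem hp.1 hp.2, sign_diff_of_mem (h ▸ hp.1) hp.2, h]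
  · intro h
    have hsub : topSet c v R u₀ ⊆ topSet c v R u := by
      intro x hx
      refine mem_topSet.2 ⟨(mem_topSet.1 hx).1, fun y hy => ?_⟩
      have h1 := h (x, y) (by simp [comparisons, hx, hy])
      rw [sign_diff_of_mem hx hy] at h1
      have h2 : 0 ≤ SignType.sign (diff v (x, y) u) := by rw [h1]; split_ifs <;> decide
      rw [sign_nonneg_iff, diff_apply] at h2
      simpa using h2
    refine subset_antisymm ?_ hsub
    intro y hy
    by_contra hy0
    have himg : c y ∈ (topSet c v R u₀).image c := by
      rw [hg.image_topSet]; exact (mem_topSet.1 hy).1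
    obtain ⟨x, hx, hxy⟩ := mem_image.1 himg
    have h1 := h (x, y) (by simp [comparisons, hx, hxy])
    rw [sign_diff_of_mem hx hxy.symm, if_neg hy0, sign_diff_of_mem (hsub hx) hxy.symm,
      if_pos hy] at h1
    exact absurd h1 (by decide)

lemma zeroSpace_comparisons (R : Finset ι) (u : Module.Dual ℝ (Vec d)) :
    zeroSpace (diff v) (comparisons c (topSet c v R u))
      (fun p => SignType.sign (diff v p u)) = flat c v (topSet c v R u) := by
  ext z
  rw [mem_zeroSpace, mem_flat]
  constructor
  · intro h x hx y hy hxy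
    have := h (x, y) (by simp [comparisons, hx, hxy]) (by
      simp only [sign_diff_of_mem hx hxy.symm, if_pos hy])
    rw [diff_apply] at this
    linarith
  · rintro h ⟨x, y⟩ hp hs
    simp only [comparisons, mem_filter, mem_univ, true_and] at hp
    simp only [sign_diff_of_mem hp.1 hp.2] at hs
    split_ifs at hs with hy
    · rw [diff_apply, sub_eq_zero]; exact h x hp.1 y hy hp.2.symm

lemma mem_realized {J E : Type*} [AddCommGroup E] [Module ℝ E] [Fintype J]
    {ℓ : J → E →ₗ[ℝ] ℝ} {s : J → SignType} :
    s ∈ realized ℓ ↔ ∃ u, (fun j => SignType.sign (ℓ j u)) = s := by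
  simp [realized]

lemma Generic.sum_fiber (hg : Generic c v) (R : Finset ι) (u : Module.Dual ℝ (Vec d)) :
    ∑ s ∈ (realized (diff v)).filter (fun s => signTop c R s = topSet c v R u),
      weight (diff v) s = (-1) ^ Module.finrank ℝ (flat c v (topSet c v R u)) := by
  rw [← zeroSpace_comparisons, ← cellSum_eq, cellSum]
  refine Finset.sum_congr ?_ fun _ _ => rfl
  ext s
  simp only [mem_filter]
  refine and_congr_right fun hs => ?_
  obtain ⟨w, rfl⟩ := mem_realized.1 hs
  rw [signTop_sign, hg.topSet_eq_iff]

lemma Generic.all_notMem (hg : Generic c v) {R : Finset ι} (hR : R.Nonempty) :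
    (univ.filter fun x => c x ∈ R) ∉ faces c v R := by
  intro h
  have h1 := hg.card_lt h
  have h2 := hg.card_color_le hR
  omega

lemma Generic.sum_weight (hg : Generic c v) {R : Finset ι} (hR : R.Nonempty)
    (φ : Finset X → ℤ) :
    ∑ s ∈ realized (diff v), weight (diff v) s * φ (signTop c R s) =
      φ (univ.filter fun x => c x ∈ R) +
        ∑ G ∈ faces c v R, (-1) ^ (d + R.card - G.card) * φ G := by
  have hfib : ∀ u : Module.Dual ℝ (Vec d),
      ∑ s ∈ (realized (diff v)).filter (fun s => signTop c R s = topSet c v R u),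
        weight (diff v) s * φ (signTop c R s) =
      (-1) ^ Module.finrank ℝ (flat c v (topSet c v R u)) * φ (topSet c v R u) := by
    intro u
    rw [← hg.sum_fiber, Finset.sum_mul]
    refine Finset.sum_congr rfl fun s hs => ?_
    rw [(mem_filter.1 hs).2]
  rw [← Finset.sum_fiberwise_of_maps_to
    (t := insert (univ.filter fun x => c x ∈ R) (faces c v R)) (g := signTop c R),
    Finset.sum_insert (hg.all_notMem hR)]
  · congr 1
    · have h := hfib 0
      rw [topSet_zero] at h
      rw [h]
      have : flat c v (univ.filter fun x => c x ∈ R) = ⊥ := by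
        rw [eq_bot_iff]
        intro z hz
        exact (Submodule.mem_bot ℝ).2 (hg.eq_zero_of_color hR hz)
      rw [this, finrank_bot]; simp
    · refine Finset.sum_congr rfl fun G hG => ?_
      have hlt := hg.card_lt hG
      have himg := hg.image_eq hG
      obtain ⟨u, hu, rfl⟩ := mem_faces.1 hG
      rw [hfib]
      have hne : (topSet c v R u).Nonempty := by
        rw [← Finset.image_nonempty (f := c), himg]; exact hR
      have := hg.finrank_flat hne (by rw [himg]; omega)
      rw [himg] at this
      congr 2
      omega
  · intro s hs
    obtain ⟨u, rfl⟩ := mem_realized.1 hs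
    rw [signTop_sign, mem_insert]
    by_cases hu : u = 0
    · left; rw [hu, topSet_zero]
    · right; exact mem_faces.2 ⟨u, hu, rfl⟩

/-- Euler's relation. -/
lemma Generic.euler (hg : Generic c v) {R : Finset ι} (hR : R.Nonempty) :
    ∑ G ∈ faces c v R, (-1 : ℤ) ^ (d + R.card - G.card) = (-1) ^ d - 1 := by
  have h := hg.sum_weight hR (fun _ => 1)
  simp only [mul_one] at h
  have h2 := cellSum_eq (ℓ := diff v) ∅ 0
  have h3 : zeroSpace (diff v) ∅ (fun j => SignType.sign (diff v j 0)) = ⊤ := by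
    ext; simp [mem_zeroSpace]
  rw [h3, finrank_top, Subspace.dual_finrank_eq, cellSum] at h2
  simp only [notMem_empty, false_imp_iff, implies_true, Finset.filter_true,
    Module.finrank_fin_fun] at h2
  rw [h2] at h
  linarith

set_option maxHeartbeats 800000 in
/-- Euler's relation in a vertex figure. -/
lemma Generic.euler_link (hg : Generic c v) {R : Finset ι} {G₀ : Finset X} (hne : G₀.Nonempty)
    (hG₀ : G₀ ∈ faces c v (G₀.image c)) (hR : G₀.image c ⊆ R) :
    ∑ G ∈ (faces c v R).filter (fun G => G₀ ⊆ G), (-1 : ℤ) ^ (d + R.card - G.card) = -1 := by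
  have h := hg.sum_weight ((hne.image c).mono hR) (fun G => if G₀ ⊆ G then 1 else 0)
  rw [if_pos (by intro x hx; simpa using hR (mem_image_of_mem c hx))] at h
  simp only [mul_ite, mul_one, mul_zero] at h
  rw [← Finset.sum_filter, ← Finset.sum_filter] at h
  suffices hz : ∑ s ∈ (realized (diff v)).filter (fun s => G₀ ⊆ signTop c R s),
      weight (diff v) s = 0 by
    rw [hz] at h; linarith
  obtain ⟨u₀, hu₀, htop⟩ := mem_faces.1 hG₀
  set K : Finset (X × X) := univ.filter fun p => p.1 ∈ G₀ ∧ p.2 ∈ G₀ ∧ c p.2 = c p.1 with hK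
  set J : Finset (X × X) := univ.filter fun p => p.1 ∈ G₀ ∧ p.2 ∉ G₀ ∧ c p.2 = c p.1 with hJ
  have hJne : J.Nonempty := by
    by_contra hempty
    rw [not_nonempty_iff_eq_empty] at hempty
    refine hu₀ (hg.eq_zero_of_color (hne.image c) (R := G₀.image c) ?_)
    have hsub : (univ.filter fun x => c x ∈ G₀.image c) ⊆ topSet c v (G₀.image c) u₀ := by
      rw [htop]
      intro y hy
      by_contra hy0
      simp only [mem_filter, mem_univ, true_and] at hy
      obtain ⟨x, hx, hxy⟩ := mem_image.1 hy
      have : (x, y) ∈ J := by simp [hJ, hx, hy0, hxy]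
      rw [hempty] at this
      exact notMem_empty _ this
    exact flat_anti hsub (topSet_mem_flat u₀)
  have hsignK : ∀ p ∈ K, SignType.sign (diff v p (-u₀)) = 0 := by
    rintro ⟨x, y⟩ hp
    simp only [hK, mem_filter, mem_univ, true_and] at hp
    have h1 := sign_diff_of_mem (u := u₀) (v := v) (R := G₀.image c)
      (by rw [htop]; exact hp.1) hp.2.2
    rw [htop, if_pos hp.2.1] at h1
    rw [map_neg, Left.sign_neg, h1]; rfl
  have hsignJ : ∀ p ∈ J, SignType.sign (diff v p (-u₀)) = -1 := by
    rintro ⟨x, y⟩ hp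
    simp only [hJ, mem_filter, mem_univ, true_and] at hp
    have h1 := sign_diff_of_mem (u := u₀) (v := v) (R := G₀.image c)
      (by rw [htop]; exact hp.1) hp.2.2
    rw [htop, if_neg hp.2.1] at h1
    rw [map_neg, Left.sign_neg, h1]
  have hcell : ∀ T ∈ J.powerset,
      cellSum (diff v) (K ∪ T) (fun p => SignType.sign (diff v p (-u₀))) =
        (-1) ^ Module.finrank ℝ (flat c v G₀) := by
    intro T hT
    rw [mem_powerset] at hT
    rw [cellSum_eq]
    suffices hz : zeroSpace (diff v) (K ∪ T) (fun p => SignType.sign (diff v p (-u₀))) =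
        flat c v G₀ by rw [hz]
    ext z
    rw [mem_zeroSpace, mem_flat]
    constructor
    · intro hz x hx y hy hxy
      have hp : (x, y) ∈ K := by simp [hK, hx, hy, hxy]
      have := hz (x, y) (mem_union_left _ hp) (hsignK _ hp)
      rw [diff_apply] at this
      linarith
    · rintro hz ⟨x, y⟩ hp hs
      rcases mem_union.1 hp with hp | hp
      · simp only [hK, mem_filter, mem_univ, true_and] at hp
        rw [diff_apply, sub_eq_zero]
        exact hz x hp.1 y hp.2.1 hp.2.2.symm
      · rw [hsignJ _ (hT hp)] at hs
        exact absurd hs (by decide)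
  have hind : ∀ s ∈ realized (diff v), (if G₀ ⊆ signTop c R s then weight (diff v) s else 0) =
      ∑ T ∈ J.powerset, (-1) ^ T.card *
        (if ∀ p ∈ K ∪ T, s p = SignType.sign (diff v p (-u₀)) then weight (diff v) s else 0) := by
    intro s hs
    have hprod : ∑ T ∈ J.powerset, (-1 : ℤ) ^ T.card * (if ∀ p ∈ T, s p = -1 then 1 else 0) =
        if ∀ p ∈ J, 0 ≤ s p then 1 else 0 := by
      have h1 := Finset.prod_add (fun p => if s p = -1 then (-1 : ℤ) else 0) (fun _ => 1) J
      have h2 : ∏ p ∈ J, ((if s p = -1 then (-1 : ℤ) else 0) + 1) =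
          if ∀ p ∈ J, 0 ≤ s p then 1 else 0 := by
        split_ifs with hall
        · refine Finset.prod_eq_one fun p hp => ?_
          have := hall p hp
          rw [if_neg, zero_add]
          intro h0; rw [h0] at this; exact absurd this (by decide)
        · push Not at hall
          obtain ⟨p, hp, hlt⟩ := hall
          refine Finset.prod_eq_zero hp ?_
          have : s p = -1 := by revert hlt; cases s p <;> decide
          rw [if_pos this]; norm_num
      rw [← h2, h1]
      refine Finset.sum_congr rfl fun T hT => ?_
      rw [Finset.prod_const_one, mul_one]
      split_ifs with hall
      · rw [Finset.prod_congr rfl fun p hp => if_pos (hall p hp), Finset.prod_const, mul_one]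
      · push Not at hall
        obtain ⟨p, hp, hne⟩ := hall
        rw [mul_zero, Finset.prod_eq_zero hp (if_neg hne)]
    obtain ⟨w, rfl⟩ := mem_realized.1 hs
    have hiff : G₀ ⊆ signTop c R (fun p => SignType.sign (diff v p w)) ↔
        (∀ p ∈ K, SignType.sign (diff v p w) = 0) ∧ ∀ p ∈ J, 0 ≤ SignType.sign (diff v p w) := by
      rw [signTop_sign]
      constructor
      · intro hsub
        constructor
        · rintro ⟨x, y⟩ hp
          simp only [hK, mem_filter, mem_univ, true_and] at hp
          rw [sign_diff_of_mem (hsub hp.1) hp.2.2, if_pos (hsub hp.2.1)]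
        · rintro ⟨x, y⟩ hp
          simp only [hJ, mem_filter, mem_univ, true_and] at hp
          rw [sign_diff_of_mem (hsub hp.1) hp.2.2]
          split_ifs <;> decide
      · rintro ⟨h1, h2⟩ x hx
        refine mem_topSet.2 ⟨hR (mem_image_of_mem c hx), fun y hy => ?_⟩
        by_cases hyG : y ∈ G₀
        · have := h1 (x, y) (by simp [hK, hx, hyG, hy])
          rw [sign_eq_zero_iff, diff_apply, sub_eq_zero] at this
          exact this.ge
        · have := h2 (x, y) (by simp [hJ, hx, hyG, hy])
          rw [sign_nonneg_iff, diff_apply, sub_nonneg] at this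
          exact this
    have hiffT : ∀ T ∈ J.powerset, (∀ p ∈ K ∪ T, SignType.sign (diff v p w) =
        SignType.sign (diff v p (-u₀))) ↔ (∀ p ∈ K, SignType.sign (diff v p w) = 0) ∧
          ∀ p ∈ T, SignType.sign (diff v p w) = -1 := by
      intro T hT
      rw [mem_powerset] at hT
      constructor
      · intro h
        exact ⟨fun p hp => (h p (mem_union_left _ hp)).trans (hsignK p hp),
          fun p hp => (h p (mem_union_right _ hp)).trans (hsignJ p (hT hp))⟩
      · rintro ⟨h1, h2⟩ p hp
        rcases mem_union.1 hp with hp | hp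
        · exact (h1 p hp).trans (hsignK p hp).symm
        · exact (h2 p hp).trans (hsignJ p (hT hp)).symm
    by_cases hk : ∀ p ∈ K, SignType.sign (diff v p w) = 0
    · have e1 : (if G₀ ⊆ signTop c R (fun p => SignType.sign (diff v p w)) then
          weight (diff v) (fun p => SignType.sign (diff v p w)) else 0) =
          weight (diff v) (fun p => SignType.sign (diff v p w)) *
            (if ∀ p ∈ J, 0 ≤ SignType.sign (diff v p w) then 1 else 0) := by
        by_cases hj : ∀ p ∈ J, 0 ≤ SignType.sign (diff v p w)
        · rw [if_pos (hiff.2 ⟨hk, hj⟩), if_pos hj, mul_one]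
        · rw [if_neg (fun h => hj (hiff.1 h).2), if_neg hj, mul_zero]
      rw [e1, ← hprod, Finset.mul_sum]
      refine Finset.sum_congr rfl fun T hT => ?_
      by_cases ht : ∀ p ∈ T, SignType.sign (diff v p w) = -1
      · rw [if_pos ht, if_pos ((hiffT T hT).2 ⟨hk, ht⟩)]; ring
      · rw [if_neg ht, if_neg (fun h => ht ((hiffT T hT).1 h).2)]; ring
    · rw [if_neg (fun h => hk (hiff.1 h).1)]
      refine (Finset.sum_eq_zero fun T hT => ?_).symm
      rw [if_neg (fun h => hk ((hiffT T hT).1 h).1), mul_zero]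
  rw [Finset.sum_filter, Finset.sum_congr rfl hind, Finset.sum_comm]
  have hinner : ∀ T ∈ J.powerset, ∑ s ∈ realized (diff v), (-1 : ℤ) ^ T.card *
        (if ∀ p ∈ K ∪ T, s p = SignType.sign (diff v p (-u₀)) then weight (diff v) s else 0) =
      (-1) ^ T.card * (-1) ^ Module.finrank ℝ (flat c v G₀) := by
    intro T hT
    rw [← hcell T hT, cellSum, ← Finset.mul_sum, Finset.sum_filter]
    congr 1
    refine Finset.sum_congr rfl fun s _ => ?_
    by_cases hs : ∀ p ∈ K ∪ T, s p = SignType.sign (diff v p (-u₀))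
    · rw [if_pos hs, if_pos hs]
    · rw [if_neg hs, if_neg hs]
  rw [Finset.sum_congr rfl hinner, ← Finset.sum_mul,
    Finset.sum_powerset_neg_one_pow_card_of_nonempty hJne, zero_mul]

end ColoredConfig

namespace ColoredConfig
open Polynomial

variable {ι X : Type*} [DecidableEq ι] [Fintype X] [DecidableEq X] {d : ℕ}
variable {c : X → ι} {v : X → Vec d}

/-- The generating polynomial of the faces with colour set `R`, with a correction term. -/
def facePoly (c : X → ι) (v : X → Vec d) (R : Finset ι) : ℤ[X] :=
  ∑ G ∈ faces c v R, (Polynomial.X : ℤ[X]) ^ G.card + C ((-1) ^ (R.card + 1))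

lemma Generic.sum_faces_subsets (hg : Generic c v) {R : Finset ι} (hR : R.Nonempty) :
    ∑ G ∈ faces c v R, C ((-1 : ℤ) ^ (d + R.card - G.card)) * (1 + Polynomial.X) ^ G.card =
      C ((-1) ^ d - 1) -
        ∑ Q ∈ R.powerset.filter (·.Nonempty), ∑ G ∈ faces c v Q,
          (Polynomial.X : ℤ[X]) ^ G.card := by
  have hexp : ∀ G : Finset X, (1 + (Polynomial.X : ℤ[X])) ^ G.card =
      1 + ∑ G₀ ∈ univ.filter (fun G₀ : Finset X => G₀.Nonempty),
        if G₀ ⊆ G then (Polynomial.X : ℤ[X]) ^ G₀.card else 0 := by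
    intro G
    have h := Finset.sum_pow_mul_eq_add_pow (Polynomial.X : ℤ[X]) 1 G
    simp only [one_pow, mul_one] at h
    rw [add_comm, ← h, ← Finset.sum_filter, Finset.filter_filter,
      ← Finset.add_sum_erase _ _ (Finset.empty_mem_powerset G), card_empty, pow_zero]
    congr 1
    refine Finset.sum_congr ?_ fun _ _ => rfl
    ext T
    simp [Finset.nonempty_iff_ne_empty]
  have hS : ∑ Q ∈ R.powerset.filter (·.Nonempty), ∑ G ∈ faces c v Q,
      (Polynomial.X : ℤ[X]) ^ G.card =
      ∑ G₀ ∈ univ.filter (fun G₀ : Finset X => G₀.Nonempty),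
        if G₀.image c ⊆ R ∧ G₀ ∈ faces c v (G₀.image c) then
          (Polynomial.X : ℤ[X]) ^ G₀.card else 0 := by
    rw [← Finset.sum_filter, Finset.filter_filter,
      ← Finset.sum_fiberwise_of_maps_to (t := R.powerset.filter (·.Nonempty))
        (g := fun G : Finset X => G.image c)]
    · refine Finset.sum_congr rfl fun Q hQ => Finset.sum_congr ?_ fun _ _ => rfl
      simp only [mem_filter, mem_powerset] at hQ
      ext G
      simp only [mem_filter, mem_univ, true_and]
      constructor
      · intro hG
        have := hg.image_eq hG
        refine ⟨⟨?_, ?_, ?_⟩, this⟩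
        · rw [← Finset.image_nonempty (f := c), this]; exact hQ.2
        · rw [this]; exact hQ.1
        · rwa [this]
      · rintro ⟨⟨h1, h2, h3⟩, h4⟩
        rwa [h4] at h3
    · intro G hG
      simp only [mem_filter, mem_univ, true_and, mem_powerset] at hG ⊢
      exact ⟨hG.2.1, hG.1.image c⟩
  simp only [hexp, mul_add, mul_one, Finset.sum_add_distrib]
  rw [← map_sum, hg.euler hR, hS, sub_eq_add_neg (C _)]
  congr 1
  simp only [Finset.mul_sum]
  rw [Finset.sum_comm, ← Finset.sum_neg_distrib]
  refine Finset.sum_congr rfl fun G₀ hG₀ => ?_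
  simp only [mem_filter, mem_univ, true_and] at hG₀
  simp only [mul_ite, mul_zero]
  rw [← Finset.sum_filter, ← Finset.sum_mul, ← map_sum]
  split_ifs with h
  · rw [hg.euler_link hG₀ h.2 h.1]; simp
  · rw [Finset.filter_false_of_mem]
    · simp
    · intro G hG hsub
      refine h ⟨?_, hg.subset_mem_faces hG hsub hG₀⟩
      rw [← hg.image_eq hG]
      exact image_subset_image hsub

lemma sum_nonempty_powerset_sign {R : Finset ι} (hR : R.Nonempty) :
    ∑ Q ∈ R.powerset.filter (·.Nonempty), (-1 : ℤ) ^ (Q.card + 1) = 1 := by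
  have h := Finset.sum_powerset_neg_one_pow_card_of_nonempty hR
  rw [← Finset.add_sum_erase _ _ (Finset.empty_mem_powerset R)] at h
  have h2 : R.powerset.filter (·.Nonempty) = R.powerset.erase ∅ := by
    ext T; simp [Finset.nonempty_iff_ne_empty, and_comm]
  rw [h2]
  simp only [pow_succ, mul_neg, mul_one, Finset.sum_neg_distrib]
  rw [card_empty, pow_zero] at h
  linarith

/-- The Dehn–Sommerville relations. -/
theorem Generic.dehn_sommerville (hg : Generic c v) {R : Finset ι} (hR : R.Nonempty) :
    C ((-1) ^ (d + R.card + 1)) * (facePoly c v R).comp (-1 - Polynomial.X) =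
      ∑ Q ∈ R.powerset.filter (·.Nonempty), facePoly c v Q := by
  have hcomp : C ((-1) ^ (d + R.card + 1)) * (facePoly c v R).comp (-1 - Polynomial.X) =
      -∑ G ∈ faces c v R, C ((-1 : ℤ) ^ (d + R.card - G.card)) * (1 + Polynomial.X) ^ G.card +
        C ((-1) ^ d) := by
    rw [facePoly, add_comp, Polynomial.sum_comp, mul_add, Finset.mul_sum, ← Finset.sum_neg_distrib]
    congr 1
    · refine Finset.sum_congr rfl fun G hG => ?_
      have hlt := hg.card_lt hG
      rw [X_pow_comp, show (-1 - Polynomial.X : ℤ[X]) = C (-1) * (1 + Polynomial.X) by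
        simp; ring, mul_pow, ← map_pow, ← mul_assoc, ← map_mul, ← neg_mul, ← map_neg]
      congr 2
      obtain ⟨k, hk⟩ := Nat.exists_eq_add_of_lt hlt
      rw [hk, show G.card + k + 1 - G.card = k + 1 by omega, ← pow_add,
        show G.card + k + 1 + 1 + G.card = 2 * (G.card + 1) + k by ring, pow_add, pow_mul]
      simp [pow_succ]
    · rw [C_comp, ← map_mul, ← pow_add,
        show d + R.card + 1 + (R.card + 1) = 2 * (R.card + 1) + d by ring, pow_add, pow_mul]
      simp
  rw [hcomp, hg.sum_faces_subsets hR]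
  simp only [facePoly, Finset.sum_add_distrib]
  rw [← map_sum, sum_nonempty_powerset_sign hR]
  simp
  ring

end ColoredConfig

namespace ColoredConfig

variable {ι X : Type*} [DecidableEq ι] [Fintype X] [DecidableEq X] {d : ℕ}
variable {c : X → ι} {v : X → Vec d}

/-- The convex hull of the points of `G` with colour `i`. -/
def hull (c : X → ι) (v : X → Vec d) (G : Finset X) (i : ι) : Set (Vec d) :=
  convexHull ℝ (v '' {x | x ∈ G ∧ c x = i})

/-- The Minkowski sum over the colours in `R` of the hulls of the colour classes of `G`. -/
def cell (c : X → ι) (v : X → Vec d) (R : Finset ι) (G : Finset X) : Set (Vec d) :=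
  ∑ i ∈ R, hull c v G i

lemma hull_mono {G H : Finset X} (h : G ⊆ H) (i : ι) : hull c v G i ⊆ hull c v H i :=
  convexHull_mono (Set.image_mono fun _ hx => ⟨h hx.1, hx.2⟩)

lemma mem_cell {R : Finset ι} {G : Finset X} {z : Vec d} :
    z ∈ cell c v R G ↔ ∃ g : ι → Vec d, (∀ i ∈ R, g i ∈ hull c v G i) ∧ ∑ i ∈ R, g i = z := by
  rw [cell, Set.mem_finsetSum]
  constructor
  · rintro ⟨g, hg, h⟩; exact ⟨g, fun i hi => hg hi, h⟩
  · rintro ⟨g, hg, h⟩; exact ⟨g, fun {i} hi => hg i hi, h⟩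

lemma hull_le {u : Module.Dual ℝ (Vec d)} {G : Finset X} {i : ι} {M : ℝ}
    (h : ∀ x ∈ G, c x = i → u (v x) ≤ M) {g : Vec d} (hg : g ∈ hull c v G i) : u g ≤ M := by
  have hsub : hull c v G i ⊆ {w | u w ≤ M} :=
    convexHull_min (by rintro _ ⟨x, ⟨hx, hc⟩, rfl⟩; exact h x hx hc)
      (convex_halfSpace_le u.isLinear M)
  exact hsub hg

lemma hull_eq {u : Module.Dual ℝ (Vec d)} {G : Finset X} {i : ι} {M : ℝ}
    (h : ∀ x ∈ G, c x = i → u (v x) = M) {g : Vec d} (hg : g ∈ hull c v G i) : u g = M := by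
  have hsub : hull c v G i ⊆ {w | u w = M} :=
    convexHull_min (by rintro _ ⟨x, ⟨hx, hc⟩, rfl⟩; exact h x hx hc)
      (convex_hyperplane u.isLinear M)
  exact hsub hg

lemma mem_hull_of_eq {u : Module.Dual ℝ (Vec d)} {G : Finset X} {i : ι} {M : ℝ}
    (h : ∀ x, c x = i → u (v x) ≤ M) (hG : ∀ x, c x = i → u (v x) = M → x ∈ G) {g : Vec d}
    (hg : g ∈ hull c v univ i) (hgM : u g = M) : g ∈ hull c v G i := by
  classical
  have hset : v '' {x | x ∈ (univ : Finset X) ∧ c x = i} =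
      ((univ.filter fun x => c x = i).image v : Finset (Vec d)) := by
    ext; simp
  rw [hull, hset, Finset.mem_convexHull'] at hg
  obtain ⟨w, hw0, hw1, hwg⟩ := hg
  set S := (univ.filter fun x => c x = i).image v with hS
  have hle : ∀ y ∈ S, u y ≤ M := by
    intro y hy
    obtain ⟨x, hx, rfl⟩ := mem_image.1 hy
    exact h x (by simpa using hx)
  have hsum : ∑ y ∈ S, w y * (M - u y) = 0 := by
    have : u g = ∑ y ∈ S, w y * u y := by rw [← hwg, map_sum]; simp
    simp only [mul_sub, Finset.sum_sub_distrib, ← Finset.sum_mul, hw1, ← this]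
    linarith
  have hzero := (Finset.sum_eq_zero_iff_of_nonneg
    (fun y hy => mul_nonneg (hw0 y hy) (sub_nonneg.2 (hle y hy)))).1 hsum
  have hset2 : ((S.filter fun y => u y = M : Finset (Vec d)) : Set (Vec d)) ⊆
      v '' {x | x ∈ G ∧ c x = i} := by
    intro y hy
    simp only [coe_filter, Set.mem_ofPred_eq] at hy
    obtain ⟨x, hx, rfl⟩ := mem_image.1 hy.1
    have hx' : c x = i := by simpa using hx
    exact ⟨x, ⟨hG x hx' hy.2, hx'⟩, rfl⟩
  refine convexHull_mono hset2 ((Finset.mem_convexHull' ).2 ⟨w, ?_, ?_, ?_⟩)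
  · intro y hy; exact hw0 y (mem_filter.1 hy).1
  · rw [← hw1, Finset.sum_filter_of_ne]
    intro y hy hne
    rcases mul_eq_zero.1 (hzero y hy) with h0 | h0
    · exact absurd h0 hne
    · linarith
  · rw [← hwg, Finset.sum_filter_of_ne]
    intro y hy hne
    rcases mul_eq_zero.1 (hzero y hy) with h0 | h0
    · exact absurd (by rw [h0, zero_smul]) hne
    · linarith

lemma Generic.exists_max (hg : Generic c v) (R : Finset ι) (u : Module.Dual ℝ (Vec d)) :
    ∃ M : ι → ℝ, ∀ x, c x ∈ R → u (v x) ≤ M (c x) ∧ (u (v x) = M (c x) ↔ x ∈ topSet c v R u) := by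
  have h : ∀ i, ∃ m : ℝ, i ∈ R → ∃ x ∈ topSet c v R u, c x = i ∧ u (v x) = m := by
    intro i
    by_cases hi : i ∈ R
    · rw [← hg.image_topSet R u] at hi
      obtain ⟨x, hx, hxi⟩ := mem_image.1 hi
      exact ⟨u (v x), fun _ => ⟨x, hx, hxi, rfl⟩⟩
    · exact ⟨0, fun h => absurd h hi⟩
  choose M hM using h
  refine ⟨M, fun x hx => ?_⟩
  obtain ⟨y, hy, hyx, hyM⟩ := hM _ hx
  have hle : u (v x) ≤ M (c x) := hyM ▸ (mem_topSet.1 hy).2 x hyx.symm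
  refine ⟨hle, fun h => mem_topSet.2 ⟨hx, fun z hz => ?_⟩, fun h => ?_⟩
  · rw [h, ← hyM]; exact (mem_topSet.1 hy).2 z (hz.trans hyx.symm)
  · rw [← hyM]; exact topSet_mem_flat (c := c) u x h y hy hyx.symm

lemma Generic.exists_section (hg : Generic c v) (R : Finset ι) (u : Module.Dual ℝ (Vec d)) :
    ∃ s : ι → X, ∀ i, (i ∈ R → s i ∈ topSet c v R u) ∧ c (s i) = i := by
  have h : ∀ i, ∃ x, (i ∈ R → x ∈ topSet c v R u) ∧ c x = i := by
    intro i
    by_cases hi : i ∈ R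
    · have hi' := hi
      rw [← hg.image_topSet R u] at hi'
      obtain ⟨x, hx, hxi⟩ := mem_image.1 hi'
      exact ⟨x, fun _ => hx, hxi⟩
    · obtain ⟨x, hx⟩ := hg.exists_color i
      exact ⟨x, fun h => absurd h hi, hx⟩
  choose s hs using h
  exact ⟨s, hs⟩

/-- The section passing through a given point of the top set. -/
lemma Generic.exists_section_through (hg : Generic c v) (R : Finset ι)
    (u : Module.Dual ℝ (Vec d)) {x : X} (hx : x ∈ topSet c v R u) :
    ∃ s : ι → X, (∀ i, (i ∈ R → s i ∈ topSet c v R u) ∧ c (s i) = i) ∧ s (c x) = x := by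
  obtain ⟨s, hs⟩ := hg.exists_section R u
  refine ⟨Function.update s (c x) x, fun i => ?_, by simp⟩
  by_cases hi : i = c x
  · subst hi; simpa using fun _ => hx
  · simpa [hi] using hs i

lemma section_mem_cell {R : Finset ι} {G : Finset X} {s : ι → X}
    (hs : ∀ i ∈ R, s i ∈ G ∧ c (s i) = i) : ∑ i ∈ R, v (s i) ∈ cell c v R G :=
  mem_cell.2 ⟨fun i => v (s i), fun i hi => subset_convexHull ℝ _ ⟨s i, hs i hi, rfl⟩, rfl⟩

lemma le_sum_of_mem_cell {R : Finset ι} {u : Module.Dual ℝ (Vec d)} {M : ι → ℝ}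
    (hM : ∀ x, c x ∈ R → u (v x) ≤ M (c x)) {y : Vec d} (hy : y ∈ cell c v R univ) :
    u y ≤ ∑ i ∈ R, M i := by
  obtain ⟨g, hgm, rfl⟩ := mem_cell.1 hy
  rw [map_sum]
  refine Finset.sum_le_sum fun i hi => hull_le ?_ (hgm i hi)
  rintro x - rfl
  exact hM x hi

/-- The face of the Minkowski sum in a given direction. -/
lemma Generic.maximizers_eq (hg : Generic c v) (R : Finset ι) (u : Module.Dual ℝ (Vec d)) :
    {z | z ∈ cell c v R univ ∧ ∀ y ∈ cell c v R univ, u y ≤ u z} =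
      cell c v R (topSet c v R u) := by
  obtain ⟨M, hM⟩ := hg.exists_max R u
  ext z
  constructor
  · rintro ⟨hz, hmax⟩
    obtain ⟨g, hgm, rfl⟩ := mem_cell.1 hz
    obtain ⟨s, hs⟩ := hg.exists_section R u
    have h1 := hmax _ (section_mem_cell (G := univ) (s := s) (v := v) (R := R)
      fun i hi => ⟨mem_univ _, (hs i).2⟩)
    rw [map_sum, map_sum] at h1
    have h2 : ∑ i ∈ R, u (v (s i)) = ∑ i ∈ R, M i := by
      refine Finset.sum_congr rfl fun i hi => ?_
      have := (hM (s i) (by rwa [(hs i).2])).2.2 ((hs i).1 hi)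
      rwa [(hs i).2] at this
    have hle : ∀ i ∈ R, u (g i) ≤ M i := by
      intro i hi
      refine hull_le ?_ (hgm i hi)
      rintro x - rfl
      exact (hM x hi).1
    have heq := (Finset.sum_eq_sum_iff_of_le hle).1
      (le_antisymm (Finset.sum_le_sum hle) (h2 ▸ h1))
    refine mem_cell.2 ⟨g, fun i hi => mem_hull_of_eq ?_ ?_ (hgm i hi) (heq i hi), rfl⟩
    · rintro x rfl; exact (hM x hi).1
    · rintro x rfl; exact (hM x hi).2.1
  · intro hz
    obtain ⟨g, hgm, rfl⟩ := mem_cell.1 hz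
    refine ⟨mem_cell.2 ⟨g, fun i hi => hull_mono (subset_univ _) i (hgm i hi), rfl⟩, fun y hy => ?_⟩
    refine (le_sum_of_mem_cell (fun x hx => (hM x hx).1) hy).trans (le_of_eq ?_)
    rw [map_sum]
    refine Finset.sum_congr rfl fun i hi => (hull_eq ?_ (hgm i hi)).symm
    rintro x hx rfl
    exact (hM x hi).2.2 hx

lemma Generic.topSet_subset (hg : Generic c v) {R : Finset ι} {u u' : Module.Dual ℝ (Vec d)}
    (h : cell c v R (topSet c v R u) = cell c v R (topSet c v R u')) :
    topSet c v R u ⊆ topSet c v R u' := by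
  intro x hx
  obtain ⟨s, hs, hsx⟩ := hg.exists_section_through R u hx
  have hz := section_mem_cell (v := v) (G := topSet c v R u) (R := R)
    fun i hi => ⟨(hs i).1 hi, (hs i).2⟩
  rw [h, ← hg.maximizers_eq] at hz
  obtain ⟨M, hM⟩ := hg.exists_max R u'
  obtain ⟨s', hs'⟩ := hg.exists_section R u'
  have h1 := hz.2 _ (section_mem_cell (G := univ) (s := s') (v := v) (R := R)
      fun i hi => ⟨mem_univ _, (hs' i).2⟩)
  rw [map_sum, map_sum] at h1
  have h2 : ∑ i ∈ R, u' (v (s' i)) = ∑ i ∈ R, M i := by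
    refine Finset.sum_congr rfl fun i hi => ?_
    have := (hM (s' i) (by rwa [(hs' i).2])).2.2 ((hs' i).1 hi)
    rwa [(hs' i).2] at this
  have hle : ∀ i ∈ R, u' (v (s i)) ≤ M i := by
    intro i hi
    have := (hM (s i) (by rwa [(hs i).2])).1
    rwa [(hs i).2] at this
  have heq := (Finset.sum_eq_sum_iff_of_le hle).1
      (le_antisymm (Finset.sum_le_sum hle) (h2 ▸ h1))
  have hxR := (mem_topSet.1 hx).1
  have := heq _ hxR
  rw [hsx] at this
  exact (hM x hxR).2.1 this

lemma Generic.cell_injOn (hg : Generic c v) (R : Finset ι) :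
    Set.InjOn (cell c v R) (faces c v R) := by
  intro G hG G' hG' h
  obtain ⟨u, -, rfl⟩ := mem_faces.1 hG
  obtain ⟨u', -, rfl⟩ := mem_faces.1 hG'
  exact subset_antisymm (hg.topSet_subset h) (hg.topSet_subset h.symm)

lemma Generic.cell_nonempty (hg : Generic c v) (R : Finset ι) (u : Module.Dual ℝ (Vec d)) :
    (cell c v R (topSet c v R u)).Nonempty := by
  obtain ⟨s, hs⟩ := hg.exists_section R u
  exact ⟨_, section_mem_cell fun i hi => ⟨(hs i).1 hi, (hs i).2⟩⟩

lemma Generic.dualAnnihilator_cell (hg : Generic c v) (R : Finset ι)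
    (u : Module.Dual ℝ (Vec d)) :
    (vectorSpan ℝ (cell c v R (topSet c v R u))).dualAnnihilator =
      flat c v (topSet c v R u) := by
  ext w
  rw [Submodule.mem_dualAnnihilator, mem_flat]
  constructor
  · intro h x hx y hy hxy
    obtain ⟨s, hs, hsx⟩ := hg.exists_section_through R u hx
    have hmem1 := section_mem_cell (v := v) (G := topSet c v R u) (R := R)
      fun i hi => ⟨(hs i).1 hi, (hs i).2⟩
    have hmem2 := section_mem_cell (v := v) (G := topSet c v R u) (R := R)
      (s := Function.update s (c x) y) fun i hi => by
        by_cases hi' : i = c x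
        · subst hi'; simpa using ⟨hy, hxy.symm⟩
        · simpa [hi'] using ⟨(hs i).1 hi, (hs i).2⟩
    have h1 := h _ (vsub_mem_vectorSpan ℝ hmem1 hmem2)
    rw [vsub_eq_sub, ← Finset.sum_sub_distrib,
      Finset.sum_eq_single (c x) (fun i _ hi => by simp [hi])
        (fun hn => absurd (mem_topSet.1 hx).1 hn), hsx, Function.update_self, map_sub] at h1
    linarith
  · intro h
    have h' : ∀ i, ∃ m, ∀ x ∈ topSet c v R u, c x = i → w (v x) = m := by
      intro i
      by_cases hi : ∃ x ∈ topSet c v R u, c x = i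
      · obtain ⟨x, hx, hxi⟩ := hi
        exact ⟨w (v x), fun y hy hyi => h y hy x hx (hyi.trans hxi.symm)⟩
      · push Not at hi
        exact ⟨0, fun x hx hxi => absurd hxi (hi x hx)⟩
    choose m hm using h'
    have hconst : ∀ z ∈ cell c v R (topSet c v R u), w z = ∑ i ∈ R, m i := by
      intro z hz
      obtain ⟨g, hgm, rfl⟩ := mem_cell.1 hz
      rw [map_sum]
      exact Finset.sum_congr rfl fun i hi => hull_eq (hm i) (hgm i hi)
    intro z hz
    have hle : vectorSpan ℝ (cell c v R (topSet c v R u)) ≤ LinearMap.ker w := by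
      rw [vectorSpan_def, Submodule.span_le]
      rintro _ ⟨a, ha, b, hb, rfl⟩
      simp [hconst a ha, hconst b hb]
    exact hle hz

lemma Generic.sdim_cell (hg : Generic c v) (R : Finset ι) (u : Module.Dual ℝ (Vec d)) :
    sdim (cell c v R (topSet c v R u)) =
      d - (Module.finrank ℝ (flat c v (topSet c v R u)) : ℤ) := by
  rw [sdim, if_neg (hg.cell_nonempty R u).ne_empty, direction_affineSpan]
  have hflat : Module.finrank ℝ (vectorSpan ℝ (cell c v R (topSet c v R u))).dualAnnihilator =
      Module.finrank ℝ (flat c v (topSet c v R u)) := by rw [hg.dualAnnihilator_cell]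
  have := Subspace.finrank_add_finrank_dualAnnihilator_eq
    (vectorSpan ℝ (cell c v R (topSet c v R u)))
  rw [Module.finrank_fin_fun, hflat] at this
  omega

lemma cell_topSet_zero (R : Finset ι) : cell c v R (topSet c v R 0) = cell c v R univ := by
  refine Finset.sum_congr rfl fun i hi => ?_
  rw [hull, hull, topSet_zero]
  congr 2
  ext x
  simp only [mem_filter, mem_univ, true_and, Set.mem_ofPred_eq]
  exact ⟨fun h => h.2, fun h => ⟨h ▸ hi, h⟩⟩

lemma Generic.sdim_univ (hg : Generic c v) {R : Finset ι} (hR : R.Nonempty) :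
    sdim (cell c v R univ) = d := by
  rw [← cell_topSet_zero, hg.sdim_cell]
  have : flat c v (topSet c v R 0) = ⊥ := by
    rw [eq_bot_iff, topSet_zero]
    intro z hz
    exact (Submodule.mem_bot ℝ).2 (hg.eq_zero_of_color hR hz)
  rw [this, finrank_bot]; simp

lemma Generic.isProperFace_iff (hg : Generic c v) {R : Finset ι} (hR : R.Nonempty)
    {F : Set (Vec d)} :
    IsProperFace (cell c v R univ) F ↔ ∃ G ∈ faces c v R, cell c v R G = F := by
  constructor
  · rintro ⟨hexp, hne, hneq⟩
    obtain ⟨l, hl⟩ := hexp hne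
    have hl' : F = cell c v R (topSet c v R (l : Vec d →ₗ[ℝ] ℝ)) := by
      rw [← hg.maximizers_eq]; exact hl
    refine ⟨_, mem_faces.2 ⟨(l : Vec d →ₗ[ℝ] ℝ), fun h0 => hneq ?_, rfl⟩, hl'.symm⟩
    rw [hl', h0]
    exact cell_topSet_zero R
  · rintro ⟨G, hG, rfl⟩
    obtain ⟨u, hu, rfl⟩ := mem_faces.1 hG
    refine ⟨fun _ => ⟨LinearMap.toContinuousLinearMap u, ?_⟩, hg.cell_nonempty R u, fun h => ?_⟩
    · rw [← hg.maximizers_eq]; rfl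
    · rw [← cell_topSet_zero] at h
      have h1 := hg.topSet_subset h.symm
      rw [topSet_zero] at h1
      exact hu (hg.eq_zero_of_color hR (flat_anti h1 (topSet_mem_flat u)))

lemma Generic.sdim_face (hg : Generic c v) {R : Finset ι} (hR : R.Nonempty) {G : Finset X}
    (hG : G ∈ faces c v R) : sdim (cell c v R G) = (G.card : ℤ) - R.card := by
  have hlt := hg.card_lt hG
  have himg := hg.image_eq hG
  obtain ⟨u, hu, rfl⟩ := mem_faces.1 hG
  have hne : (topSet c v R u).Nonempty := by
    rw [← Finset.image_nonempty (f := c), himg]; exact hR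
  have := hg.finrank_flat hne (by rw [himg]; omega)
  rw [himg] at this
  rw [hg.sdim_cell]
  omega

/-- The face numbers of a Minkowski sum count the combinatorial faces. -/
theorem Generic.fPoly_eq (hg : Generic c v) {R : Finset ι} (hR : R.Nonempty) (k : ℕ) {j : ℤ}
    (hj : (k : ℤ) = j + R.card) :
    fPoly (cell c v R univ) j = ((faces c v R).filter fun G => G.card = k).card := by
  have hset : {F : Set (Vec d) | IsProperFace (cell c v R univ) F ∧ sdim F = j} =
      cell c v R '' (((faces c v R).filter fun G => G.card = k : Finset _) : Set _) := by
    ext F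
    simp only [Set.mem_ofPred_eq, hg.isProperFace_iff hR, Set.mem_image, coe_filter]
    constructor
    · rintro ⟨⟨G, hG, rfl⟩, hd⟩
      rw [hg.sdim_face hR hG] at hd
      exact ⟨G, ⟨hG, by omega⟩, rfl⟩
    · rintro ⟨G, ⟨hG, hk⟩, rfl⟩
      refine ⟨⟨G, hG, rfl⟩, ?_⟩
      rw [hg.sdim_face hR hG]; omega
  change Nat.card ({F : Set (Vec d) | IsProperFace (cell c v R univ) F ∧ sdim F = j} : Set _) = _
  rw [Nat.card_coe_set_eq, hset, Set.InjOn.ncard_image, Set.ncard_coe_finset]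
  exact (hg.cell_injOn R).mono (by intro G hG; exact (mem_filter.1 hG).1)

end ColoredConfig

namespace TruncatedPowers
open Polynomial

lemma ch_natCast (a : ℤ) (i : ℕ) : ch a i = Ring.choose a i := by simp [ch]

lemma ch_pascal (a : ℤ) (i : ℕ) :
    ch (a + 1) ((i + 1 : ℕ) : ℤ) = ch a i + ch a ((i + 1 : ℕ) : ℤ) := by
  rw [ch_natCast, ch_natCast, ch_natCast, Ring.choose_succ_succ]

lemma ch_natCast_natCast (a b : ℕ) : ch a b = (a.choose b : ℤ) := by
  rw [ch_natCast, Ring.choose_natCast]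

lemma ch_neg (a : ℤ) {b : ℤ} (hb : b < 0) : ch a b = 0 := by
  rw [ch, if_neg (by omega)]

/-- The truncation of `(1+X)^n` in the basis `X^i (1+X)^(D-i)`. -/
def trunc (D M : ℕ) (n : ℤ) : ℤ[X] :=
  ∑ i ∈ range (M + 1), C (ch (n - D - 1 + i) i) * (X ^ i * (1 + X) ^ (D - i))

lemma trunc_succ {D M : ℕ} (hM : M ≤ D) (n : ℤ) :
    trunc D M (n + 1) = (1 + X) * trunc D M n -
      C (ch (n + 1 - D - 1 + M) M) * (X ^ (M + 1) * (1 + X) ^ (D - M)) := by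
  induction M with
  | zero =>
    simp [trunc, ch]
    ring
  | succ M ih =>
    have h1 : ∀ n, trunc D (M + 1) n = trunc D M n +
        C (ch (n - D - 1 + (M + 1 : ℕ)) (M + 1 : ℕ)) * (X ^ (M + 1) * (1 + X) ^ (D - (M + 1))) := by
      intro n; rw [trunc, Finset.sum_range_succ, trunc]
    rw [h1, h1, ih (by omega)]
    obtain ⟨k, rfl⟩ := Nat.exists_eq_add_of_le hM
    have hp := ch_pascal (n - (M + 1 + k : ℕ) - 1 + (M + 1 : ℕ)) M
    rw [show n - (M + 1 + k : ℕ) - 1 + (M + 1 : ℕ) + 1 =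
      n + 1 - (M + 1 + k : ℕ) - 1 + (M + 1 : ℕ) by ring] at hp
    rw [hp, show n + 1 - (M + 1 + k : ℕ) - 1 + (M : ℕ) =
      n - (M + 1 + k : ℕ) - 1 + (M + 1 : ℕ) by push_cast; ring,
      show M + 1 + k - M = k + 1 by omega, show M + 1 + k - (M + 1) = k by omega]
    simp only [map_add]
    ring

lemma trunc_base {D M : ℕ} (hM : 1 ≤ M) (hMD : M ≤ D) :
    trunc D M ((D : ℤ) - 1) = (1 + X) ^ (D - 1) := by
  have hz : ∀ i : ℕ, ch ((D : ℤ) - 1 - D - 1 + (i + 2 : ℕ)) (i + 2 : ℕ) = 0 := by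
    intro i
    rw [show (D : ℤ) - 1 - D - 1 + (i + 2 : ℕ) = (i : ℕ) by push_cast; ring, ch_natCast_natCast,
      Nat.choose_eq_zero_of_lt (by omega)]
    rfl
  obtain ⟨k, rfl⟩ := Nat.exists_eq_add_of_le hM
  rw [trunc, show 1 + k + 1 = k + 2 by ring, Finset.sum_range_succ', Finset.sum_range_succ']
  rw [Finset.sum_eq_zero fun i _ => by rw [show i + 1 + 1 = i + 2 by ring, hz]; simp]
  have h1 : ch ((D : ℤ) - 1 - D - 1 + (0 + 1 : ℕ)) (0 + 1 : ℕ) = -1 := by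
    rw [show (D : ℤ) - 1 - D - 1 + (0 + 1 : ℕ) = -1 by push_cast; ring, ch_natCast]
    simp
  have h0 : ch ((D : ℤ) - 1 - D - 1 + (0 : ℕ)) (0 : ℕ) = 1 := by
    rw [ch_natCast]; simp
  rw [h1, h0]
  obtain ⟨e, rfl⟩ := Nat.exists_eq_add_of_le (hM.trans hMD)
  simp only [show 1 + e - (0 + 1) = e by omega, Nat.sub_zero]
  simp
  ring

/-- `trunc` agrees with the power up to the truncation order. -/
lemma dvd_trunc_sub {D M : ℕ} (hM : 1 ≤ M) (hMD : M ≤ D) {n : ℕ} (hn : D ≤ n + 1) :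
    X ^ (M + 1) ∣ trunc D M n - (1 + X) ^ n := by
  obtain ⟨k, hk⟩ := Nat.exists_eq_add_of_le hn
  have hD : 1 ≤ D := hM.trans hMD
  obtain rfl : n = D - 1 + k := by omega
  clear hk hn
  induction k with
  | zero =>
    have := trunc_base hM hMD
    rw [show ((D - 1 + 0 : ℕ) : ℤ) = D - 1 by omega, this]
    simp
  | succ k ih =>
    rw [← add_assoc, Nat.cast_succ, trunc_succ hMD, pow_succ (1 + X : ℤ[X])]
    have : (1 + X) * trunc D M ((D - 1 + k : ℕ) : ℤ) -
        C (ch (((D - 1 + k : ℕ) : ℤ) + 1 - D - 1 + M) M) * (X ^ (M + 1) * (1 + X) ^ (D - M)) -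
          (1 + X) ^ (D - 1 + k) * (1 + X) =
        (1 + X) * (trunc D M ((D - 1 + k : ℕ) : ℤ) - (1 + X) ^ (D - 1 + k)) -
          X ^ (M + 1) * ((1 + X) ^ (D - M) *
            C (ch (((D - 1 + k : ℕ) : ℤ) + 1 - D - 1 + M) M)) := by ring
    rw [this]
    exact dvd_sub (ih.mul_left _) (dvd_mul_right _ _)

/-- The twistion `p(X) ↦ (-1)^D p(-1-X)`. -/
def twist (D : ℕ) (p : ℤ[X]) : ℤ[X] := C ((-1) ^ D) * p.comp (-1 - X)

lemma twist_sub (D : ℕ) (p q : ℤ[X]) : twist D (p - q) = twist D p - twist D q := by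
  simp [twist, mul_sub]

lemma twist_sum {α : Type*} (D : ℕ) (s : Finset α) (p : α → ℤ[X]) :
    twist D (∑ i ∈ s, p i) = ∑ i ∈ s, twist D (p i) := by
  simp only [twist, Polynomial.sum_comp, Finset.mul_sum]

lemma twist_C_mul (D : ℕ) (a : ℤ) (p : ℤ[X]) : twist D (C a * p) = C a * twist D p := by
  simp [twist]; ring

lemma twist_add (D : ℕ) (p q : ℤ[X]) : twist D (p + q) = twist D p + twist D q := by
  simp [twist, mul_add]

lemma twist_basis {D i j : ℕ} (h : i + j = D) :
    twist D (X ^ i * (1 + X) ^ j) = X ^ j * (1 + X) ^ i := by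
  subst h
  rw [twist, mul_comp, X_pow_comp, pow_comp, add_comp, one_comp, X_comp,
    show (-1 - X : ℤ[X]) = (-1) * (1 + X) by ring,
    show (1 + -1 * (1 + X) : ℤ[X]) = (-1) * X by ring,
    mul_pow, mul_pow, C_pow, C_neg, C_1, pow_add]
  calc _ = ((-1 : ℤ[X]) ^ i * (-1) ^ i) * ((-1) ^ j * (-1) ^ j) * (X ^ j * (1 + X) ^ i) := by ring
    _ = _ := by rw [← mul_pow, ← mul_pow]; simp

lemma twist_twist (D : ℕ) (p : ℤ[X]) : twist D (twist D p) = p := by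
  rw [twist, twist, mul_comp, C_comp, comp_assoc, ← mul_assoc, ← C_mul, ← mul_pow]
  simp

lemma twist_mul_pow (D k : ℕ) (p : ℤ[X]) :
    (1 + X) ^ k ∣ twist D (X ^ k * p) := by
  refine ⟨C ((-1) ^ D) * ((-1) ^ k * p.comp (-1 - X)), ?_⟩
  rw [twist, mul_comp, X_pow_comp, show (-1 - X : ℤ[X]) = (-1) * (1 + X) by ring, mul_pow]
  ring

/-- A polynomial of small degree vanishing to high order at `0` and `-1` is zero. -/
lemma eq_zero_of_dvd {D A B : ℕ} (hAB : D < A + B) {g : ℤ[X]} (hdeg : g.natDegree ≤ D)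
    (h1 : X ^ A ∣ g) (h2 : X ^ B ∣ twist D g) : g = 0 := by
  obtain ⟨q, hq⟩ := h2
  have h3 : (1 + X) ^ B ∣ g := by
    have := twist_mul_pow D B q
    rwa [← hq, twist_twist] at this
  have hcop : IsCoprime ((X : ℤ[X]) ^ A) ((1 + X) ^ B) := by
    refine IsCoprime.pow ⟨-1, 1, by ring⟩
  have hdvd := hcop.mul_dvd h1 h3
  have hm : ((X : ℤ[X]) ^ A * (1 + X) ^ B).Monic := by
    refine (monic_X_pow A).mul (Monic.pow ?_ B)
    rw [add_comm]; exact monic_X_add_C 1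
  by_contra hne
  have h4 := natDegree_le_of_dvd hdvd hne
  have h5 : ((X : ℤ[X]) ^ A * (1 + X) ^ B).natDegree = A + B := by
    rw [Monic.natDegree_mul (monic_X_pow A) (Monic.pow (by rw [add_comm]; exact monic_X_add_C 1) B),
      natDegree_X_pow, Monic.natDegree_pow (by rw [add_comm]; exact monic_X_add_C 1), add_comm 1 X]
    rw [show (X + 1 : ℤ[X]) = X + C 1 by simp, natDegree_X_add_C, mul_one]
  omega

lemma natDegree_basis_le (i j : ℕ) : ((X : ℤ[X]) ^ i * (1 + X) ^ j).natDegree ≤ i + j := by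
  refine natDegree_mul_le.trans (Nat.add_le_add (natDegree_X_pow_le i) ?_)
  refine natDegree_pow_le.trans ?_
  have : (1 + X : ℤ[X]).natDegree ≤ 1 := by
    rw [show (1 + X : ℤ[X]) = X + C 1 by simp [add_comm]]; exact (natDegree_X_add_C 1).le
  nlinarith

lemma natDegree_trunc_le {D M : ℕ} (hM : M ≤ D) (n : ℤ) : (trunc D M n).natDegree ≤ D := by
  refine natDegree_sum_le_of_forall_le _ _ fun i hi => ?_
  refine (natDegree_C_mul_le _ _).trans ((natDegree_basis_le _ _).trans ?_)
  have := mem_range.1 hi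
  omega

lemma twist_trunc {D M : ℕ} (hM : M ≤ D) (n : ℤ) :
    twist D (trunc D M n) =
      ∑ i ∈ range (M + 1), C (ch (n - D - 1 + i) i) * (X ^ (D - i) * (1 + X) ^ i) := by
  rw [trunc, twist_sum]
  refine Finset.sum_congr rfl fun i hi => ?_
  have := mem_range.1 hi
  rw [twist_C_mul, twist_basis (by omega)]

lemma dvd_twist_trunc {D M : ℕ} (hM : M ≤ D) (n : ℤ) : X ^ (D - M) ∣ twist D (trunc D M n) := by
  rw [twist_trunc hM]
  refine Finset.dvd_sum fun i hi => ?_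
  have := mem_range.1 hi
  exact Dvd.dvd.mul_left (Dvd.dvd.mul_right (pow_dvd_pow _ (by omega)) _) _

/-- In odd degree, a twist-invariant polynomial is determined to one order more than its
initial terms. -/
lemma dvd_sub_of_twist_eq {h : ℕ} (hh : 1 ≤ h) {f : ℤ[X]} (hdeg : f.natDegree ≤ 2 * h + 1)
    {n : ℕ} (hn : 2 * h + 1 ≤ n + 1) (hlow : X ^ (h + 1) ∣ f - (1 + X) ^ n)
    (hrefl : twist (2 * h + 1) f = f) :
    X ^ (h + 2) ∣ f - ((1 + X) ^ n - C (ch ((n : ℤ) - h - 2) (h + 1 : ℕ)) * X ^ (h + 1)) := by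
  set t := trunc (2 * h + 1) h n with ht
  have hf : f = t + twist (2 * h + 1) t := by
    rw [← sub_eq_zero]
    have hd := dvd_twist_trunc (D := 2 * h + 1) (M := h) (by omega) (n : ℤ)
    rw [show 2 * h + 1 - h = h + 1 by omega] at hd
    have hdvd : X ^ (h + 1) ∣ f - (t + twist (2 * h + 1) t) := by
      have := dvd_sub (dvd_sub hlow (dvd_trunc_sub hh (by omega : h ≤ 2 * h + 1) hn)) hd
      rwa [show f - (1 + X) ^ n - (trunc (2 * h + 1) h n - (1 + X) ^ n) -
        twist (2 * h + 1) (trunc (2 * h + 1) h n) = f - (t + twist (2 * h + 1) t) by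
          rw [ht]; ring] at this
    refine eq_zero_of_dvd (D := 2 * h + 1) (A := h + 1) (B := h + 1) (by omega) ?_ hdvd ?_
    · refine (natDegree_sub_le _ _).trans (max_le hdeg ((natDegree_add_le _ _).trans
        (max_le (natDegree_trunc_le (by omega) _) ?_)))
      rw [twist_trunc (by omega)]
      refine natDegree_sum_le_of_forall_le _ _ fun i hi => ?_
      refine (natDegree_C_mul_le _ _).trans ((natDegree_basis_le _ _).trans ?_)
      have := mem_range.1 hi
      omega
    · rw [twist_sub, twist_add, twist_twist, hrefl, add_comm (twist _ _)]
      exact hdvd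
  have h1 := dvd_trunc_sub (D := 2 * h + 1) (M := h + 1) (by omega) (by omega) hn
  have h2 : trunc (2 * h + 1) (h + 1) n = t +
      C (ch ((n : ℤ) - h - 1) (h + 1 : ℕ)) * (X ^ (h + 1) * (1 + X) ^ h) := by
    rw [trunc, Finset.sum_range_succ, ht, trunc]
    congr 4
    · push_cast; ring
    · omega
  have h3 : X ^ (h + 2) ∣ twist (2 * h + 1) t -
      C (ch ((n : ℤ) - h - 2) (h : ℕ)) * (X ^ (h + 1) * (1 + X) ^ h) := by
    rw [ht, twist_trunc (by omega), Finset.sum_range_succ,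
      show (n : ℤ) - (2 * h + 1 : ℕ) - 1 + h = n - h - 2 by push_cast; ring,
      show 2 * h + 1 - h = h + 1 by omega, add_sub_cancel_right]
    refine Finset.dvd_sum fun i hi => ?_
    have := mem_range.1 hi
    exact Dvd.dvd.mul_left (Dvd.dvd.mul_right (pow_dvd_pow _ (by omega)) _) _
  have hp := ch_pascal ((n : ℤ) - h - 2) h
  rw [show (n : ℤ) - h - 2 + 1 = n - h - 1 by ring] at hp
  have h4 : X ^ (h + 2) ∣ C (ch ((n : ℤ) - h - 2) (h + 1 : ℕ)) * (X ^ (h + 1) * (1 + X) ^ h) -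
      C (ch ((n : ℤ) - h - 2) (h + 1 : ℕ)) * (X : ℤ[X]) ^ (h + 1) := by
    have : (X : ℤ[X]) ∣ (1 + X) ^ h - 1 := by
      have := sub_dvd_pow_sub_pow (1 + X : ℤ[X]) 1 h
      simpa using this
    obtain ⟨q, hq⟩ := this
    refine ⟨C (ch ((n : ℤ) - h - 2) (h + 1 : ℕ)) * q, ?_⟩
    rw [sub_eq_iff_eq_add] at hq
    rw [hq]; ring
  have h5 := dvd_sub (dvd_add h1 h3) h4
  convert h5 using 1
  rw [hf, h2, hp, C_add]
  ring

end TruncatedPowers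

namespace ColoredConfig
open Polynomial TruncatedPowers

variable {ι X : Type*} [DecidableEq ι] [Fintype X] [DecidableEq X] {d : ℕ}
variable {c : X → ι} {v : X → Vec d}

/-- Every sufficiently small set of points spans a face. -/
def Neighborly (c : X → ι) (v : X → Vec d) : Prop :=
  ∀ G : Finset X, G.Nonempty → 2 * G.card + 1 ≤ d + (G.image c).card → G ∈ faces c v (G.image c)

/-- The generating polynomial of all sets with colour set `R`. -/
def colorPoly (c : X → ι) (R : Finset ι) : ℤ[X] :=
  ∑ G ∈ univ.filter (fun G : Finset X => G.image c = R), (Polynomial.X : ℤ[X]) ^ G.card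

lemma sum_colorPoly (c : X → ι) (R : Finset ι) :
    ∑ Q ∈ R.powerset, colorPoly c Q =
      (1 + Polynomial.X) ^ (univ.filter fun x => c x ∈ R).card := by
  have h := Finset.sum_pow_mul_eq_add_pow (Polynomial.X : ℤ[X]) 1 (univ.filter fun x => c x ∈ R)
  simp only [one_pow, mul_one] at h
  rw [add_comm, ← h, ← Finset.sum_fiberwise_of_maps_to (t := R.powerset)
    (g := fun G : Finset X => G.image c)]
  · refine Finset.sum_congr rfl fun Q hQ => Finset.sum_congr ?_ fun _ _ => rfl
    ext G
    simp only [mem_filter, mem_univ, true_and, mem_powerset] at hQ ⊢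
    refine ⟨fun hG => ⟨fun x hx => ?_, hG⟩, fun hG => hG.2⟩
    simpa using hQ (hG ▸ mem_image_of_mem c hx)
  · intro G hG
    rw [mem_powerset] at hG ⊢
    intro i hi
    obtain ⟨x, hx, rfl⟩ := mem_image.1 hi
    simpa using hG hx

lemma colorPoly_empty (c : X → ι) : colorPoly c ∅ = 1 := by
  have : univ.filter (fun G : Finset X => G.image c = ∅) = {∅} := by
    ext G; simp
  rw [colorPoly, this]; simp

lemma Generic.natDegree_facePoly_le (hg : Generic c v) {R : Finset ι} {D : ℕ}
    (hD : D + 1 = d + R.card) : (facePoly c v R).natDegree ≤ D := by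
  refine (natDegree_add_le _ _).trans (max_le ?_ (by rw [natDegree_C]; omega))
  refine natDegree_sum_le_of_forall_le _ _ fun G hG => (natDegree_X_pow_le _).trans ?_
  have := hg.card_lt hG
  omega

lemma coeff_facePoly (R : Finset ι) {k : ℕ} (hk : k ≠ 0) :
    (facePoly c v R).coeff k = ((faces c v R).filter fun G => G.card = k).card := by
  rw [facePoly, coeff_add, coeff_C_of_ne_zero hk, add_zero, finsetSum_coeff, Finset.card_filter]
  push_cast
  refine Finset.sum_congr rfl fun G _ => ?_
  rw [coeff_X_pow]
  simp only [eq_comm]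

lemma Generic.dvd_facePoly_sub (hg : Generic c v) (hn : Neighborly c v) {R : Finset ι}
    (hR : R.Nonempty) {K : ℕ} (hK : 2 * K ≤ d + R.card + 1) :
    Polynomial.X ^ K ∣ facePoly c v R - (colorPoly c R + C ((-1) ^ (R.card + 1))) := by
  have hsub : faces c v R ⊆ univ.filter (fun G : Finset X => G.image c = R) := by
    intro G hG; simpa using hg.image_eq hG
  rw [facePoly, colorPoly, ← Finset.sum_sdiff hsub]
  rw [show ∀ a b e : ℤ[X], a + e - (b + a + e) = -b by intros; ring, dvd_neg]
  refine Finset.dvd_sum fun G hG => pow_dvd_pow _ ?_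
  simp only [mem_sdiff, mem_filter, mem_univ, true_and] at hG
  by_contra! hlt
  refine hG.2 (hG.1 ▸ hn G ?_ ?_)
  · rw [← Finset.image_nonempty (f := c), hG.1]; exact hR
  · rw [hG.1]; omega

lemma Generic.twist_facePoly (hg : Generic c v) {R : Finset ι} (hR : R.Nonempty) {D : ℕ}
    (hD : D + 1 = d + R.card) :
    twist D (facePoly c v R) = ∑ Q ∈ R.powerset.filter (·.Nonempty), facePoly c v Q := by
  rw [← hg.dehn_sommerville hR, twist, ← hD, pow_succ, pow_succ]
  simp

lemma filter_powerset_singleton (i : ι) :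
    ({i} : Finset ι).powerset.filter (·.Nonempty) = {{i}} := by
  ext Q
  simp only [mem_filter, mem_powerset, subset_singleton_iff, mem_singleton]
  constructor
  · rintro ⟨rfl | rfl, h⟩
    · exact absurd h not_nonempty_empty
    · rfl
  · rintro rfl; exact ⟨Or.inr rfl, singleton_nonempty i⟩

lemma colorPoly_singleton (c : X → ι) (i : ι) :
    colorPoly c {i} = (1 + Polynomial.X) ^ (univ.filter fun x => c x = i).card - 1 := by
  have h := sum_colorPoly c {i}
  have hp : ({i} : Finset ι).powerset = {∅, {i}} := by
    ext Q
    simp only [mem_powerset, mem_insert, mem_singleton, subset_singleton_iff]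
  rw [hp, Finset.sum_pair (by simp), colorPoly_empty] at h
  simp only [mem_singleton] at h
  rw [← h]; ring

lemma card_filter_pair (c : X → ι) {i j : ι} (hij : i ≠ j) :
    (univ.filter fun x => c x ∈ ({i, j} : Finset ι)).card =
      (univ.filter fun x => c x = i).card + (univ.filter fun x => c x = j).card := by
  rw [← Finset.card_union_of_disjoint, ← Finset.filter_or]
  · simp
  · rw [Finset.disjoint_filter]
    rintro x - rfl h
    exact hij h

lemma colorPoly_pair (c : X → ι) {i j : ι} (hij : i ≠ j) :
    colorPoly c {i, j} = ((1 + Polynomial.X) ^ (univ.filter fun x => c x = i).card - 1) *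
      ((1 + Polynomial.X) ^ (univ.filter fun x => c x = j).card - 1) := by
  have h := sum_colorPoly c {i, j}
  have hp : ({i, j} : Finset ι).powerset = {∅, {i}, {j}, {i, j}} := by
    ext Q
    simp only [mem_powerset, mem_insert, mem_singleton, ← Finset.coe_subset, ← Finset.coe_inj,
      coe_insert, coe_singleton, coe_empty]
    exact Set.subset_pair_iff_eq
  have hne : ({i} : Finset ι) ≠ {j} := by simpa using hij
  have hne2 : ({i} : Finset ι) ≠ {i, j} := by
    intro h; have : j ∈ ({i} : Finset ι) := h ▸ (by simp)
    exact hij (mem_singleton.1 this).symm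
  have hne3 : ({j} : Finset ι) ≠ {i, j} := by
    intro h; have : i ∈ ({j} : Finset ι) := h ▸ (by simp)
    exact hij (mem_singleton.1 this)
  rw [hp, Finset.sum_insert, Finset.sum_insert, Finset.sum_pair hne3, colorPoly_empty,
    colorPoly_singleton, colorPoly_singleton, card_filter_pair c hij, pow_add] at h
  · linear_combination h
  · simp [hne, hne2]
  · simp only [mem_insert, mem_singleton, not_or]
    exact ⟨(singleton_ne_empty _).symm, (singleton_ne_empty _).symm, (insert_ne_empty _ _).symm⟩

lemma card_filter_fin_three (c : X → Fin 3) :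
    Fintype.card X = (univ.filter fun x => c x = 0).card + (univ.filter fun x => c x = 1).card +
      (univ.filter fun x => c x = 2).card := by
  rw [← Finset.card_univ, Finset.card_eq_sum_card_fiberwise (f := c) (t := univ) (by simp),
    Fin.sum_univ_three]

lemma colorPoly_univ (c : X → Fin 3) :
    colorPoly c univ = ((1 + Polynomial.X) ^ (univ.filter fun x => c x = 0).card - 1) *
      ((1 + Polynomial.X) ^ (univ.filter fun x => c x = 1).card - 1) *
      ((1 + Polynomial.X) ^ (univ.filter fun x => c x = 2).card - 1) := by
  have h := sum_colorPoly c univ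
  have hp : (univ : Finset (Fin 3)).powerset =
      {∅, {0}, {1}, {2}, {0, 1}, {0, 2}, {1, 2}, univ} := by decide
  rw [hp] at h
  rw [Finset.sum_insert (by decide), Finset.sum_insert (by decide), Finset.sum_insert (by decide),
    Finset.sum_insert (by decide), Finset.sum_insert (by decide), Finset.sum_insert (by decide),
    Finset.sum_pair (by decide), colorPoly_empty, colorPoly_singleton, colorPoly_singleton,
    colorPoly_singleton, colorPoly_pair c (by decide), colorPoly_pair c (by decide),
    colorPoly_pair c (by decide)] at h
  simp only [mem_univ, Finset.filter_true] at h
  rw [Finset.card_univ, card_filter_fin_three c, pow_add, pow_add] at h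
  linear_combination h

end ColoredConfig

namespace ColoredConfig
open Polynomial TruncatedPowers

variable {X : Type*} [Fintype X] [DecidableEq X] {d : ℕ} {c : X → Fin 3} {v : X → Vec d}
variable {Y : Type*} [Fintype Y] [DecidableEq Y] {c' : Y → Unit} {v' : Y → Vec (d + 2)}

lemma Generic.twist_facePoly_univ_unit (hg : Generic c' v') :
    twist (d + 2) (facePoly c' v' univ) = facePoly c' v' univ := by
  have h := hg.twist_facePoly (R := {()}) (by simp) (D := d + 2) (by simp)
  rwa [filter_powerset_singleton, Finset.sum_singleton] at h

lemma colorPoly_univ_unit (c' : Y → Unit) :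
    colorPoly c' univ = (1 + Polynomial.X) ^ Fintype.card Y - 1 := by
  have h := colorPoly_singleton c' ()
  rw [show (univ.filter fun y => c' y = ()) = univ by ext; simp, Finset.card_univ] at h
  exact h

lemma Generic.twist_facePoly_univ_fin_three (hg : Generic c v) :
    twist (d + 2) (facePoly c v univ) = facePoly c v univ +
      (facePoly c v {0, 1} + facePoly c v {0, 2} + facePoly c v {1, 2}) +
      (facePoly c v {0} + facePoly c v {1} + facePoly c v {2}) := by
  have hp : (univ : Finset (Fin 3)).powerset.filter (·.Nonempty) =
      {{0}, {1}, {2}, {0, 1}, {0, 2}, {1, 2}, univ} := by decide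
  rw [hg.twist_facePoly univ_nonempty (by simp), hp,
    Finset.sum_insert (by decide), Finset.sum_insert (by decide), Finset.sum_insert (by decide),
    Finset.sum_insert (by decide), Finset.sum_insert (by decide), Finset.sum_pair (by decide)]
  ring

/-- The alternating sum over proper colour sets of the truncated powers. -/
def truncSum (D M : ℕ) (n : Fin 3 → ℤ) : ℤ[X] :=
  (trunc D M (n 0 + n 1) + trunc D M (n 0 + n 2) + trunc D M (n 1 + n 2)) -
    (trunc D M (n 0) + trunc D M (n 1) + trunc D M (n 2))

lemma natDegree_truncSum_le {D M : ℕ} (hM : M ≤ D) (n : Fin 3 → ℤ) :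
    (truncSum D M n).natDegree ≤ D := by
  have h := natDegree_trunc_le hM
  exact (natDegree_sub_le _ _).trans (max_le (natDegree_add_le_of_degree_le
    (natDegree_add_le_of_degree_le (h _) (h _)) (h _)) (natDegree_add_le_of_degree_le
    (natDegree_add_le_of_degree_le (h _) (h _)) (h _)))

lemma dvd_twist_truncSum {D M : ℕ} (hM : M ≤ D) (n : Fin 3 → ℤ) :
    Polynomial.X ^ (D - M) ∣ twist D (truncSum D M n) := by
  have h := dvd_twist_trunc hM
  rw [truncSum, twist_sub]
  simp only [twist_add]
  exact dvd_sub (dvd_add (dvd_add (h _) (h _)) (h _)) (dvd_add (dvd_add (h _) (h _)) (h _))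

lemma dvd_truncSum_sub {D M : ℕ} (hM : 1 ≤ M) (hMD : M ≤ D) {n : Fin 3 → ℕ}
    (hn : ∀ i, D ≤ n i + 1) :
    Polynomial.X ^ (M + 1) ∣ truncSum D M (fun i => n i) -
      (((1 + Polynomial.X) ^ n 0 * (1 + Polynomial.X) ^ n 1 +
        (1 + Polynomial.X) ^ n 0 * (1 + Polynomial.X) ^ n 2 +
        (1 + Polynomial.X) ^ n 1 * (1 + Polynomial.X) ^ n 2) -
      ((1 + Polynomial.X) ^ n 0 + (1 + Polynomial.X) ^ n 1 + (1 + Polynomial.X) ^ n 2)) := by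
  have h0 := hn 0
  have h1 := hn 1
  have h2 := hn 2
  obtain ⟨q0, e0⟩ := dvd_trunc_sub hM hMD (n := n 0) (by omega)
  obtain ⟨q1, e1⟩ := dvd_trunc_sub hM hMD (n := n 1) (by omega)
  obtain ⟨q2, e2⟩ := dvd_trunc_sub hM hMD (n := n 2) (by omega)
  obtain ⟨r0, w0⟩ := dvd_trunc_sub hM hMD (n := n 0 + n 1) (by omega)
  obtain ⟨r1, w1⟩ := dvd_trunc_sub hM hMD (n := n 0 + n 2) (by omega)
  obtain ⟨r2, w2⟩ := dvd_trunc_sub hM hMD (n := n 1 + n 2) (by omega)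
  push_cast at w0 w1 w2
  rw [pow_add] at w0 w1 w2
  refine ⟨r0 + r1 + r2 - (q0 + q1 + q2), ?_⟩
  rw [truncSum]
  linear_combination w0 + w1 + w2 - e0 - e1 - e2

/-- The face polynomial of a single neighbourly configuration, to one order beyond what
neighbourliness gives directly in odd dimension. -/
lemma Generic.dvd_facePoly_singleton_sub (hg : Generic c v) (hn : Neighborly c v) (hd : 2 ≤ d)
    (i : Fin 3) :
    Polynomial.X ^ ((d + 3) / 2) ∣ facePoly c v {i} -
      ((1 + Polynomial.X) ^ (univ.filter fun x => c x = i).card -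
        C (((d : ℤ) - 2 * (d / 2 : ℕ)) *
          ch (((univ.filter fun x => c x = i).card : ℤ) - (d / 2 : ℕ) - 2) ((d / 2 : ℕ) + 1)) *
          Polynomial.X ^ (d / 2 + 1)) := by
  have hlow : ∀ K, 2 * K ≤ d + 2 → Polynomial.X ^ K ∣ facePoly c v {i} -
      (1 + Polynomial.X) ^ (univ.filter fun x => c x = i).card := by
    intro K hK
    have h := hg.dvd_facePoly_sub hn (R := {i}) (by simp) (K := K) (by simpa using hK)
    rw [colorPoly_singleton] at h
    simpa using h
  obtain ⟨h, rfl | rfl⟩ := Nat.even_or_odd' d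
  · rw [show 2 * h / 2 = h by omega, show (2 * h + 3) / 2 = h + 1 by omega]
    simpa using hlow (h + 1) (by omega)
  · rw [show (2 * h + 1) / 2 = h by omega, show (2 * h + 1 + 3) / 2 = h + 2 by omega]
    have ht := hg.twist_facePoly (R := {i}) (by simp) (D := 2 * h + 1) (by simp)
    rw [filter_powerset_singleton, Finset.sum_singleton] at ht
    have := dvd_sub_of_twist_eq (by omega) (hg.natDegree_facePoly_le (R := {i}) (by simp))
      (by have := hg.large i; omega) (hlow (h + 1) (by omega)) ht
    have hone : ((2 * h + 1 : ℕ) : ℤ) - 2 * (h : ℕ) = 1 := by push_cast; ring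
    rw [hone, one_mul]
    exact_mod_cast this

theorem Generic.facePoly_eq (hg : Generic c v) (hn : Neighborly c v) (hg' : Generic c' v')
    (hn' : Neighborly c' v') (hd : 2 ≤ d) (hcard : Fintype.card Y = Fintype.card X)
    {n : Fin 3 → ℕ} (hcn : ∀ i, (univ.filter fun x => c x = i).card = n i) :
    facePoly c v univ = facePoly c' v' univ - truncSum (d + 2) (d / 2 + 1) (fun i => n i) -
      C (((d : ℤ) - 2 * (d / 2 : ℕ)) *
          ∑ i, ch ((n i : ℤ) - (d / 2 : ℕ) - 2) ((d / 2 : ℕ) + 1)) *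
        (Polynomial.X ^ (d / 2 + 2) * (1 + Polynomial.X) ^ (d / 2 + 1)) := by
  have hlarge : ∀ i, d + 1 ≤ n i := fun i => hcn i ▸ hg.large i
  have hN : (1 + Polynomial.X : ℤ[X]) ^ Fintype.card Y =
      (1 + Polynomial.X) ^ n 0 * (1 + Polynomial.X) ^ n 1 * (1 + Polynomial.X) ^ n 2 := by
    rw [hcard, card_filter_fin_three c, hcn, hcn, hcn, pow_add, pow_add]
  rw [← sub_eq_zero]
  have hF : ∀ K, 2 * K ≤ d + 4 → Polynomial.X ^ K ∣ facePoly c' v' univ -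
      (1 + Polynomial.X) ^ n 0 * (1 + Polynomial.X) ^ n 1 * (1 + Polynomial.X) ^ n 2 := by
    intro K hK
    have h := hg'.dvd_facePoly_sub hn' (R := univ) univ_nonempty (K := K) (by simp; omega)
    rw [colorPoly_univ_unit, hN] at h
    simpa using h
  have hf : ∀ K, 2 * K ≤ d + 4 → Polynomial.X ^ K ∣ facePoly c v univ -
      (((1 + Polynomial.X) ^ n 0 - 1) * ((1 + Polynomial.X) ^ n 1 - 1) *
        ((1 + Polynomial.X) ^ n 2 - 1) + 1) := by
    intro K hK
    have h := hg.dvd_facePoly_sub hn (R := univ) univ_nonempty (K := K) (by simp; omega)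
    rw [colorPoly_univ, hcn, hcn, hcn] at h
    simpa using h
  have hpair : ∀ i j, i ≠ j → Polynomial.X ^ ((d + 3) / 2) ∣ facePoly c v {i, j} -
      (((1 + Polynomial.X) ^ n i - 1) * ((1 + Polynomial.X) ^ n j - 1) - 1) := by
    intro i j hij
    have h := hg.dvd_facePoly_sub hn (R := {i, j}) (by simp) (K := (d + 3) / 2)
      (by rw [Finset.card_pair hij]; omega)
    rw [colorPoly_pair c hij, hcn, hcn, Finset.card_pair hij] at h
    rw [sub_eq_add_neg _ (1 : ℤ[X])]
    simpa using h
  refine eq_zero_of_dvd (D := d + 2) (A := d / 2 + 2) (B := (d + 3) / 2) (by omega) ?_ ?_ ?_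
  · have h1 := hg.natDegree_facePoly_le (R := univ) (D := d + 2) (by simp)
    have h2 := hg'.natDegree_facePoly_le (R := univ) (D := d + 2) (by simp)
    have h3 := natDegree_truncSum_le (D := d + 2) (M := d / 2 + 1) (by omega) (fun i => n i)
    refine (natDegree_sub_le _ _).trans (max_le h1 ((natDegree_sub_le _ _).trans
      (max_le ((natDegree_sub_le _ _).trans (max_le h2 h3)) ?_)))
    obtain ⟨h, rfl | rfl⟩ := Nat.even_or_odd' d
    · simp
    · refine (natDegree_C_mul_le _ _).trans ((natDegree_basis_le _ _).trans ?_)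
      omega
  · obtain ⟨q0, e0⟩ := hf (d / 2 + 2) (by omega)
    obtain ⟨q1, e1⟩ := hF (d / 2 + 2) (by omega)
    obtain ⟨q2, e2⟩ := dvd_truncSum_sub (D := d + 2) (M := d / 2 + 1) (by omega) (by omega)
      (n := n) (fun i => by have := hlarge i; omega)
    refine ⟨q0 - q1 + q2 + C (((d : ℤ) - 2 * (d / 2 : ℕ)) *
          ∑ i, ch ((n i : ℤ) - (d / 2 : ℕ) - 2) ((d / 2 : ℕ) + 1)) *
            (1 + Polynomial.X) ^ (d / 2 + 1), ?_⟩
    linear_combination e0 - e1 + e2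
  · obtain ⟨q0, e0⟩ := hf ((d + 3) / 2) (by omega)
    obtain ⟨q1, e1⟩ := hF ((d + 3) / 2) (by omega)
    obtain ⟨r0, w0⟩ := hpair 0 1 (by decide)
    obtain ⟨r1, w1⟩ := hpair 0 2 (by decide)
    obtain ⟨r2, w2⟩ := hpair 1 2 (by decide)
    obtain ⟨s0, z0⟩ := hg.dvd_facePoly_singleton_sub hn hd 0
    obtain ⟨s1, z1⟩ := hg.dvd_facePoly_singleton_sub hn hd 1
    obtain ⟨s2, z2⟩ := hg.dvd_facePoly_singleton_sub hn hd 2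
    have ht := dvd_twist_truncSum (D := d + 2) (M := d / 2 + 1) (by omega) (fun i => n i)
    rw [show d + 2 - (d / 2 + 1) = (d + 3) / 2 by omega] at ht
    obtain ⟨t, ht⟩ := ht
    have hlast : ∃ m : ℤ[X], twist (d + 2) (C (((d : ℤ) - 2 * (d / 2 : ℕ)) *
          ∑ i, ch ((n i : ℤ) - (d / 2 : ℕ) - 2) ((d / 2 : ℕ) + 1)) *
        (Polynomial.X ^ (d / 2 + 2) * (1 + Polynomial.X) ^ (d / 2 + 1))) -
        C (((d : ℤ) - 2 * (d / 2 : ℕ)) *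
          ∑ i, ch ((n i : ℤ) - (d / 2 : ℕ) - 2) ((d / 2 : ℕ) + 1)) *
          Polynomial.X ^ (d / 2 + 1) = Polynomial.X ^ ((d + 3) / 2) * m := by
      obtain ⟨h, rfl | rfl⟩ := Nat.even_or_odd' d
      · exact ⟨0, by simp [twist]⟩
      · rw [show (2 * h + 1) / 2 = h by omega, show (2 * h + 1 + 3) / 2 = h + 2 by omega,
          twist_C_mul, twist_basis (by omega)]
        obtain ⟨a, ha⟩ := sub_dvd_pow_sub_pow (1 + Polynomial.X : ℤ[X]) 1 (h + 2)
        rw [one_pow] at ha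
        refine ⟨C (((2 * h + 1 : ℕ) : ℤ) - 2 * (h : ℕ)) *
          C (∑ i, ch ((n i : ℤ) - (h : ℕ) - 2) ((h : ℕ) + 1)) * a, ?_⟩
        rw [C_mul]
        linear_combination (C (((2 * h + 1 : ℕ) : ℤ) - 2 * (h : ℕ)) *
          C (∑ i, ch ((n i : ℤ) - (h : ℕ) - 2) ((h : ℕ) + 1)) * Polynomial.X ^ (h + 1)) * ha
    obtain ⟨m, hm⟩ := hlast
    rw [twist_sub, twist_sub, twist_sub, hg.twist_facePoly_univ_fin_three,
      hg'.twist_facePoly_univ_unit]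
    refine ⟨q0 + (r0 + r1 + r2) + (s0 + s1 + s2) - q1 + t + m, ?_⟩
    simp only [hcn] at z0 z1 z2
    rw [Fin.sum_univ_three] at hm ⊢
    simp only [C_mul, C_add] at hm z0 z1 z2 ⊢
    linear_combination e0 - e1 + w0 + w1 + w2 + z0 + z1 + z2 + ht + hm

lemma coeff_basis (i j k : ℕ) :
    ((Polynomial.X : ℤ[X]) ^ i * (1 + Polynomial.X) ^ j).coeff k = ch j ((k : ℤ) - i) := by
  rcases le_or_gt i k with hi | hi
  · obtain ⟨e, rfl⟩ := Nat.exists_eq_add_of_le hi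
    rw [add_comm i e, coeff_X_pow_mul, coeff_one_add_X_pow]
    rw [show ((e + i : ℕ) : ℤ) - i = (e : ℕ) by push_cast; ring, ch_natCast_natCast]
  · rw [ch_neg _ (by omega)]
    exact X_pow_dvd_iff.1 (dvd_mul_right _ _) k hi

lemma coeff_trunc {D M : ℕ} (hM : M ≤ D) (n : ℤ) (k : ℕ) :
    (trunc D M n).coeff k =
      ∑ i ∈ range (M + 1), ch ((D : ℤ) - i) ((k : ℤ) - i) * ch (n - D - 1 + i) i := by
  rw [trunc, finsetSum_coeff]
  refine Finset.sum_congr rfl fun i hi => ?_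
  have := mem_range.1 hi
  rw [coeff_C_mul, coeff_basis, Nat.cast_sub (by omega), mul_comm]

lemma coeff_truncSum {D M : ℕ} (hM : M ≤ D) (n : Fin 3 → ℤ) (k : ℕ) :
    (truncSum D M n).coeff k =
      ∑ i ∈ range (M + 1), ch ((D : ℤ) - i) ((k : ℤ) - i) *
        ∑ S ∈ (univ : Finset (Fin 3)).powerset.filter (fun S => S ≠ ∅ ∧ S ≠ univ),
          (-1 : ℤ) ^ S.card * ch ((∑ j ∈ S, n j) - D - 1 + i) i := by
  have hp : (univ : Finset (Fin 3)).powerset.filter (fun S => S ≠ ∅ ∧ S ≠ univ) =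
      {{0}, {1}, {2}, {0, 1}, {0, 2}, {1, 2}} := by decide
  rw [truncSum, coeff_sub]
  simp only [coeff_add, coeff_trunc hM, ← Finset.sum_add_distrib, ← Finset.sum_sub_distrib]
  refine Finset.sum_congr rfl fun i _ => ?_
  rw [hp, Finset.sum_insert (by decide), Finset.sum_insert (by decide),
    Finset.sum_insert (by decide), Finset.sum_insert (by decide), Finset.sum_pair (by decide)]
  simp only [Finset.sum_singleton, Finset.card_singleton]
  rw [Finset.sum_pair (by decide), Finset.sum_pair (by decide), Finset.sum_pair (by decide),
    Finset.card_pair (by decide), Finset.card_pair (by decide), Finset.card_pair (by decide)]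
  ring

/-- The face numbers of the Minkowski sum attain the upper bound. -/
theorem Generic.fPoly_eq_UB3 (hg : Generic c v) (hn : Neighborly c v) (hg' : Generic c' v')
    (hn' : Neighborly c' v') (hd : 2 ≤ d) {n : Fin 3 → ℕ}
    (hcn : ∀ i, (univ.filter fun x => c x = i).card = n i)
    (hcyc : cell c' v' univ univ = cyclicPolytope (d + 2) (n 0 + n 1 + n 2))
    (hcard : Fintype.card Y = n 0 + n 1 + n 2) (k : ℕ) (hk : 1 ≤ k) :
    (fPoly (cell c v univ univ) ((k : ℤ) - 1) : ℤ) = UB3 d n k := by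
  rw [hg.fPoly_eq univ_nonempty (k + 2) (by simp; ring), ← coeff_facePoly univ (by omega),
    hg.facePoly_eq hn hg' hn' hd (by rw [hcard, card_filter_fin_three c, hcn, hcn, hcn]) hcn,
    UB3, ← hcyc, hg'.fPoly_eq univ_nonempty (k + 2) (by simp; ring),
    ← coeff_facePoly univ (by omega), coeff_sub, coeff_sub, coeff_truncSum (by omega),
    coeff_C_mul, coeff_basis]
  congr 1
  · congr 1
    rw [show (d + 2) / 2 + 1 = d / 2 + 1 + 1 by omega]
    refine Finset.sum_congr rfl fun i _ => ?_
    push_cast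
    congr 1
    refine Finset.sum_congr rfl fun S _ => ?_
    congr 2
    ring
  · rw [show ((k + 2 : ℕ) : ℤ) - (d / 2 + 2 : ℕ) = (k : ℤ) - (d / 2 : ℕ) by push_cast; ring]
    push_cast
    ring

end ColoredConfig

namespace PolynomialZeros
open Polynomial

/-- Rolle's theorem for finite sets of zeros. -/
lemma exists_derivative_zeros (f : ℝ[X]) (Z : Finset ℝ) (hZ : ∀ z ∈ Z, f.eval z = 0) :
    ∃ Z' : Finset ℝ, Z.card ≤ Z'.card + 1 ∧ (∀ z ∈ Z', (derivative f).eval z = 0) ∧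
      Disjoint Z' Z ∧ ∀ z ∈ Z', (∃ a ∈ Z, a < z) ∧ ∃ b ∈ Z, z < b := by
  induction Z using Finset.induction_on_max with
  | empty => exact ⟨∅, by simp⟩
  | insert a Z ha ih =>
    obtain ⟨Z', hcard, hzero, hdisj, hbet⟩ := ih fun z hz => hZ z (mem_insert_of_mem hz)
    have haZ : a ∉ Z := fun h => lt_irrefl _ (ha a h)
    rcases Z.eq_empty_or_nonempty with rfl | hne
    · exact ⟨∅, by simp⟩
    set M := Z.max' hne with hM
    have hMZ : M ∈ Z := Z.max'_mem hne
    obtain ⟨z, ⟨hz1, hz2⟩, hz⟩ := exists_deriv_eq_zero (f := fun x => f.eval x) (ha M hMZ)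
      f.continuous.continuousOn
      ((hZ M (mem_insert_of_mem hMZ)).trans (hZ a (mem_insert_self _ _)).symm)
    rw [Polynomial.deriv] at hz
    have hle : ∀ b ∈ Z, b < z := fun b hb => (Z.le_max' b hb).trans_lt hz1
    have hzZ' : z ∉ Z' := by
      intro h
      obtain ⟨b, hb, hzb⟩ := (hbet z h).2
      exact lt_asymm hzb (hle b hb)
    refine ⟨insert z Z', ?_, ?_, ?_, ?_⟩
    · rw [card_insert_of_notMem haZ, card_insert_of_notMem hzZ']; omega
    · intro y hy
      rcases mem_insert.1 hy with rfl | hy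
      · exact hz
      · exact hzero y hy
    · rw [Finset.disjoint_left]
      intro y hy hy'
      rcases mem_insert.1 hy with rfl | hy
      · rcases mem_insert.1 hy' with rfl | hy'
        · exact lt_irrefl _ hz2
        · exact lt_irrefl _ (hle _ hy')
      · rcases mem_insert.1 hy' with rfl | hy'
        · obtain ⟨b, hb, hyb⟩ := (hbet y hy).2
          exact lt_asymm hyb (ha b hb)
        · exact Finset.disjoint_left.1 hdisj hy hy'
    · intro y hy
      rcases mem_insert.1 hy with rfl | hy
      · exact ⟨⟨M, mem_insert_of_mem hMZ, hz1⟩, a, mem_insert_self _ _, hz2⟩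
      · obtain ⟨⟨a', ha', h1⟩, b, hb, h2⟩ := hbet y hy
        exact ⟨⟨a', mem_insert_of_mem ha', h1⟩, b, mem_insert_of_mem hb, h2⟩

/-- The open unit interval with left end `i`. -/
abbrev slot (i : Fin 3) : Set ℝ := Set.Ioo ((i : ℕ) : ℝ) ((i : ℕ) + 1)

lemma eq_of_mem_slot {i j : Fin 3} {x : ℝ} (hi : x ∈ slot i) (hj : x ∈ slot j) : i = j := by
  have h1 : ((i : ℕ) : ℝ) < (j : ℕ) + 1 := hi.1.trans hj.2
  have h2 : ((j : ℕ) : ℝ) < (i : ℕ) + 1 := hj.1.trans hi.2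
  norm_cast at h1 h2
  exact Fin.ext (by omega)

lemma pairwiseDisjoint_of_subset_slot {S : Finset (Fin 3)} {Z : Fin 3 → Finset ℝ}
    (hZ : ∀ i ∈ S, ∀ z ∈ Z i, z ∈ slot i) : (S : Set (Fin 3)).PairwiseDisjoint Z := by
  intro i hi j hj hij
  refine Finset.disjoint_left.2 fun z hz hz' => hij ?_
  exact eq_of_mem_slot (hZ i hi z hz) (hZ j hj z hz')

lemma eq_zero_of_degree_lt_sum {S : Finset (Fin 3)} {Z : Fin 3 → Finset ℝ} {r : ℝ[X]}
    (hZ : ∀ i ∈ S, ∀ z ∈ Z i, z ∈ slot i) (hr : ∀ i ∈ S, ∀ z ∈ Z i, r.eval z = 0)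
    (hdeg : r.degree < (∑ i ∈ S, (Z i).card : ℕ)) : r = 0 := by
  refine Polynomial.eq_zero_of_degree_lt_of_eval_finset_eq_zero (S.biUnion Z) ?_ ?_
  · rwa [Finset.card_biUnion (pairwiseDisjoint_of_subset_slot hZ)]
  · intro x hx
    obtain ⟨i, hi, hx⟩ := mem_biUnion.1 hx
    exact hr i hi x hx

lemma ordConnected_between {i : Fin 3} {Z Z' : Finset ℝ} (hZ : ∀ z ∈ Z, z ∈ slot i)
    (h : ∀ z ∈ Z', (∃ a ∈ Z, a < z) ∧ ∃ b ∈ Z, z < b) : ∀ z ∈ Z', z ∈ slot i := by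
  intro z hz
  obtain ⟨⟨a, ha, haz⟩, b, hb, hzb⟩ := h z hz
  exact ⟨(hZ a ha).1.trans haz, hzb.trans (hZ b hb).2⟩

/-- Zeros of the second derivative forced by a set `A` of double zeros. -/
lemma exists_second_derivative_zeros (f : ℝ[X]) {A Z : Finset ℝ} (hAZ : A ⊆ Z)
    (hZ : ∀ z ∈ Z, f.eval z = 0) (hA : ∀ a ∈ A, (derivative f).eval a = 0) :
    ∃ R : Finset ℝ, Z.card + A.card ≤ R.card + 2 ∧
      (∀ z ∈ R, (derivative (derivative f)).eval z = 0) ∧ Disjoint R A ∧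
      ∀ z ∈ R, (∃ a ∈ Z, a < z) ∧ ∃ b ∈ Z, z < b := by
  obtain ⟨B, hB1, hB2, hB3, hB4⟩ := exists_derivative_zeros f Z hZ
  have hdisj : Disjoint B A := hB3.mono_right hAZ
  obtain ⟨R, hR1, hR2, hR3, hR4⟩ := exists_derivative_zeros (derivative f) (B ∪ A) (by
    intro z hz
    rcases mem_union.1 hz with h | h
    · exact hB2 z h
    · exact hA z h)
  rw [card_union_of_disjoint hdisj] at hR1
  refine ⟨R, by omega, hR2, hR3.mono_right subset_union_right, fun z hz => ?_⟩
  obtain ⟨⟨a, ha, haz⟩, b, hb, hzb⟩ := hR4 z hz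
  constructor
  · rcases mem_union.1 ha with h | h
    · obtain ⟨⟨a', ha', h'⟩, -⟩ := hB4 a h
      exact ⟨a', ha', h'.trans haz⟩
    · exact ⟨a, hAZ h, haz⟩
  · rcases mem_union.1 hb with h | h
    · obtain ⟨-, b', hb', h'⟩ := hB4 b h
      exact ⟨b', hb', hzb.trans h'⟩
    · exact ⟨b, hAZ h, hzb⟩

lemma sq_dvd_of_double_zero {f : ℝ[X]} {a : ℝ} (h0 : f.eval a = 0)
    (h1 : (derivative f).eval a = 0) : (X - C a) ^ 2 ∣ f := by
  obtain ⟨q, rfl⟩ := dvd_iff_isRoot.2 h0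
  have : q.eval a = 0 := by simpa using h1
  obtain ⟨q', rfl⟩ := dvd_iff_isRoot.2 this
  exact ⟨q', by ring⟩

lemma prod_sq_dvd_of_double_zeros {f : ℝ[X]} {A : Finset ℝ} (h0 : ∀ a ∈ A, f.eval a = 0)
    (h1 : ∀ a ∈ A, (derivative f).eval a = 0) : (∏ a ∈ A, (X - C a)) ^ 2 ∣ f := by
  rw [← Finset.prod_pow]
  refine Finset.prod_dvd_of_coprime ?_ fun a ha => sq_dvd_of_double_zero (h0 a ha) (h1 a ha)
  intro a _ b _ hab
  exact IsCoprime.pow (pairwise_coprime_X_sub_C Function.injective_id hab)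

lemma eval_second_derivative {A : Finset ℝ} (m : ℝ[X]) {a : ℝ} (ha : a ∈ A) :
    (derivative (derivative ((∏ b ∈ A, (X - C b)) ^ 2 * m))).eval a =
      2 * (∏ b ∈ A.erase a, (a - b)) ^ 2 * m.eval a := by
  rw [← Finset.mul_prod_erase A _ ha]
  set g := ∏ b ∈ A.erase a, (X - C b) with hg
  have : g.eval a = ∏ b ∈ A.erase a, (a - b) := by simp [hg, eval_prod]
  rw [← this]
  simp [derivative_mul, derivative_pow, -mul_eq_mul_left_iff, -mul_eq_mul_right_iff]
  ring

lemma pos_of_double_zeros {S : Finset (Fin 3)} {f : Fin 3 → ℝ[X]} {r : ℝ[X]}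
    (hf : ∀ i ∈ S, derivative (derivative (f i)) = r) {A : Fin 3 → Finset ℝ}
    (hA : ∀ i ∈ S, (A i).Nonempty) (hAs : ∀ i ∈ S, ∀ a ∈ A i, a ∈ slot i)
    (h0 : ∀ i ∈ S, ∀ a ∈ A i, (f i).eval a = 0)
    (h1 : ∀ i ∈ S, ∀ a ∈ A i, (derivative (f i)).eval a = 0)
    (hdeg : r.degree < (∑ i ∈ S, (2 * (A i).card - 2) + 1 : ℕ)) (hr : 0 < r.leadingCoeff)
    {i : Fin 3} (hi : i ∈ S) {x : ℝ} (hx : x ∈ slot i) (hxA : x ∉ A i) : 0 < (f i).eval x := by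
  have hr0 : r ≠ 0 := by rintro rfl; simp at hr
  have hex : ∀ j, ∃ R : Finset ℝ, j ∈ S → R.card = 2 * (A j).card - 2 ∧
      (∀ z ∈ R, r.eval z = 0) ∧ Disjoint R (A j) ∧
      ∀ z ∈ R, (∃ a ∈ A j, a < z) ∧ ∃ b ∈ A j, z < b := by
    intro j
    by_cases hj : j ∈ S
    · obtain ⟨R, hR1, hR2, hR3, hR4⟩ :=
        exists_second_derivative_zeros (f j) (Subset.refl (A j)) (h0 j hj) (h1 j hj)
      obtain ⟨R', hsub, hcard⟩ := Finset.exists_subset_card_eq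
        (show 2 * (A j).card - 2 ≤ R.card by omega)
      rw [hf j hj] at hR2
      exact ⟨R', fun _ => ⟨hcard, fun z hz => hR2 z (hsub hz), hR3.mono_left hsub,
        fun z hz => hR4 z (hsub hz)⟩⟩
    · exact ⟨∅, fun h => absurd h hj⟩
  choose R hR using hex
  have hRs : ∀ j ∈ S, ∀ z ∈ R j, z ∈ slot j := fun j hj =>
    ordConnected_between (hAs j hj) (hR j hj).2.2.2
  have hextra : ∀ W : Finset ℝ, (∀ z ∈ W, z ∈ slot i) → (∀ z ∈ W, r.eval z = 0) →
      W.card ≤ 2 * (A i).card - 2 := by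
    intro W hW1 hW2
    by_contra! hlt
    refine hr0 (eq_zero_of_degree_lt_sum (S := S) (Z := Function.update R i W) ?_ ?_
      (hdeg.trans_le ?_))
    · intro j hj z hz
      by_cases h : j = i
      · subst h; rw [Function.update_self] at hz; exact hW1 z hz
      · rw [Function.update_of_ne h] at hz; exact hRs j hj z hz
    · intro j hj z hz
      by_cases h : j = i
      · subst h; rw [Function.update_self] at hz; exact hW2 z hz
      · rw [Function.update_of_ne h] at hz; exact (hR j hj).2.1 z hz
    · norm_cast
      rw [Nat.succ_le_iff]
      refine Finset.sum_lt_sum (fun j hj => ?_) ⟨i, hi, by rwa [Function.update_self]⟩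
      by_cases h : j = i
      · subst h; rw [Function.update_self]; exact hlt.le
      · rw [Function.update_of_ne h, (hR j hj).1]
  obtain ⟨m, hm⟩ := prod_sq_dvd_of_double_zeros (h0 i hi) (h1 i hi)
  have hsecond : ∀ a ∈ A i, r.eval a = 2 * (∏ b ∈ (A i).erase a, (a - b)) ^ 2 * m.eval a := by
    intro a ha
    rw [← hf i hi, hm, eval_second_derivative m ha]
  have hmne : ∀ y ∈ slot i, m.eval y ≠ 0 := by
    intro y hy hy0
    by_cases hyA : y ∈ A i
    · have hry : r.eval y = 0 := by rw [hsecond y hyA, hy0, mul_zero]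
      have hyR : y ∉ R i := fun h => Finset.disjoint_left.1 (hR i hi).2.2.1 h hyA
      have := hextra (insert y (R i)) (by
        intro z hz
        rcases mem_insert.1 hz with rfl | hz
        · exact hy
        · exact hRs i hi z hz) (by
        intro z hz
        rcases mem_insert.1 hz with rfl | hz
        · exact hry
        · exact (hR i hi).2.1 z hz)
      rw [card_insert_of_notMem hyR, (hR i hi).1] at this
      omega
    · obtain ⟨W, hW1, hW2, -, hW4⟩ := exists_second_derivative_zeros (f i)
        (Finset.subset_insert y (A i)) (by
          intro z hz
          rcases mem_insert.1 hz with rfl | hz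
          · rw [hm, eval_mul, hy0, mul_zero]
          · exact h0 i hi z hz) (h1 i hi)
      rw [hf i hi] at hW2
      have := hextra W (ordConnected_between (by
        intro z hz
        rcases mem_insert.1 hz with rfl | hz
        · exact hy
        · exact hAs i hi z hz) hW4) hW2
      rw [card_insert_of_notMem hyA] at hW1
      have := (hA i hi).card_pos
      omega
  have hfac : ∃ e : ℝ, r = C e * ∏ j ∈ S, ∏ z ∈ R j, (X - C z) := by
    have hdvd : ∏ z ∈ S.biUnion R, (X - C z) ∣ r := by
      refine Finset.prod_dvd_of_coprime (fun a _ b _ hab =>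
        pairwise_coprime_X_sub_C Function.injective_id hab) fun z hz => ?_
      obtain ⟨j, hj, hz⟩ := mem_biUnion.1 hz
      exact dvd_iff_isRoot.2 ((hR j hj).2.1 z hz)
    obtain ⟨q, hq⟩ := hdvd
    have hmonic : (∏ z ∈ S.biUnion R, (X - C z)).Monic :=
      monic_prod_of_monic _ _ fun z _ => monic_X_sub_C z
    have hnd : (∏ z ∈ S.biUnion R, (X - C z)).natDegree = ∑ j ∈ S, (2 * (A j).card - 2) := by
      rw [natDegree_prod_of_monic _ _ fun z _ => monic_X_sub_C z]
      simp only [natDegree_X_sub_C, Finset.sum_const, smul_eq_mul, mul_one]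
      rw [Finset.card_biUnion (pairwiseDisjoint_of_subset_slot hRs)]
      exact Finset.sum_congr rfl fun j hj => (hR j hj).1
    have hq0 : q ≠ 0 := by rintro rfl; exact hr0 (by rw [hq, mul_zero])
    have hqd : q.natDegree = 0 := by
      have := hmonic.natDegree_mul' hq0
      rw [← hq, hnd] at this
      rw [← natDegree_lt_iff_degree_lt hr0] at hdeg
      omega
    refine ⟨q.coeff 0, ?_⟩
    rw [← Finset.prod_biUnion (pairwiseDisjoint_of_subset_slot hRs), mul_comm,
      ← eq_C_of_natDegree_eq_zero hqd]
    exact hq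
  obtain ⟨e, he⟩ := hfac
  have hepos : 0 < e := by
    have hmonic : (∏ j ∈ S, ∏ z ∈ R j, (X - C z)).Monic :=
      monic_prod_of_monic _ _ fun j _ => monic_prod_of_monic _ _ fun z _ => monic_X_sub_C z
    rw [he, leadingCoeff_mul, leadingCoeff_C, hmonic.leadingCoeff, mul_one] at hr
    exact hr
  set a := (A i).max' (hA i hi) with ha
  have haA : a ∈ A i := (A i).max'_mem _
  have has := hAs i hi a haA
  have hra : 0 < r.eval a := by
    rw [he, eval_mul, eval_C, eval_prod]
    refine mul_pos hepos (Finset.prod_pos fun j hj => ?_)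
    rw [eval_prod]
    simp only [eval_sub, eval_X, eval_C]
    rcases le_or_gt j i with hji | hji
    · refine Finset.prod_pos fun z hz => sub_pos.2 ?_
      rcases hji.eq_or_lt with rfl | hji
      · obtain ⟨-, b, hb, hzb⟩ := (hR j hj).2.2.2 z hz
        exact hzb.trans_le ((A j).le_max' b hb)
      · have h2 : ((j : ℕ) : ℝ) + 1 ≤ (i : ℕ) := by exact_mod_cast hji
        linarith [(hRs j hj z hz).2, has.1]
    · have heven : Even (R j).card := by
        rw [(hR j hj).1]; exact ⟨(A j).card - 1, by omega⟩
      rw [← Finset.prod_congr rfl fun z _ => neg_sub z a, Finset.prod_neg, heven.neg_one_pow,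
        one_mul]
      refine Finset.prod_pos fun z hz => sub_pos.2 ?_
      have h2 : ((i : ℕ) : ℝ) + 1 ≤ (j : ℕ) := by exact_mod_cast hji
      linarith [(hRs j hj z hz).1, has.2]
  have hma : 0 < m.eval a := by
    rw [hsecond a haA] at hra
    exact pos_of_mul_pos_right hra (by positivity)
  have hmx : 0 < m.eval x := by
    by_contra! hle
    have hcon : IsPreconnected (slot i) := isPreconnected_Ioo
    obtain ⟨y, hy, hy0⟩ := hcon.intermediate_value hx has
      (f := fun y => m.eval y) m.continuous.continuousOn ⟨hle, hma.le⟩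
    exact hmne y hy hy0
  rw [hm, eval_mul]
  refine mul_pos ?_ hmx
  rw [eval_pow, eval_prod]
  refine sq_pos_of_ne_zero (Finset.prod_ne_zero_iff.2 fun b hb => ?_)
  simp only [eval_sub, eval_X, eval_C]
  rw [sub_ne_zero]
  rintro rfl
  exact hxA hb

end PolynomialZeros

namespace ColoredConfig
open Polynomial PolynomialZeros Filter Topology

/-- An open cone condition satisfied by all nonzero vectors at parameter `0` is satisfied by all
nonzero vectors for nearby parameters. -/
lemma eventually_forall_ne_zero {W : Type*} [NormedAddCommGroup W] [NormedSpace ℝ W]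
    [FiniteDimensional ℝ W] {U : Set (ℝ × W)} (hU : IsOpen U)
    (hcone : ∀ (ε : ℝ) (w : W) (s : ℝ), 0 < s → (ε, s • w) ∈ U → (ε, w) ∈ U)
    (h0 : ∀ w, w ≠ 0 → ((0 : ℝ), w) ∈ U) : ∀ᶠ ε in 𝓝 (0 : ℝ), ∀ w, w ≠ 0 → (ε, w) ∈ U := by
  have : ProperSpace W := FiniteDimensional.proper ℝ W
  have h := (isCompact_sphere (0 : W) 1).eventually_forall_of_forall_eventually
    (x₀ := (0 : ℝ)) (P := fun ε w => (ε, w) ∈ U) (by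
      intro w hw
      refine hU.mem_nhds (h0 w ?_)
      rintro rfl
      simp at hw)
  filter_upwards [h] with ε hε w hw
  refine hcone ε w ‖w‖⁻¹ (inv_pos.2 (norm_pos_iff.2 hw)) (hε _ ?_)
  rw [mem_sphere_zero_iff_norm, norm_smul, norm_inv, norm_norm,
    inv_mul_cancel₀ (norm_ne_zero_iff.2 hw)]

variable {ι X : Type*} [DecidableEq ι] [Fintype X] [DecidableEq X] {d : ℕ}

/-- The pullback of a functional along a polynomial curve. -/
def curvePoly (γ : Fin d → ℝ[X]) : Module.Dual ℝ (Vec d) →ₗ[ℝ] ℝ[X] where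
  toFun u := ∑ j, C (u (Pi.single j 1)) * γ j
  map_add' u w := by simp [add_mul, Finset.sum_add_distrib]
  map_smul' s u := by simp [Finset.smul_sum, smul_eq_C_mul, mul_assoc]

lemma curvePoly_apply (γ : Fin d → ℝ[X]) (u : Module.Dual ℝ (Vec d)) :
    curvePoly γ u = ∑ j, C (u (Pi.single j 1)) * γ j := rfl

/-- Points on polynomial curves, one curve for each colour. -/
def curvePoint (Γ : ι → Fin d → ℝ[X]) (c : X → ι) (t : X → ℝ) : X → Vec d :=
  fun x j => (Γ (c x) j).eval (t x)

lemma apply_curvePoint (Γ : ι → Fin d → ℝ[X]) (c : X → ι) (t : X → ℝ)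
    (u : Module.Dual ℝ (Vec d)) (x : X) :
    u (curvePoint Γ c t x) = (curvePoly (Γ (c x)) u).eval (t x) := by
  rw [LinearMap.pi_apply_eq_sum_univ u, curvePoly_apply, eval_finsetSum]
  refine Finset.sum_congr rfl fun j _ => ?_
  rw [eval_mul, eval_C, smul_eq_mul, mul_comm, curvePoint]
  congr 2
  ext k
  simp [Pi.single_apply, eq_comm]

lemma dual_eq_zero {u : Module.Dual ℝ (Vec d)} (h : ∀ j, u (Pi.single j 1) = 0) : u = 0 :=
  LinearMap.pi_ext' fun j => LinearMap.ext_ring (by simpa using h j)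

/-- A polynomial curve is moment-like if its coordinates together with `1` form a basis of the
polynomials of degree at most `d`. -/
structure MomentLike (γ : Fin d → ℝ[X]) : Prop where
  natDegree_le : ∀ j, (γ j).natDegree ≤ d
  eq_zero : ∀ u a, curvePoly γ u = C a → u = 0

lemma MomentLike.natDegree_curvePoly_le {γ : Fin d → ℝ[X]} (hγ : MomentLike γ)
    (u : Module.Dual ℝ (Vec d)) : (curvePoly γ u).natDegree ≤ d := by
  rw [curvePoly_apply]
  exact natDegree_sum_le_of_forall_le _ _ fun j _ => (natDegree_C_mul_le _ _).trans
    (hγ.natDegree_le j)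

lemma MomentLike.exists_curvePoly_eq {γ : Fin d → ℝ[X]} (hγ : MomentLike γ) {p : ℝ[X]}
    (hp : p.natDegree ≤ d) : ∃ u a, curvePoly γ u = p + C a := by
  let L : Module.Dual ℝ (Vec d) × ℝ →ₗ[ℝ] ℝ[X] :=
    (curvePoly γ).coprod ((1 : ℝ →ₗ[ℝ] ℝ).smulRight (1 : ℝ[X]))
  have hL : ∀ z, L z = curvePoly γ z.1 + C z.2 := by
    intro z; simp [L, smul_eq_C_mul]
  have hmem : ∀ q : ℝ[X], q ∈ degreeLT ℝ (d + 1) ↔ q.natDegree ≤ d := by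
    intro q
    rw [mem_degreeLT]
    rcases eq_or_ne q 0 with rfl | hq
    · simp
    · rw [← natDegree_lt_iff_degree_lt hq, Nat.lt_succ_iff]
  let L' : Module.Dual ℝ (Vec d) × ℝ →ₗ[ℝ] degreeLT ℝ (d + 1) := L.codRestrict _ fun z => by
    rw [hmem, hL]
    exact (natDegree_add_C).trans_le (hγ.natDegree_curvePoly_le z.1)
  have hinj : Function.Injective L' := by
    rw [injective_iff_map_eq_zero]
    rintro ⟨u, a⟩ hz
    have hz' : curvePoly γ u + C a = 0 := by rw [← hL (u, a)]; exact congrArg Subtype.val hz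
    have hu : u = 0 := hγ.eq_zero u (-a) (by rw [C_neg]; exact eq_neg_of_add_eq_zero_left hz')
    subst hu
    rw [map_zero, zero_add, C_eq_zero] at hz'
    rw [hz']; rfl
  have hfin : Module.finrank ℝ (Module.Dual ℝ (Vec d) × ℝ) =
      Module.finrank ℝ (degreeLT ℝ (d + 1)) := by
    rw [(degreeLTEquiv ℝ (d + 1)).finrank_eq]
    simp [Subspace.dual_finrank_eq]
  have : FiniteDimensional ℝ (degreeLT ℝ (d + 1)) :=
    Module.Finite.equiv (degreeLTEquiv ℝ (d + 1)).symm
  obtain ⟨⟨u, a⟩, hz⟩ := (LinearMap.injective_iff_surjective_of_finrank_eq_finrank hfin).1 hinj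
    ⟨p, (hmem p).2 hp⟩
  refine ⟨u, -a, ?_⟩
  have := congrArg Subtype.val hz
  change L (u, a) = p at this
  rw [← this, hL, C_neg]
  ring

variable {Γ : ι → Fin d → ℝ[X]} {c : X → ι} {t : X → ℝ}

lemma MomentLike.eq_zero_of_monochromatic {i : ι} (hγ : MomentLike (Γ i))
    (ht : Function.Injective t) {G : Finset X} (hG : ∀ x ∈ G, c x = i) (hcard : d + 1 ≤ G.card)
    {u : Module.Dual ℝ (Vec d)} (hu : u ∈ flat c (curvePoint Γ c t) G) : u = 0 := by
  obtain ⟨x, hx⟩ := Finset.card_pos.1 (by omega : 0 < G.card)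
  refine hγ.eq_zero u ((curvePoly (Γ i) u).eval (t x)) (sub_eq_zero.1 ?_)
  refine eq_zero_of_natDegree_lt_card_of_eval_eq_zero' _ (G.image t) ?_ ?_
  · intro z hz
    obtain ⟨y, hy, rfl⟩ := mem_image.1 hz
    have := hu y hy x hx ((hG y hy).trans (hG x hx).symm)
    rw [apply_curvePoint, apply_curvePoint, hG y hy, hG x hx] at this
    rw [eval_sub, eval_C, this, sub_self]
  · rw [card_image_of_injective _ ht, natDegree_sub_C]
    exact (hγ.natDegree_curvePoly_le u).trans_lt hcard

lemma MomentLike.exists_topSet_eq {i : ι} (hγ : MomentLike (Γ i))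
    (ht : Function.Injective t) {G : Finset X} (hne : G.Nonempty) (hG : ∀ x ∈ G, c x = i)
    (hcard : 2 * G.card ≤ d) : ∃ u, topSet c (curvePoint Γ c t) {i} u = G := by
  obtain ⟨u, a, hu⟩ := hγ.exists_curvePoly_eq (p := -(∏ y ∈ G, (Polynomial.X - C (t y))) ^ 2) (by
    rw [natDegree_neg]
    refine natDegree_pow_le.trans ?_
    rw [natDegree_prod_of_monic _ _ fun y _ => monic_X_sub_C _]
    simpa using hcard)
  have hval : ∀ x, c x = i → u (curvePoint Γ c t x) = -(∏ y ∈ G, (t x - t y)) ^ 2 + a := by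
    intro x hx
    rw [apply_curvePoint, hx, hu]
    simp [eval_prod]
  have hzero : ∀ x ∈ G, ∏ y ∈ G, (t x - t y) = 0 := fun x hx =>
    Finset.prod_eq_zero hx (sub_self _)
  refine ⟨u, ?_⟩
  ext x
  rw [mem_topSet, mem_singleton]
  constructor
  · rintro ⟨hx, h⟩
    obtain ⟨y, hy⟩ := hne
    have h1 := h y ((hG y hy).trans hx.symm)
    rw [hval y (hG y hy), hval x hx, hzero y hy] at h1
    have h2 : ∏ y ∈ G, (t x - t y) = 0 := by
      have := sq_nonneg (∏ y ∈ G, (t x - t y))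
      exact pow_eq_zero_iff (two_ne_zero) |>.1 (by linarith)
    obtain ⟨z, hz, hxz⟩ := Finset.prod_eq_zero_iff.1 h2
    rwa [ht (sub_eq_zero.1 hxz)]
  · intro hx
    refine ⟨hG x hx, fun y hy => ?_⟩
    rw [hval y (hy.trans (hG x hx)), hval x (hG x hx), hzero x hx]
    have := sq_nonneg (∏ z ∈ G, (t y - t z))
    linarith

variable {v : X → Vec d}

lemma exists_subset_colors_card_ge_two {G : Finset X}
    (hG : G.card = d + (G.image c).card) :
    ∃ H ⊆ G, H.card = d + (H.image c).card ∧ ∀ x ∈ H, ∃ y ∈ H, y ≠ x ∧ c y = c x := by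
  induction G using Finset.strongInduction with
  | H G ih =>
    by_cases h : ∀ x ∈ G, ∃ y ∈ G, y ≠ x ∧ c y = c x
    · exact ⟨G, Subset.refl _, hG, h⟩
    · push Not at h
      obtain ⟨x, hx, h⟩ := h
      have himg : (G.erase x).image c = (G.image c).erase (c x) := by
        ext i
        simp only [mem_image, mem_erase]
        constructor
        · rintro ⟨y, ⟨hyx, hy⟩, rfl⟩
          exact ⟨h y hy hyx, y, hy, rfl⟩
        · rintro ⟨hi, y, hy, rfl⟩
          exact ⟨y, ⟨fun hyx => hi (hyx ▸ rfl), hy⟩, rfl⟩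
      have hcx : c x ∈ G.image c := mem_image_of_mem c hx
      obtain ⟨H, hH, h1, h2⟩ := ih (G.erase x) (erase_ssubset hx) (by
        rw [himg, card_erase_of_mem hx, card_erase_of_mem hcx]
        have := Finset.card_pos.2 ⟨_, hcx⟩
        omega)
      exact ⟨H, hH.trans (erase_subset _ _), h1, h2⟩

lemma generic_of_card_ge_two
    (hlarge : ∀ i, d + 1 ≤ (univ.filter fun x => c x = i).card)
    (h : ∀ G : Finset X, G.card = d + (G.image c).card → (∀ x ∈ G, ∃ y ∈ G, y ≠ x ∧ c y = c x) →
      ∀ u ∈ flat c v G, u = 0) : Generic c v := by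
  refine ⟨hlarge, fun G hG u hu => ?_⟩
  obtain ⟨H, hH, h1, h2⟩ := exists_subset_colors_card_ge_two hG
  exact h H h1 h2 u (flat_anti hH hu)

lemma Generic.neighborly_of_topSet (hg : Generic c v)
    (h : ∀ G : Finset X, G.Nonempty → 2 * G.card + 1 ≤ d + (G.image c).card →
      ∃ u, topSet c v (G.image c) u = G) : Neighborly c v := by
  intro G hne hG
  obtain ⟨u, hu⟩ := h G hne hG
  refine mem_faces.2 ⟨u, ?_, hu⟩
  rintro rfl
  have h1 := hg.card_color_le (hne.image c)
  rw [topSet_zero] at hu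
  rw [hu] at h1
  omega

end ColoredConfig

namespace ColoredConfig
open Polynomial PolynomialZeros

/-- The coordinate polynomials of the moment curve. -/
def momentPoly (d : ℕ) (j : Fin d) : ℝ[X] := Polynomial.X ^ ((j : ℕ) + 1)

lemma coeff_sum_C_mul_X_pow {k : ℕ} (a : Fin k → ℝ) (s : ℕ) (j : Fin k) :
    (∑ i, C (a i) * (Polynomial.X : ℝ[X]) ^ ((i : ℕ) + s)).coeff (j + s) = a j := by
  rw [finsetSum_coeff, Finset.sum_eq_single j]
  · simp
  · intro i _ hij
    rw [coeff_C_mul, coeff_X_pow, if_neg, mul_zero]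
    intro h
    exact hij (Fin.ext (by omega))
  · simp

lemma momentLike_momentPoly (d : ℕ) : MomentLike (momentPoly d) := by
  refine ⟨fun j => (natDegree_X_pow_le _).trans j.2, fun u a h => dual_eq_zero fun j => ?_⟩
  have h1 := congrArg (fun p => p.coeff ((j : ℕ) + 1)) h
  simp only [curvePoly_apply, momentPoly] at h1
  rwa [coeff_sum_C_mul_X_pow, coeff_C_of_ne_zero (by omega)] at h1

section Cyclic

variable (m N : ℕ)

/-- The vertices of the cyclic polytope. -/
def cyclicPoint : Fin N → Vec m :=
  curvePoint (fun _ : Unit => momentPoly m) (fun _ => ()) fun j => ((j : ℕ) : ℝ) + 1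

lemma cyclic_injective : Function.Injective fun j : Fin N => ((j : ℕ) : ℝ) + 1 := by
  intro i j h
  simpa [Fin.ext_iff] using h

variable {m N}

lemma generic_cyclicPoint (hm : 0 < m) (hN : m + 1 ≤ N) :
    Generic (fun _ : Fin N => ()) (cyclicPoint m N) := by
  refine ⟨fun i => by simpa using hN, fun G hG u hu => ?_⟩
  have hne : G.Nonempty := Finset.card_pos.1 (by omega)
  have := (hne.image fun _ : Fin N => ()).card_pos
  exact MomentLike.eq_zero_of_monochromatic (momentLike_momentPoly m) (i := ())
    (cyclic_injective N) (fun _ _ => rfl) (by omega) hu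

lemma neighborly_cyclicPoint (hm : 0 < m) (hN : m + 1 ≤ N) :
    Neighborly (fun _ : Fin N => ()) (cyclicPoint m N) := by
  refine (generic_cyclicPoint hm hN).neighborly_of_topSet fun G hne hG => ?_
  have himg : G.image (fun _ : Fin N => ()) = {()} := Finset.image_const hne ()
  rw [himg] at hG ⊢
  exact MomentLike.exists_topSet_eq (momentLike_momentPoly m) (i := ())
    (cyclic_injective N) hne (fun _ _ => rfl) (by simpa using hG)

lemma cell_cyclicPoint :
    cell (fun _ : Fin N => ()) (cyclicPoint m N) univ univ = cyclicPolytope m N := by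
  rw [cell, Finset.univ_unique, Finset.sum_singleton, hull, cyclicPolytope]
  congr 1
  ext p
  simp [cyclicPoint, curvePoint, momentPoly, momentCurve, funext_iff]

end Cyclic

variable {X : Type*} [Fintype X] [DecidableEq X] {c : X → Fin 3} {t : X → ℝ}

/-- The parameters of the points of `G` with colour `i`. -/
def params (c : X → Fin 3) (t : X → ℝ) (G : Finset X) (i : Fin 3) : Finset ℝ :=
  (G.filter fun x => c x = i).image t

lemma mem_params {G : Finset X} {i : Fin 3} {a : ℝ} :
    a ∈ params c t G i ↔ ∃ x ∈ G, c x = i ∧ t x = a := by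
  simp [params, and_assoc]

lemma sum_card_params (ht : Function.Injective t) (G : Finset X) :
    ∑ i ∈ G.image c, (params c t G i).card = G.card := by
  rw [Finset.card_eq_sum_card_image c G]
  exact Finset.sum_congr rfl fun i _ => card_image_of_injective _ ht

lemma mem_slot_of_mem_params (hs : ∀ x, t x ∈ slot (c x)) {G : Finset X} {i : Fin 3} :
    ∀ a ∈ params c t G i, a ∈ slot i := by
  intro a ha
  obtain ⟨x, -, rfl, rfl⟩ := mem_params.1 ha
  exact hs x

lemma generic_plane (ht : Function.Injective t) (hs : ∀ x, t x ∈ slot (c x))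
    (hlarge : ∀ i, 3 ≤ (univ.filter fun x => c x = i).card) :
    Generic c (curvePoint (fun _ => momentPoly 2) c t) := by
  refine ⟨hlarge, fun G hG u hu => ?_⟩
  set p := curvePoly (momentPoly 2) u with hp
  have hex : ∀ i, ∃ Z : Finset ℝ, (params c t G i).card ≤ Z.card + 1 ∧
      (∀ z ∈ Z, (derivative p).eval z = 0) ∧ ∀ z ∈ Z, z ∈ slot i := by
    intro i
    obtain ⟨e, he⟩ : ∃ e, ∀ a ∈ params c t G i, (p - C e).eval a = 0 := by
      rcases (params c t G i).eq_empty_or_nonempty with h | ⟨b, hb⟩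
      · exact ⟨0, by simp [h]⟩
      · refine ⟨p.eval b, fun a ha => ?_⟩
        obtain ⟨x, hx, hxi, rfl⟩ := mem_params.1 ha
        obtain ⟨y, hy, hyi, rfl⟩ := mem_params.1 hb
        have := hu x hx y hy (hxi.trans hyi.symm)
        rw [apply_curvePoint, apply_curvePoint, ← hp] at this
        rw [eval_sub, eval_C, this, sub_self]
    obtain ⟨Z, h1, h2, -, h3⟩ := exists_derivative_zeros _ _ he
    rw [derivative_sub, derivative_C, sub_zero] at h2
    exact ⟨Z, h1, h2, ordConnected_between (mem_slot_of_mem_params hs) h3⟩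
  choose Z hZ1 hZ2 hZ3 using hex
  have hder : derivative p = 0 := by
    refine eq_zero_of_degree_lt_sum (S := G.image c) (fun i _ => hZ3 i) (fun i _ => hZ2 i) ?_
    have h1 := Finset.sum_le_sum fun i (_ : i ∈ G.image c) => hZ1 i
    rw [sum_card_params ht, Finset.sum_add_distrib, hG, Finset.sum_const, smul_eq_mul,
      mul_one] at h1
    refine lt_of_lt_of_le (b := ((2 : ℕ) : WithBot ℕ)) ?_ (by exact_mod_cast (by omega))
    by_cases h0 : derivative p = 0
    · rw [h0, degree_zero]; exact WithBot.bot_lt_coe _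
    rw [← natDegree_lt_iff_degree_lt h0]
    have : p.natDegree ≤ 2 := (momentLike_momentPoly 2).natDegree_curvePoly_le u
    have := natDegree_derivative_le p
    omega
  exact (momentLike_momentPoly 2).eq_zero u _ (eq_C_of_natDegree_eq_zero
    (derivative_eq_zero.1 hder))

lemma neighborly_plane (ht : Function.Injective t) (hs : ∀ x, t x ∈ slot (c x))
    (hlarge : ∀ i, 3 ≤ (univ.filter fun x => c x = i).card) :
    Neighborly c (curvePoint (fun _ => momentPoly 2) c t) := by
  refine (generic_plane ht hs hlarge).neighborly_of_topSet fun G hne hG => ?_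
  have h1 : (G.image c).card ≤ G.card := card_image_le
  obtain ⟨x, rfl⟩ := Finset.card_eq_one.1 (by have := hne.card_pos; omega : G.card = 1)
  rw [image_singleton]
  exact MomentLike.exists_topSet_eq (momentLike_momentPoly 2) ht (singleton_nonempty x) (by simp)
    (by simp)

end ColoredConfig

namespace ColoredConfig
open Polynomial PolynomialZeros Filter Topology

/-- Three polynomial curves in `ℝ^(3+m)`, each a small perturbation of a curve spanning a
subspace of dimension `m + 1`. -/
def perturbed (m : ℕ) (ε : ℝ) (i : Fin 3) : Fin (3 + m) → ℝ[X] :=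
  Fin.append (fun j => if j = i then Polynomial.X else
      C ε * Polynomial.X ^ (m + 2) + C (ε ^ 2 * (j : ℕ)) * Polynomial.X ^ (m + 3))
    (fun k => Polynomial.X ^ ((k : ℕ) + 2))

/-- Parameters for functionals together with a constant for each colour. -/
abbrev Coeffs (m : ℕ) := (Fin 3 → ℝ) × (Fin 3 → ℝ) × (Fin m → ℝ)

/-- The rescaled pullback of a functional, shifted by a constant, to the curve of colour `i`. -/
def sidePoly (m : ℕ) (S : Finset (Fin 3)) (ε : ℝ) (i : Fin 3) : Coeffs m →ₗ[ℝ] ℝ[X] where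
  toFun w := C (w.1 i) + C (w.2.1 i) * Polynomial.X +
    ∑ j ∈ univ.erase i, C (w.2.1 j * if j ∈ S then ε else 1) *
      (Polynomial.X ^ (m + 2) + C (ε * (j : ℕ)) * Polynomial.X ^ (m + 3)) +
    ∑ k, C (w.2.2 k) * Polynomial.X ^ ((k : ℕ) + 2)
  map_add' w w' := by
    simp only [Prod.fst_add, Prod.snd_add, Pi.add_apply, add_mul, C_add, Finset.sum_add_distrib]
    ring
  map_smul' s w := by
    simp only [Prod.smul_fst, Prod.smul_snd, Pi.smul_apply, smul_eq_mul, C_mul, mul_assoc,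
      ← Finset.mul_sum, RingHom.id_apply, smul_eq_C_mul]
    ring

lemma sidePoly_apply (m : ℕ) (S : Finset (Fin 3)) (ε : ℝ) (i : Fin 3) (w : Coeffs m) :
    sidePoly m S ε i w = C (w.1 i) + C (w.2.1 i) * Polynomial.X +
    ∑ j ∈ univ.erase i, C (w.2.1 j * if j ∈ S then ε else 1) *
      (Polynomial.X ^ (m + 2) + C (ε * (j : ℕ)) * Polynomial.X ^ (m + 3)) +
    ∑ k, C (w.2.2 k) * Polynomial.X ^ ((k : ℕ) + 2) := rfl

/-- The common second derivative of the polynomials `sidePoly m S 0 i`, for `i ∈ S`. -/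
def secondPoly (m : ℕ) (S : Finset (Fin 3)) : Coeffs m →ₗ[ℝ] ℝ[X] where
  toFun w :=
    ∑ k : Fin m, C ((((k : ℕ) : ℝ) + 2) * ((k : ℕ) + 1) * w.2.2 k) *
      Polynomial.X ^ ((k : ℕ) + 0) +
    C ((m + 2) * (m + 1) * ∑ j ∈ Sᶜ, w.2.1 j) * Polynomial.X ^ m
  map_add' w w' := by
    simp only [Prod.snd_add, Prod.fst_add, Pi.add_apply, mul_add, C_add, add_mul,
      Finset.sum_add_distrib]
    ring
  map_smul' s w := by
    simp only [Prod.smul_fst, Prod.smul_snd, Pi.smul_apply, smul_eq_mul, RingHom.id_apply,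
      smul_eq_C_mul, ← Finset.mul_sum, mul_left_comm _ s, C_mul, mul_assoc, mul_add]

lemma secondPoly_apply (m : ℕ) (S : Finset (Fin 3)) (w : Coeffs m) :
    secondPoly m S w =
      ∑ k : Fin m, C ((((k : ℕ) : ℝ) + 2) * ((k : ℕ) + 1) * w.2.2 k) *
      Polynomial.X ^ ((k : ℕ) + 0) +
        C ((m + 2) * (m + 1) * ∑ j ∈ Sᶜ, w.2.1 j) * Polynomial.X ^ m := rfl

variable {m : ℕ} {S : Finset (Fin 3)} {w : Coeffs m}

lemma coeff_secondPoly (k : Fin m) :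
    (secondPoly m S w).coeff k = ((k : ℕ) + 2) * ((k : ℕ) + 1) * w.2.2 k := by
  have h := coeff_sum_C_mul_X_pow (fun k : Fin m => (((k : ℕ) : ℝ) + 2) * ((k : ℕ) + 1) * w.2.2 k)
    0 k
  rw [add_zero] at h
  rw [secondPoly_apply, coeff_add, h, coeff_C_mul, coeff_X_pow, if_neg k.2.ne, mul_zero, add_zero]

lemma coeff_secondPoly_of_le {k : ℕ} (hk : m ≤ k) :
    (secondPoly m S w).coeff k = if k = m then (m + 2) * (m + 1) * ∑ j ∈ Sᶜ, w.2.1 j else 0 := by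
  rw [secondPoly_apply, coeff_add, finsetSum_coeff, Finset.sum_eq_zero, zero_add, coeff_C_mul,
    coeff_X_pow, mul_ite, mul_one, mul_zero]
  intro j _
  rw [coeff_C_mul, coeff_X_pow, if_neg (by omega), mul_zero]

lemma degree_secondPoly_lt (hS : 2 ≤ S.card) :
    (secondPoly m S w).degree < (3 + m - S.card : ℕ) := by
  rw [degree_lt_iff_coeff_zero]
  intro k hk
  have h3 : S.card ≤ 3 := S.card_le_univ
  have hmk : m ≤ k := by omega
  rw [coeff_secondPoly_of_le hmk]
  split_ifs with h
  · have : S = univ := by rw [← Finset.card_eq_iff_eq_univ, Fintype.card_fin]; omega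
    simp [this]
  · rfl

lemma eq_zero_of_secondPoly_eq_zero (hS : 2 ≤ S.card) (h : secondPoly m S w = 0) :
    w.2.2 = 0 ∧ ∀ j ∉ S, w.2.1 j = 0 := by
  constructor
  · funext k
    have h1 := coeff_secondPoly (S := S) (w := w) k
    rw [h, coeff_zero] at h1
    have h2 : (((k : ℕ) : ℝ) + 2) * ((k : ℕ) + 1) ≠ 0 := by positivity
    exact (mul_eq_zero.1 h1.symm).resolve_left h2
  · intro j hj
    have h1 := coeff_secondPoly_of_le (S := S) (w := w) (le_refl m)
    rw [h, coeff_zero, if_pos rfl] at h1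
    have h2 : ((m : ℝ) + 2) * (m + 1) ≠ 0 := by positivity
    have hc : Sᶜ.card ≤ 1 := by rw [card_compl, Fintype.card_fin]; omega
    have hj' : j ∈ Sᶜ := mem_compl.2 hj
    have hs : Sᶜ = {j} := Finset.eq_singleton_iff_unique_mem.2
      ⟨hj', fun y hy => Finset.card_le_one.1 hc y hy j hj'⟩
    rw [hs, Finset.sum_singleton] at h1
    exact (mul_eq_zero.1 h1.symm).resolve_left h2

lemma sidePoly_zero {i : Fin 3} (hi : i ∈ S) :
    sidePoly m S 0 i w = C (w.1 i) + C (w.2.1 i) * Polynomial.X +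
      C (∑ j ∈ Sᶜ, w.2.1 j) * Polynomial.X ^ (m + 2) +
      ∑ k, C (w.2.2 k) * Polynomial.X ^ ((k : ℕ) + 2) := by
  rw [sidePoly_apply]
  congr 2
  rw [Finset.sum_erase _ (by simp [hi]), map_sum, Finset.sum_mul,
    ← Finset.sum_subset (Finset.subset_univ Sᶜ)]
  · refine Finset.sum_congr rfl fun j hj => ?_
    rw [if_neg (mem_compl.1 hj)]
    simp
  · intro j _ hj
    rw [mem_compl, not_not] at hj
    simp [hj]

lemma second_derivative_sidePoly {i : Fin 3} (hi : i ∈ S) :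
    derivative (derivative (sidePoly m S 0 i w)) = secondPoly m S w := by
  have h : ∀ (a : ℝ) (k : ℕ), derivative (derivative (C a * (Polynomial.X : ℝ[X]) ^ (k + 2))) =
      C (((k : ℝ) + 2) * (k + 1) * a) * Polynomial.X ^ k := by
    intro a k
    rw [derivative_C_mul_X_pow, derivative_C_mul_X_pow]
    push_cast
    congr 2
    ring
  rw [sidePoly_zero hi, secondPoly_apply]
  simp only [derivative_add, derivative_sum, h]
  simp [add_comm]

lemma eq_zero_of_sidePoly_zeros (hS : 2 ≤ S.card) (hw : ∀ j ∉ S, w.1 j = 0)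
    (h2 : secondPoly m S w = 0)
    (h : ∀ i ∈ S, ∃ a, (sidePoly m S 0 i w).eval a = 0 ∧
      ((derivative (sidePoly m S 0 i w)).eval a = 0 ∨
        ∃ b, b ≠ a ∧ (sidePoly m S 0 i w).eval b = 0)) : w = 0 := by
  obtain ⟨hq, hb⟩ := eq_zero_of_secondPoly_eq_zero hS h2
  have hside : ∀ i ∈ S, sidePoly m S 0 i w = C (w.1 i) + C (w.2.1 i) * Polynomial.X := by
    intro i hi
    rw [sidePoly_zero hi, hq, Finset.sum_eq_zero fun j hj => hb j (mem_compl.1 hj)]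
    simp
  have hz : ∀ i ∈ S, w.1 i = 0 ∧ w.2.1 i = 0 := by
    intro i hi
    obtain ⟨a, ha, h'⟩ := h i hi
    rw [hside i hi] at ha h'
    simp only [eval_add, eval_C, eval_mul, eval_X] at ha h'
    have hbi : w.2.1 i = 0 := by
      rcases h' with h' | ⟨b, hba, h'⟩
      · simpa using h'
      · have : w.2.1 i * (b - a) = 0 := by linear_combination h' - ha
        exact (mul_eq_zero.1 this).resolve_right (sub_ne_zero.2 hba)
    exact ⟨by rw [hbi] at ha; simpa using ha, hbi⟩
  refine Prod.ext (funext fun i => ?_) (Prod.ext (funext fun i => ?_) hq)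
  · by_cases hi : i ∈ S
    · exact (hz i hi).1
    · exact hw i hi
  · by_cases hi : i ∈ S
    · exact (hz i hi).2
    · exact hb i hi

lemma continuous_eval_sidePoly (i : Fin 3) (a : ℝ) :
    Continuous fun z : ℝ × Coeffs m => (sidePoly m S z.1 i z.2).eval a := by
  simp only [sidePoly_apply, eval_add, eval_C, eval_mul, eval_X, eval_finsetSum, eval_pow]
  have h : ∀ j, Continuous fun z : ℝ × Coeffs m => if j ∈ S then z.1 else 1 := by
    intro j; split_ifs <;> fun_prop
  fun_prop

lemma continuous_eval_derivative_sidePoly (i : Fin 3) (a : ℝ) :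
    Continuous fun z : ℝ × Coeffs m => (derivative (sidePoly m S z.1 i z.2)).eval a := by
  simp only [sidePoly_apply, derivative_add, derivative_sum, derivative_mul, derivative_C,
    derivative_X, derivative_X_pow, eval_add, eval_C, eval_mul, eval_X, eval_finsetSum, eval_pow,
    eval_zero, eval_one]
  have h : ∀ j, Continuous fun z : ℝ × Coeffs m => if j ∈ S then z.1 else 1 := by
    intro j; split_ifs <;> fun_prop
  fun_prop

lemma curvePoly_perturbed (ε : ℝ) (i : Fin 3) (u : Module.Dual ℝ (Vec (3 + m))) :
    curvePoly (perturbed m ε i) u = C (u (Pi.single (Fin.castAdd m i) 1)) * Polynomial.X +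
      ∑ j ∈ univ.erase i, C (u (Pi.single (Fin.castAdd m j) 1)) *
        (C ε * Polynomial.X ^ (m + 2) + C (ε ^ 2 * (j : ℕ)) * Polynomial.X ^ (m + 3)) +
      ∑ k, C (u (Pi.single (Fin.natAdd 3 k) 1)) * Polynomial.X ^ ((k : ℕ) + 2) := by
  rw [curvePoly_apply, Fin.sum_univ_add, ← Finset.add_sum_erase _ _ (mem_univ i)]
  congr 1
  · congr 1
    · simp [perturbed]
    · refine Finset.sum_congr rfl fun j hj => ?_
      rw [perturbed, Fin.append_left, if_neg (ne_of_mem_erase hj)]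
  · simp [perturbed]

lemma sidePoly_eq_curvePoly (ε : ℝ) {i : Fin 3} (hi : i ∈ S)
    (u : Module.Dual ℝ (Vec (3 + m)))
    (hb : ∀ j, w.2.1 j = u (Pi.single (Fin.castAdd m j) 1) * if j ∈ S then 1 else ε)
    (hq : ∀ k, w.2.2 k = u (Pi.single (Fin.natAdd 3 k) 1)) :
    sidePoly m S ε i w = C (w.1 i) + curvePoly (perturbed m ε i) u := by
  rw [sidePoly_apply, curvePoly_perturbed, hb i, if_pos hi, mul_one, add_assoc,
    add_assoc, add_assoc]
  congr 3
  · refine Finset.sum_congr rfl fun j _ => ?_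
    rw [hb j]
    split_ifs <;> simp only [C_mul, C_pow, mul_one] <;> ring
  · exact Finset.sum_congr rfl fun k _ => by rw [hq]

lemma exists_dual_eq {d : ℕ} (a : Fin d → ℝ) :
    ∃ u : Module.Dual ℝ (Vec d), ∀ j, u (Pi.single j 1) = a j :=
  ⟨∑ j, a j • LinearMap.proj j, fun j => by simp [LinearMap.sum_apply, Pi.single_apply]⟩

lemma momentLike_perturbed {ε : ℝ} (hε : ε ≠ 0) (i : Fin 3) : MomentLike (perturbed m ε i) := by
  refine ⟨fun j => ?_, fun u a h => ?_⟩
  · refine Fin.addCases (fun j => ?_) (fun k => ?_) j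
    · rw [perturbed, Fin.append_left]
      split_ifs
      · rw [natDegree_X]; omega
      · refine natDegree_add_le_of_degree_le ?_ ?_
        · exact (natDegree_C_mul_X_pow_le _ _).trans (by omega)
        · exact (natDegree_C_mul_X_pow_le _ _).trans (by omega)
    · rw [perturbed, Fin.append_right, natDegree_X_pow]; omega
  · have hcoeff : ∀ n : ℕ, n ≠ 0 →
        u (Pi.single (Fin.castAdd m i) 1) * (if 1 = n then 1 else 0) +
        ∑ j ∈ univ.erase i, u (Pi.single (Fin.castAdd m j) 1) *
          (ε * (if n = m + 2 then 1 else 0) + ε ^ 2 * (j : ℕ) * (if n = m + 3 then 1 else 0)) +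
        ∑ k : Fin m, u (Pi.single (Fin.natAdd 3 k) 1) * (if n = (k : ℕ) + 2 then 1 else 0) = 0 := by
      intro n hn
      have h1 := congrArg (fun p => p.coeff n) h
      simp only [curvePoly_perturbed, coeff_add, finsetSum_coeff, coeff_C_mul, coeff_X_pow,
        coeff_X, coeff_C_of_ne_zero hn] at h1
      exact h1
    have hi : u (Pi.single (Fin.castAdd m i) 1) = 0 := by
      simpa using hcoeff 1 one_ne_zero
    have hk : ∀ k : Fin m, u (Pi.single (Fin.natAdd 3 k) 1) = 0 := by
      intro k
      have h1 := hcoeff (k + 2) (by omega)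
      rw [if_neg (by omega), Finset.sum_eq_zero, Finset.sum_eq_single k] at h1
      · simpa using h1
      · intro j _ hjk
        rw [if_neg, mul_zero]
        intro h2
        exact hjk (Fin.ext (by omega))
      · simp
      · intro j _
        have := k.2
        rw [if_neg (by omega), if_neg (by omega)]
        simp
    have hs : ∀ n, m + 2 ≤ n → ∑ k : Fin m, u (Pi.single (Fin.natAdd 3 k) 1) *
        (if n = (k : ℕ) + 2 then (1 : ℝ) else 0) = 0 :=
      fun n _ => Finset.sum_eq_zero fun k _ => by rw [hk, zero_mul]
    have h2 := hcoeff (m + 2) (by omega)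
    have h3 := hcoeff (m + 3) (by omega)
    rw [hs _ (by omega), if_neg (by omega), mul_zero] at h2 h3
    simp only [if_true, if_neg (show m + 2 ≠ m + 3 by omega), if_neg (show m + 3 ≠ m + 2 by omega),
      mul_one, mul_zero, add_zero, zero_add] at h2 h3
    have hj : ∀ j : Fin 3, u (Pi.single (Fin.castAdd m j) 1) = 0 := by
      have e2 : ∑ j ∈ univ.erase i, u (Pi.single (Fin.castAdd m j) 1) = 0 := by
        rw [← Finset.sum_mul] at h2
        exact (mul_eq_zero.1 h2).resolve_right hε
      have e3 : ∑ j ∈ univ.erase i, u (Pi.single (Fin.castAdd m j) 1) * ((j : ℕ) : ℝ) = 0 := by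
        have : (∑ j ∈ univ.erase i, u (Pi.single (Fin.castAdd m j) 1) * ((j : ℕ) : ℝ)) * ε ^ 2 =
            0 := by
          rw [← h3, Finset.sum_mul]
          exact Finset.sum_congr rfl fun j _ => by ring
        exact (mul_eq_zero.1 this).resolve_right (pow_ne_zero 2 hε)
      rw [← add_right_inj, Finset.add_sum_erase _ _ (mem_univ i), hi, Fin.sum_univ_three] at e2
      rw [← add_right_inj, Finset.add_sum_erase _ _ (mem_univ i), hi, Fin.sum_univ_three] at e3
      simp only [Fin.val_zero, Fin.val_one, Fin.val_two, Nat.cast_zero, Nat.cast_one,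
        Nat.cast_ofNat, mul_zero, mul_one, zero_mul, zero_add, add_zero] at e2 e3
      intro j
      fin_cases i <;> fin_cases j <;>
        simp only [Fin.zero_eta, Fin.mk_one, Fin.reduceFinMk] at hi ⊢ <;> linarith
    refine dual_eq_zero fun j => Fin.addCases hj hk j

end ColoredConfig

namespace ColoredConfig
open Polynomial PolynomialZeros Filter Topology

variable {X : Type*} [Fintype X] [DecidableEq X] {c : X → Fin 3} {t : X → ℝ} {m : ℕ}
  {G : Finset X}

lemma exists_constants {v : X → Vec (3 + m)} {u : Module.Dual ℝ (Vec (3 + m))}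
    (hu : u ∈ flat c v G) :
    ∃ f : Fin 3 → ℝ, (∀ x ∈ G, f (c x) = -u (v x)) ∧ ∀ l ∉ G.image c, f l = 0 := by
  have h : ∀ i, ∃ a : ℝ, (∀ x ∈ G, c x = i → a = -u (v x)) ∧ (i ∉ G.image c → a = 0) := by
    intro i
    by_cases hi : i ∈ G.image c
    · obtain ⟨y, hy, rfl⟩ := mem_image.1 hi
      exact ⟨-u (v y), fun x hx hxy => by rw [hu x hx y hy hxy], fun h => absurd hi h⟩
    · exact ⟨0, fun x hx hxi => absurd (mem_image.2 ⟨x, hx, hxi⟩) hi, fun _ => rfl⟩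
  choose f h1 h2 using h
  exact ⟨f, fun x hx => h1 _ x hx rfl, h2⟩

lemma eventually_flat_eq_zero (ht : Function.Injective t) (hs : ∀ x, t x ∈ slot (c x))
    (hG : G.card = 3 + m + (G.image c).card) (h2 : ∀ x ∈ G, ∃ y ∈ G, y ≠ x ∧ c y = c x)
    (hS : 2 ≤ (G.image c).card) :
    ∀ᶠ ε in 𝓝 (0 : ℝ), ε ≠ 0 → ∀ u ∈ flat c (curvePoint (perturbed m ε) c t) G, u = 0 := by
  set S := G.image c with hSdef
  let K : Set (ℝ × Coeffs m) := {z | (∀ x ∈ G, (sidePoly m S z.1 (c x) z.2).eval (t x) = 0) ∧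
    ∀ l ∉ S, z.2.1 l = 0}
  have hK : IsClosed K := by
    simp only [K, Set.ofPred_and, Set.ofPred_forall]
    refine IsClosed.inter ?_ ?_
    · exact isClosed_iInter fun x => isClosed_iInter fun _ =>
        isClosed_eq (continuous_eval_sidePoly _ _) continuous_const
    · exact isClosed_iInter fun x => isClosed_iInter fun _ =>
        isClosed_eq (by fun_prop) continuous_const
  have key := eventually_forall_ne_zero hK.isOpen_compl ?_ ?_
  · filter_upwards [key] with ε hε hε0 u hu
    obtain ⟨f, hf1, hf2⟩ := exists_constants hu
    let w : Coeffs m := (f, fun j => u (Pi.single (Fin.castAdd m j) 1) * if j ∈ S then 1 else ε,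
      fun k => u (Pi.single (Fin.natAdd 3 k) 1))
    have hw : w = 0 := by
      by_contra hw
      refine hε w hw ⟨fun x hx => ?_, hf2⟩
      rw [sidePoly_eq_curvePoly ε (mem_image_of_mem c hx) u (fun _ => rfl) (fun _ => rfl),
        eval_add, eval_C, ← apply_curvePoint, ← neg_eq_iff_add_eq_zero]
      simp only [w, hf1 x hx, neg_neg]
    refine dual_eq_zero fun j => Fin.addCases (fun j => ?_) (fun k => ?_) j
    · have h := congrArg (fun w : Coeffs m => w.2.1 j) hw
      simp only [w, Prod.snd_zero, Prod.fst_zero, Pi.zero_apply, mul_eq_zero] at h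
      refine h.resolve_right ?_
      split_ifs
      · exact one_ne_zero
      · exact hε0
    · exact congrArg (fun w : Coeffs m => w.2.2 k) hw
  · intro ε w s _ h hw
    refine h ⟨fun x hx => ?_, fun l hl => ?_⟩
    · rw [map_smul, eval_smul, hw.1 x hx, smul_zero]
    · change s * w.1 l = 0
      rw [show w.1 l = 0 from hw.2 l hl, mul_zero]
  · intro w hw0 hw
    refine hw0 ?_
    have hz : ∀ i, i ∈ S → ∀ a ∈ params c t G i, (sidePoly m S 0 i w).eval a = 0 := by
      intro i _ a ha
      obtain ⟨x, hx, rfl, rfl⟩ := mem_params.1 ha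
      exact hw.1 x hx
    have hex : ∀ i, ∃ Z : Finset ℝ, i ∈ S → (params c t G i).card ≤ Z.card + 2 ∧
        (∀ z ∈ Z, (secondPoly m S w).eval z = 0) ∧ ∀ z ∈ Z, z ∈ slot i := by
      intro i
      by_cases hi : i ∈ S
      · obtain ⟨Z, h1, h2, -, h3⟩ := exists_second_derivative_zeros (A := ∅) _
          (Finset.empty_subset _) (hz i hi) (by simp)
        rw [second_derivative_sidePoly hi] at h2
        exact ⟨Z, fun _ => ⟨by simpa using h1, h2,
          ordConnected_between (mem_slot_of_mem_params hs) h3⟩⟩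
      · exact ⟨∅, fun h => absurd h hi⟩
    choose Z hZ using hex
    have hsec : secondPoly m S w = 0 := by
      refine eq_zero_of_degree_lt_sum (fun i hi => (hZ i hi).2.2) (fun i hi => (hZ i hi).2.1) ?_
      have h1 := Finset.sum_le_sum fun i (hi : i ∈ S) => (hZ i hi).1
      rw [sum_card_params ht, Finset.sum_add_distrib, hG, Finset.sum_const, smul_eq_mul] at h1
      exact (degree_secondPoly_lt hS).trans_le (by exact_mod_cast (by omega))
    refine eq_zero_of_sidePoly_zeros hS hw.2 hsec fun i hi => ?_
    obtain ⟨x, hx, rfl⟩ := mem_image.1 hi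
    obtain ⟨y, hy, hyx, hc⟩ := h2 x hx
    exact ⟨t x, hw.1 x hx, Or.inr ⟨t y, fun h => hyx (ht h), hc ▸ hw.1 y hy⟩⟩

/-- The parameters for which each polynomial `sidePoly` is tangent to zero at the points of `G`
and `secondPoly` has degree at most `2 * (G.card - (G.image c).card)`. -/
def tangent (c : X → Fin 3) (t : X → ℝ) (m : ℕ) (G : Finset X) (ε : ℝ) :
    Submodule ℝ (Coeffs m) :=
  LinearMap.ker <|
    (LinearMap.pi fun x : G => leval (t x) ∘ₗ sidePoly m (G.image c) ε (c x)).prod <|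
    (LinearMap.pi fun x : G => leval (t x) ∘ₗ derivative ∘ₗ sidePoly m (G.image c) ε (c x)).prod <|
    (LinearMap.pi fun l : ↥(G.image c)ᶜ =>
      LinearMap.proj (l : Fin 3) ∘ₗ LinearMap.fst ℝ (Fin 3 → ℝ) _).prod <|
    LinearMap.pi fun k : ↥(Finset.Ico (2 * G.card - 2 * (G.image c).card + 1)
      (3 + m - (G.image c).card)) => lcoeff ℝ (k : ℕ) ∘ₗ secondPoly m (G.image c)

lemma mem_tangent {ε : ℝ} {w : Coeffs m} :
    w ∈ tangent c t m G ε ↔ (∀ x ∈ G, (sidePoly m (G.image c) ε (c x) w).eval (t x) = 0) ∧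
      (∀ x ∈ G, (derivative (sidePoly m (G.image c) ε (c x) w)).eval (t x) = 0) ∧
      (∀ l ∉ G.image c, w.1 l = 0) ∧
      ∀ k, 2 * G.card - 2 * (G.image c).card + 1 ≤ k → k < 3 + m - (G.image c).card →
        (secondPoly m (G.image c) w).coeff k = 0 := by
  simp only [tangent, LinearMap.mem_ker, LinearMap.prod_apply, Function.prod_apply, Prod.mk_eq_zero,
    funext_iff, LinearMap.pi_apply, LinearMap.comp_apply, leval_apply, lcoeff_apply,
    LinearMap.proj_apply, LinearMap.fst_apply, Pi.zero_apply, Subtype.forall, mem_compl,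
    Finset.mem_Ico, and_imp]

lemma exists_mem_tangent_ne_zero (hG : 2 * G.card + 1 ≤ 3 + m + (G.image c).card) (ε : ℝ) :
    ∃ w ∈ tangent c t m G ε, w ≠ 0 := by
  refine Submodule.exists_mem_ne_zero_of_ne_bot (LinearMap.ker_ne_bot_of_finrank_lt ?_)
  have h1 : (G.image c).card ≤ G.card := card_image_le
  have h3 : (G.image c).card ≤ 3 := (G.image c).card_le_univ
  simp only [Module.finrank_prod, Module.finrank_fintype_fun_eq_card, Fintype.card_coe,
    Fintype.card_fin, card_compl, Nat.card_Ico]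
  omega

lemma isClosed_tangent : IsClosed {z : ℝ × Coeffs m | z.2 ∈ tangent c t m G z.1} := by
  simp only [mem_tangent, Set.ofPred_and, Set.ofPred_forall]
  refine IsClosed.inter ?_ (IsClosed.inter ?_ (IsClosed.inter ?_ ?_))
  · exact isClosed_iInter fun x => isClosed_iInter fun _ =>
      isClosed_eq (continuous_eval_sidePoly _ _) continuous_const
  · exact isClosed_iInter fun x => isClosed_iInter fun _ =>
      isClosed_eq (continuous_eval_derivative_sidePoly _ _) continuous_const
  · exact isClosed_iInter fun x => isClosed_iInter fun _ =>
      isClosed_eq (by fun_prop) continuous_const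
  · refine isClosed_iInter fun k => isClosed_iInter fun _ => isClosed_iInter fun _ =>
      isClosed_eq ?_ continuous_const
    have : Continuous (lcoeff ℝ k ∘ₗ secondPoly m (G.image c)) :=
      LinearMap.continuous_of_finiteDimensional _
    exact this.comp continuous_snd

lemma secondPoly_ne_zero_of_mem_tangent (hS : 2 ≤ (G.image c).card) {w : Coeffs m}
    (hw : w ∈ tangent c t m G 0) (h0 : w ≠ 0) : secondPoly m (G.image c) w ≠ 0 := by
  intro h
  obtain ⟨h1, h2, h3, -⟩ := mem_tangent.1 hw
  refine h0 (eq_zero_of_sidePoly_zeros hS h3 h fun i hi => ?_)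
  obtain ⟨x, hx, rfl⟩ := mem_image.1 hi
  exact ⟨t x, h1 x hx, Or.inl (h2 x hx)⟩

lemma pos_of_mem_tangent (ht : Function.Injective t) (hs : ∀ x, t x ∈ slot (c x))
    (hS : 2 ≤ (G.image c).card) {w : Coeffs m} (hw : w ∈ tangent c t m G 0)
    (hlc : 0 < (secondPoly m (G.image c) w).leadingCoeff) {y : X} (hy : c y ∈ G.image c)
    (hyG : y ∉ G) : 0 < (sidePoly m (G.image c) 0 (c y) w).eval (t y) := by
  obtain ⟨h1, h2, -, h4⟩ := mem_tangent.1 hw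
  refine pos_of_double_zeros (S := G.image c) (f := fun i => sidePoly m (G.image c) 0 i w)
    (r := secondPoly m (G.image c) w)
    (A := params c t G) (fun i hi => second_derivative_sidePoly hi) ?_
    (fun i _ => mem_slot_of_mem_params hs) ?_ ?_ ?_ hlc hy (hs y) ?_
  · intro i hi
    obtain ⟨x, hx, rfl⟩ := mem_image.1 hi
    exact ⟨t x, mem_params.2 ⟨x, hx, rfl, rfl⟩⟩
  · intro i _ a ha
    obtain ⟨x, hx, rfl, rfl⟩ := mem_params.1 ha
    exact h1 x hx
  · intro i _ a ha
    obtain ⟨x, hx, rfl, rfl⟩ := mem_params.1 ha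
    exact h2 x hx
  · have hne : ∀ i ∈ G.image c, 1 ≤ (params c t G i).card := by
      intro i hi
      obtain ⟨x, hx, rfl⟩ := mem_image.1 hi
      exact Finset.card_pos.2 ⟨t x, mem_params.2 ⟨x, hx, rfl, rfl⟩⟩
    have hsum : ∑ i ∈ G.image c, (2 * (params c t G i).card - 2) + 2 * (G.image c).card =
        2 * G.card := by
      rw [← sum_card_params ht G, Finset.mul_sum, mul_comm 2 (G.image c).card, ← smul_eq_mul,
        ← Finset.sum_const, ← Finset.sum_add_distrib]
      exact Finset.sum_congr rfl fun i hi => by have := hne i hi; omega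
    rw [degree_lt_iff_coeff_zero]
    intro k hk
    rcases lt_or_ge k (3 + m - (G.image c).card) with h | h
    · exact h4 k (by omega) h
    · exact (degree_lt_iff_coeff_zero _ _).1 (degree_secondPoly_lt hS) k h
  · intro h
    obtain ⟨x, hx, -, hxy⟩ := mem_params.1 h
    exact hyG (ht hxy ▸ hx)

lemma topSet_eq_of_mem_tangent {ε : ℝ} (hε : ε ≠ 0) {w : Coeffs m}
    (hw : w ∈ tangent c t m G ε)
    (hpos : ∀ y, c y ∈ G.image c → y ∉ G → 0 < (sidePoly m (G.image c) ε (c y) w).eval (t y)) :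
    ∃ u, topSet c (curvePoint (perturbed m ε) c t) (G.image c) u = G := by
  obtain ⟨u, hu⟩ := exists_dual_eq (Fin.append
    (fun j => w.2.1 j * if j ∈ G.image c then 1 else ε⁻¹) w.2.2)
  have hside : ∀ x, c x ∈ G.image c → (sidePoly m (G.image c) ε (c x) w).eval (t x) =
      w.1 (c x) + u (curvePoint (perturbed m ε) c t x) := by
    intro x hx
    rw [sidePoly_eq_curvePoly ε hx u, eval_add, eval_C, ← apply_curvePoint]
    · intro j
      rw [hu, Fin.append_left]
      split_ifs
      · ring
      · rw [mul_assoc, inv_mul_cancel₀ hε, mul_one]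
    · intro k
      rw [hu, Fin.append_right]
  have h1 := (mem_tangent.1 hw).1
  have hnonneg : ∀ y, c y ∈ G.image c →
      0 ≤ (sidePoly m (G.image c) ε (c y) w).eval (t y) := by
    intro y hy
    by_cases hyG : y ∈ G
    · exact (h1 y hyG).ge
    · exact (hpos y hy hyG).le
  refine ⟨-u, ?_⟩
  ext x
  simp only [mem_topSet, LinearMap.neg_apply, neg_le_neg_iff]
  constructor
  · rintro ⟨hx, h⟩
    by_contra hxG
    obtain ⟨y, hy, hyx⟩ := mem_image.1 hx
    have h2 := h y hyx
    have h3 := hpos x hx hxG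
    have h4 := h1 y hy
    rw [hside x hx] at h3
    rw [hside y (mem_image_of_mem c hy), hyx] at h4
    linarith
  · intro hx
    refine ⟨mem_image_of_mem c hx, fun y hy => ?_⟩
    have hx' := mem_image_of_mem c hx
    have h2 := h1 x hx
    have h3 := hnonneg y (hy ▸ hx')
    rw [hside x hx'] at h2
    rw [hside y (hy ▸ hx'), hy] at h3
    linarith

lemma eventually_exists_topSet_eq (ht : Function.Injective t) (hs : ∀ x, t x ∈ slot (c x))
    (hG : 2 * G.card + 1 ≤ 3 + m + (G.image c).card) (hS : 2 ≤ (G.image c).card) :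
    ∀ᶠ ε in 𝓝 (0 : ℝ), ε ≠ 0 →
      ∃ u, topSet c (curvePoint (perturbed m ε) c t) (G.image c) u = G := by
  let P : Set (ℝ × Coeffs m) := {z | ∀ y, c y ∈ G.image c → y ∉ G →
    0 < (sidePoly m (G.image c) z.1 (c y) z.2).eval (t y)}
  let N : Set (ℝ × Coeffs m) := {z | ∀ y, c y ∈ G.image c → y ∉ G →
    (sidePoly m (G.image c) z.1 (c y) z.2).eval (t y) < 0}
  have hP : IsOpen P := by
    simp only [P, Set.ofPred_forall]
    exact isOpen_iInter_of_finite fun y => isOpen_iInter_of_finite fun _ =>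
      isOpen_iInter_of_finite fun _ => isOpen_lt continuous_const (continuous_eval_sidePoly _ _)
  have hN : IsOpen N := by
    simp only [N, Set.ofPred_forall]
    exact isOpen_iInter_of_finite fun y => isOpen_iInter_of_finite fun _ =>
      isOpen_iInter_of_finite fun _ => isOpen_lt (continuous_eval_sidePoly _ _) continuous_const
  have key := eventually_forall_ne_zero
    ((isClosed_tangent (c := c) (t := t) (m := m) (G := G)).isOpen_compl.union (hP.union hN)) ?_ ?_
  · filter_upwards [key] with ε hε hε0
    obtain ⟨w, hw, hw0⟩ := exists_mem_tangent_ne_zero (t := t) hG ε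
    rcases hε w hw0 with h | h | h
    · exact absurd hw h
    · exact topSet_eq_of_mem_tangent hε0 hw h
    · refine topSet_eq_of_mem_tangent hε0 (neg_mem hw) fun y hy hyG => ?_
      rw [map_neg, eval_neg]
      exact neg_pos.2 (h y hy hyG)
  · rintro ε w s hs (h | h | h)
    · exact Or.inl fun hw => h (Submodule.smul_mem (tangent c t m G ε) s hw)
    · refine Or.inr (Or.inl fun y hy hyG => ?_)
      have := h y hy hyG
      rw [map_smul, eval_smul, smul_eq_mul] at this
      exact pos_of_mul_pos_right this hs.le
    · refine Or.inr (Or.inr fun y hy hyG => ?_)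
      have := h y hy hyG
      rw [map_smul, eval_smul, smul_eq_mul] at this
      exact neg_of_mul_neg_right this hs.le
  · intro w hw0
    by_cases hw : w ∈ tangent c t m G 0
    · have hne := leadingCoeff_ne_zero.2 (secondPoly_ne_zero_of_mem_tangent hS hw hw0)
      rcases hne.lt_or_gt with h | h
      · refine Or.inr (Or.inr fun y hy hyG => ?_)
        have := pos_of_mem_tangent ht hs hS (neg_mem hw)
          (by rw [map_neg, leadingCoeff_neg]; exact neg_pos.2 h) hy hyG
        rw [map_neg, eval_neg] at this
        exact neg_pos.1 this
      · exact Or.inr (Or.inl fun y hy hyG => pos_of_mem_tangent ht hs hS hw h hy hyG)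
    · exact Or.inl hw

lemma exists_generic_neighborly_perturbed (ht : Function.Injective t)
    (hs : ∀ x, t x ∈ slot (c x))
    (hlarge : ∀ i, 3 + m + 1 ≤ (univ.filter fun x => c x = i).card) :
    ∃ v : X → Vec (3 + m), Generic c v ∧ Neighborly c v := by
  have hev : ∀ᶠ ε in 𝓝 (0 : ℝ), ∀ G : Finset X,
      (G.card = 3 + m + (G.image c).card → (∀ x ∈ G, ∃ y ∈ G, y ≠ x ∧ c y = c x) →
        2 ≤ (G.image c).card → ε ≠ 0 →
        ∀ u ∈ flat c (curvePoint (perturbed m ε) c t) G, u = 0) ∧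
      (2 * G.card + 1 ≤ 3 + m + (G.image c).card → 2 ≤ (G.image c).card → ε ≠ 0 →
        ∃ u, topSet c (curvePoint (perturbed m ε) c t) (G.image c) u = G) := by
    refine eventually_all.2 fun G => Filter.Eventually.and ?_ ?_
    · simp only [eventually_imp_distrib_left]
      exact fun h1 h2 h3 => eventually_flat_eq_zero ht hs h1 h2 h3
    · simp only [eventually_imp_distrib_left]
      exact fun h1 h2 => eventually_exists_topSet_eq ht hs h1 h2
  obtain ⟨ε, hε, hε0⟩ := ((hev.filter_mono nhdsWithin_le_nhds).and
    (self_mem_nhdsWithin : ∀ᶠ ε in 𝓝[≠] (0 : ℝ), ε ≠ 0)).exists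
  have hmono : ∀ {G : Finset X}, G.Nonempty → ¬2 ≤ (G.image c).card →
      ∃ i, G.image c = {i} ∧ ∀ x ∈ G, c x = i := by
    intro G hne h
    have := (hne.image c).card_pos
    obtain ⟨i, hi⟩ := Finset.card_eq_one.1 (by omega : (G.image c).card = 1)
    exact ⟨i, hi, fun x hx => mem_singleton.1 (hi ▸ mem_image_of_mem c hx)⟩
  have hgen : Generic c (curvePoint (perturbed m ε) c t) := by
    refine generic_of_card_ge_two hlarge fun G hG h2 u hu => ?_
    by_cases hS : 2 ≤ (G.image c).card
    · exact (hε G).1 hG h2 hS hε0 u hu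
    · obtain ⟨i, hi, hGi⟩ := hmono (Finset.card_pos.1 (by omega)) hS
      rw [hi, card_singleton] at hG
      exact (momentLike_perturbed hε0 i).eq_zero_of_monochromatic ht hGi hG.ge hu
  refine ⟨_, hgen, hgen.neighborly_of_topSet fun G hne hG => ?_⟩
  by_cases hS : 2 ≤ (G.image c).card
  · exact (hε G).2 hG hS hε0
  · obtain ⟨i, hi, hGi⟩ := hmono hne hS
    rw [hi, card_singleton] at hG
    rw [hi]
    exact (momentLike_perturbed hε0 i).exists_topSet_eq ht hne hGi (by omega)

end ColoredConfig

namespace ColoredConfig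
open PolynomialZeros

section Vertices

variable {ι X : Type*} [DecidableEq ι] [Fintype X] [DecidableEq X] {d : ℕ} {c : X → ι}
  {v : X → Vec d}

lemma Neighborly.singleton_mem_faces (hn : Neighborly c v) (hd : 2 ≤ d) (x : X) :
    {x} ∈ faces c v {c x} := by
  have := hn {x} (singleton_nonempty x) (by simp; omega)
  rwa [image_singleton] at this

lemma Neighborly.exists_forall_lt (hn : Neighborly c v) (hd : 2 ≤ d) (x : X) :
    ∃ u : Module.Dual ℝ (Vec d), ∀ y, c y = c x → y ≠ x → u (v y) < u (v x) := by
  obtain ⟨u, -, hu⟩ := mem_faces.1 (hn.singleton_mem_faces hd x)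
  have hx := (mem_topSet.1 (hu ▸ mem_singleton_self x)).2
  refine ⟨u, fun y hy hyx => (hx y hy).lt_of_ne fun h => hyx ?_⟩
  rw [← mem_singleton, ← hu, mem_topSet]
  exact ⟨mem_singleton.2 hy, fun z hz => by rw [h]; exact hx z (hz.trans hy)⟩

lemma Neighborly.injOn (hn : Neighborly c v) (hd : 2 ≤ d) {x y : X} (hc : c x = c y)
    (h : v x = v y) : x = y := by
  obtain ⟨u, hu⟩ := hn.exists_forall_lt hd y
  by_contra hxy
  exact (hu x hc hxy).ne (by rw [h])

variable (c v) in
/-- The points of colour `i`. -/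
def colorVertices (i : ι) : Finset (Vec d) := (univ.filter fun x => c x = i).image v

lemma Neighborly.card_colorVertices (hn : Neighborly c v) (hd : 2 ≤ d) (i : ι) :
    (colorVertices c v i).card = (univ.filter fun x => c x = i).card := by
  refine card_image_of_injOn fun x hx y hy h => hn.injOn hd ?_ h
  rw [(mem_filter.1 (mem_coe.1 hx)).2, (mem_filter.1 (mem_coe.1 hy)).2]

lemma Neighborly.isPolytopeWithVertexSet (hn : Neighborly c v) (hd : 2 ≤ d) (i : ι) :
    IsPolytopeWithVertexSet (cell c v {i} univ) (colorVertices c v i) := by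
  constructor
  · rw [cell, Finset.sum_singleton, hull, colorVertices]
    simp
  · intro p hp
    obtain ⟨x, hx, rfl⟩ := mem_image.1 hp
    obtain rfl := (mem_filter.1 hx).2
    obtain ⟨u, hu⟩ := hn.exists_forall_lt hd x
    intro hmem
    have hsub : convexHull ℝ (((colorVertices c v (c x)).erase (v x) : Finset (Vec d)) :
        Set (Vec d)) ⊆ {w | u w < u (v x)} := by
      refine convexHull_min ?_ (convex_halfSpace_lt u.isLinear _)
      intro q hq
      obtain ⟨hqx, hq⟩ := mem_erase.1 (mem_coe.1 hq)
      obtain ⟨y, hy, rfl⟩ := mem_image.1 hq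
      exact hu y (mem_filter.1 hy).2 fun h => hqx (h ▸ rfl)
    exact lt_irrefl (u (v x)) (hsub hmem)

lemma Generic.fPoly_zero (hg : Generic c v) (hn : Neighborly c v) (hd : 2 ≤ d) (i : ι) :
    fPoly (cell c v {i} univ) 0 = (univ.filter fun x => c x = i).card := by
  rw [hg.fPoly_eq (singleton_nonempty i) 1 (by simp)]
  refine (Finset.card_bij (fun x _ => {x}) ?_ ?_ ?_).symm
  · intro x hx
    obtain rfl := (mem_filter.1 hx).2
    exact mem_filter.2 ⟨hn.singleton_mem_faces hd x, card_singleton x⟩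
  · intro x _ y _ h
    exact Finset.singleton_injective h
  · intro G hG
    obtain ⟨hG, hcard⟩ := mem_filter.1 hG
    obtain ⟨x, rfl⟩ := Finset.card_eq_one.1 hcard
    obtain ⟨u, -, hu⟩ := mem_faces.1 hG
    have hx := (mem_topSet.1 (hu ▸ mem_singleton_self x)).1
    exact ⟨x, mem_filter.2 ⟨mem_univ x, mem_singleton.1 hx⟩, rfl⟩

end Vertices

section Slots

variable {n : Fin 3 → ℕ}

/-- Parameters of the points of colour `i` in the interval `(i, i + 1)`. -/
def slotParam (x : Σ i : Fin 3, Fin (n i)) : ℝ :=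
  ((x.1 : ℕ) : ℝ) + (((x.2 : ℕ) : ℝ) + 1) / (n x.1 + 1)

lemma slotParam_mem_slot (x : Σ i : Fin 3, Fin (n i)) : slotParam x ∈ slot x.1 := by
  have h : ((x.2 : ℕ) : ℝ) < n x.1 := by exact_mod_cast x.2.2
  have h1 : (0 : ℝ) < n x.1 + 1 := by positivity
  constructor
  · have : (0 : ℝ) < (((x.2 : ℕ) : ℝ) + 1) / (n x.1 + 1) := by positivity
    simp only [slotParam]
    linarith
  · have : (((x.2 : ℕ) : ℝ) + 1) / (n x.1 + 1) < 1 := by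
      rw [div_lt_one h1]
      linarith
    simp only [slotParam]
    linarith

lemma slotParam_injective : Function.Injective (slotParam (n := n)) := by
  rintro ⟨i, a⟩ ⟨j, b⟩ h
  obtain rfl : i = j := eq_of_mem_slot (slotParam_mem_slot ⟨i, a⟩) (h ▸ slotParam_mem_slot ⟨j, b⟩)
  have h1 : ((n i : ℝ) + 1) ≠ 0 := by positivity
  simp only [slotParam, add_right_inj, div_left_inj' h1, add_left_inj, Nat.cast_inj] at h
  rw [Fin.ext h]

lemma card_filter_fst (i : Fin 3) :
    (univ.filter fun x : Σ i : Fin 3, Fin (n i) => x.1 = i).card = n i := by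
  rw [← Fintype.card_fin (n i), ← Finset.card_univ]
  refine (Finset.card_bij (fun a _ => ⟨i, a⟩) (by simp) (by simp) ?_).symm
  rintro ⟨j, a⟩ h
  obtain rfl := (mem_filter.1 h).2
  exact ⟨a, mem_univ a, rfl⟩

lemma exists_generic_neighborly {d : ℕ} (hd : 2 ≤ d) (hn : ∀ i, d + 1 ≤ n i) :
    ∃ v : (Σ i : Fin 3, Fin (n i)) → Vec d, Generic Sigma.fst v ∧ Neighborly Sigma.fst v := by
  rcases hd.eq_or_lt with rfl | hd
  · have hlarge : ∀ i, 3 ≤ (univ.filter fun x : Σ i : Fin 3, Fin (n i) => x.1 = i).card :=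
      fun i => by rw [card_filter_fst]; exact hn i
    exact ⟨_, generic_plane slotParam_injective slotParam_mem_slot hlarge,
      neighborly_plane slotParam_injective slotParam_mem_slot hlarge⟩
  · obtain ⟨m, rfl⟩ := Nat.exists_eq_add_of_le (Nat.succ_le_of_lt hd)
    exact exists_generic_neighborly_perturbed slotParam_injective slotParam_mem_slot
      fun i => by rw [card_filter_fst]; exact hn i

end Slots

end ColoredConfig

/-- For all `d ≥ 2` and `n₁, n₂, n₃ ≥ d+1` there exist three `d`-polytopes
in `ℝ^d` with the prescribed numbers of vertices attaining the upper bound on the number of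
`(k-1)`-faces of their Minkowski sum simultaneously for all `1 ≤ k ≤ d`. -/
theorem minkowski_sum_three_upper_bound_tight
    (d : ℕ) (hd : 2 ≤ d) (n : Fin 3 → ℕ) (hn : ∀ i, d + 1 ≤ n i) :
    ∃ (P : Fin 3 → Set (Vec d)) (V : Fin 3 → Finset (Vec d)),
      (∀ i, IsPolytopeWithVertexSet (P i) (V i)) ∧
      (∀ i, sdim (P i) = (d : ℤ)) ∧
      (∀ i, (V i).card = n i) ∧
      (∀ i, fPoly (P i) 0 = n i) ∧
      ∀ k : ℕ, 1 ≤ k → k ≤ d →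
        (fPoly (P 0 + P 1 + P 2) ((k : ℤ) - 1) : ℤ) = UB3 d n k := by
  obtain ⟨v, hg, hv⟩ := ColoredConfig.exists_generic_neighborly hd hn
  refine ⟨fun i => ColoredConfig.cell Sigma.fst v {i} univ, ColoredConfig.colorVertices Sigma.fst v,
    hv.isPolytopeWithVertexSet hd, fun i => hg.sdim_univ (singleton_nonempty i),
    fun i => by rw [hv.card_colorVertices hd, ColoredConfig.card_filter_fst],
    fun i => by rw [hg.fPoly_zero hv hd, ColoredConfig.card_filter_fst], fun k hk _ => ?_⟩
  have hsum : ColoredConfig.cell Sigma.fst v {0} univ + ColoredConfig.cell Sigma.fst v {1} univ +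
      ColoredConfig.cell Sigma.fst v {2} univ =
      ColoredConfig.cell Sigma.fst v univ univ := by
    simp only [ColoredConfig.cell, Finset.sum_singleton, Fin.sum_univ_three]
  have h0 := hn 0
  have hN : d + 2 + 1 ≤ n 0 + n 1 + n 2 := by have := hn 1; omega
  rw [hsum]
  exact hg.fPoly_eq_UB3 hv (ColoredConfig.generic_cyclicPoint (by omega) hN)
    (ColoredConfig.neighborly_cyclicPoint (by omega) hN) hd
    ColoredConfig.card_filter_fst ColoredConfig.cell_cyclicPoint (Fintype.card_fin _) k hk
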